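/- There exists an absolute constant c > 0 such that for every n, if A_n is drawn uniformly at random from the n × n symmetric matrices with entries in {-1, 1}, then ℙ(det(A_n) = 0) ≤ e^{-c n}. -/

import Mathlib

namespace SymSing

open scoped BigOperators

open Real

section Averages

variable {ι κ : Type*} [Fintype ι] [DecidableEq ι] [Fintype κ]

theorem expect_prod_pi {R : Type*} [Field R] [CharZero R] (f : ι → κ → R) :
    𝔼 h : ι → κ, ∏ i, f i (h i) = ∏ i, 𝔼 k, f i k := by
  simp only [Fintype.expect_eq_sum_div_card, Finset.prod_div_distrib, Finset.prod_const,
    Fintype.card_fun, Nat.cast_pow, Finset.card_univ]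
  congr 1
  exact (Finset.prod_univ_sum (fun _ => Finset.univ) f).symm ▸ by simp

theorem expect_prod_type {α β : Type*} [Fintype α] [Fintype β] (f : α × β → ℝ) :
    𝔼 p : α × β, f p = 𝔼 a, 𝔼 b, f (a, b) := by
  simp only [Fintype.expect_eq_sum_div_card, Fintype.sum_prod_type, Fintype.card_prod,
    Nat.cast_mul, Finset.sum_div]
  refine Finset.sum_congr rfl fun a _ => Finset.sum_congr rfl fun b _ => ?_
  rw [div_div, mul_comm]

theorem expect_nonneg' {α : Type*} [Fintype α] {f : α → ℝ} (h : ∀ a, 0 ≤ f a) : 0 ≤ 𝔼 a, f a :=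
  Finset.expect_nonneg fun a _ => h a

theorem expect_mono {α : Type*} [Fintype α] {f g : α → ℝ} (h : ∀ a, f a ≤ g a) :
    𝔼 a, f a ≤ 𝔼 a, g a :=
  Finset.expect_le_expect fun a _ => h a

theorem expect_le_of_forall_le {α : Type*} [Fintype α] [Nonempty α] {f : α → ℝ} {c : ℝ}
    (h : ∀ a, f a ≤ c) : 𝔼 a, f a ≤ c :=
  Finset.expect_le Finset.univ_nonempty fun a _ => h a

theorem le_expect_of_forall_le {α : Type*} [Fintype α] [Nonempty α] {f : α → ℝ} {c : ℝ}
    (h : ∀ a, c ≤ f a) : c ≤ 𝔼 a, f a :=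
  Finset.le_expect Finset.univ_nonempty fun a _ => h a

theorem expect_cos_add_sum (X : κ → ℝ) (hX : ∀ t, 𝔼 k, sin (X k * t) = 0) (a : ℝ) (t : ι → ℝ) :
    𝔼 h : ι → κ, cos (a + ∑ i, X (h i) * t i) = cos a * ∏ i, 𝔼 k, cos (X k * t i) := by
  have key : ∀ t : ℝ, 𝔼 k, Complex.exp ((X k * t : ℝ) * Complex.I) =
      ((𝔼 k, cos (X k * t) : ℝ) : ℂ) := by
    intro t
    have h1 := hX t
    rw [Fintype.expect_eq_sum_div_card] at h1 ⊢
    rw [Fintype.expect_eq_sum_div_card]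
    rcases isEmpty_or_nonempty κ with hk | hk
    · simp
    have h2 : ∑ k, sin (X k * t) = 0 := by
      have : (Fintype.card κ : ℝ) ≠ 0 := by positivity
      simpa [this] using h1
    push_cast
    congr 1
    simp_rw [Complex.exp_mul_I, Finset.sum_add_distrib, ← Finset.sum_mul]
    have : ∑ k, Complex.sin (X k * t) = 0 := by exact_mod_cast congrArg (fun x : ℝ => (x : ℂ)) h2
    simp [this]
  have h1 := expect_prod_pi (fun (i : ι) (k : κ) => Complex.exp ((X k * t i : ℝ) * Complex.I))
  simp_rw [key, ← Complex.exp_sum, ← Finset.sum_mul] at h1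
  have h2 : 𝔼 h : ι → κ, Complex.exp ((a + ∑ i, X (h i) * t i : ℝ) * Complex.I) =
      Complex.exp (a * Complex.I) * ∏ i, ((𝔼 k, cos (X k * t i) : ℝ) : ℂ) := by
    rw [← h1, Finset.mul_expect]
    refine Finset.expect_congr rfl fun h _ => ?_
    rw [← Complex.exp_add]
    push_cast
    ring_nf
  have h3 := congrArg Complex.re h2
  rw [← Complex.ofReal_prod, Complex.re_mul_ofReal, Complex.exp_ofReal_mul_I_re] at h3
  rw [← h3, Fintype.expect_eq_sum_div_card, Fintype.expect_eq_sum_div_card]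
  rw [Complex.div_natCast_re, Complex.re_sum]
  simp only [Complex.exp_ofReal_mul_I_re]

end Averages

/-- The sign `±1` of a Boolean. -/
def sg (b : Bool) : ℝ := if b then 1 else -1

/-- Half of the time-difference of two lazy signs: `2`, `-2` with probability `1/8` each,
and `0` otherwise. -/
def lz (k : Fin 8) : ℝ := if k = 0 then 2 else if k = 1 then -2 else 0

/-- The characteristic function of `lz`. -/
noncomputable def phi (x : ℝ) : ℝ := 1 - sin x ^ 2 / 2

theorem abs_sg (b : Bool) : |sg b| = 1 := by cases b <;> simp [sg]

theorem expect_bool (f : Bool → ℝ) : 𝔼 b, f b = (f true + f false) / 2 := by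
  rw [Fintype.expect_eq_sum_div_card]; simp

theorem expect_lz (f : ℝ → ℝ) : 𝔼 k, f (lz k) = f 2 / 8 + f (-2) / 8 + 3 / 4 * f 0 := by
  rw [Fintype.expect_eq_sum_div_card]
  simp [Fin.sum_univ_succ, lz]
  ring

theorem abs_lz_le (k : Fin 8) : |lz k| ≤ 2 := by
  unfold lz; split_ifs <;> norm_num

theorem expect_cos_sg {ι : Type*} [Fintype ι] [DecidableEq ι] (a : ℝ) (t : ι → ℝ) :
    𝔼 h : ι → Bool, cos (a + ∑ i, sg (h i) * t i) = cos a * ∏ i, cos (t i) := by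
  rw [expect_cos_add_sum]
  · congr 1
    refine Finset.prod_congr rfl fun i _ => ?_
    rw [expect_bool]
    simp [sg]
  · intro t
    rw [expect_bool]
    simp [sg]

theorem expect_cos_lz {ι : Type*} [Fintype ι] [DecidableEq ι] (a : ℝ) (t : ι → ℝ) :
    𝔼 h : ι → Fin 8, cos (a + ∑ i, lz (h i) * t i) = cos a * ∏ i, phi (t i) := by
  rw [expect_cos_add_sum]
  · congr 1
    refine Finset.prod_congr rfl fun i _ => ?_
    rw [expect_lz (fun x => cos (x * t i)), phi, sin_sq_eq_half_sub]
    simp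
    ring
  · intro t
    rw [expect_lz (fun x => sin (x * t))]
    simp
    ring

theorem phi_le_one (x : ℝ) : phi x ≤ 1 := by
  unfold phi; nlinarith [sq_nonneg (sin x)]

theorem half_le_phi (x : ℝ) : 1 / 2 ≤ phi x := by
  unfold phi; nlinarith [sin_sq_le_one x]

theorem phi_pos (x : ℝ) : 0 < phi x := by linarith [half_le_phi x]

theorem abs_cos_le_phi (x : ℝ) : |cos x| ≤ phi x := by
  have h := sin_sq_add_cos_sq x
  unfold phi
  nlinarith [sq_nonneg (|cos x| - 1), sq_abs (cos x)]

theorem phi_le_exp (x : ℝ) : phi x ≤ exp (-(sin x ^ 2) / 2) := by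
  unfold phi
  linarith [add_one_le_exp (-(sin x ^ 2) / 2)]

theorem sin_sq_le_sq (x : ℝ) : sin x ^ 2 ≤ x ^ 2 := by
  rw [sq_le_sq]
  exact abs_sin_le_abs

theorem exp_neg_le_one_sub_half {y : ℝ} (h0 : 0 ≤ y) (h1 : y ≤ 1) : exp (-(3 / 4 * y)) ≤ 1 - y / 2 := by
  have hc := convexOn_exp.2 (Set.mem_univ (0 : ℝ)) (Set.mem_univ (-(3 / 4 : ℝ)))
    (by linarith : 0 ≤ 1 - y) h0 (by ring)
  simp only [smul_eq_mul, mul_zero, zero_add, exp_zero, mul_one] at hc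
  have h2 : exp (-(3 / 4 : ℝ)) ≤ 1 / 2 := by
    rw [exp_neg, inv_eq_one_div]
    apply one_div_le_one_div_of_le (by norm_num)
    have := quadratic_le_exp_of_nonneg (x := 3 / 4) (by norm_num)
    linarith
  have e : y * -(3 / 4 : ℝ) = -(3 / 4 * y) := by ring
  rw [e] at hc
  nlinarith

theorem exp_neg_sq_le_phi (x : ℝ) : exp (-x ^ 2) ≤ phi x := by
  have h := exp_neg_le_one_sub_half (sq_nonneg (sin x)) (sin_sq_le_one x)
  refine le_trans (exp_le_exp.2 ?_) h
  nlinarith [sin_sq_le_sq x, sq_nonneg (sin x)]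

theorem sin_sq_add_le (a b : ℝ) : sin (a + b) ^ 2 ≤ 2 * sin a ^ 2 + 2 * sin b ^ 2 := by
  rw [sin_add]
  have h1 := sin_sq_add_cos_sq a
  have h2 := sin_sq_add_cos_sq b
  have : (sin a * cos b + cos a * sin b) ^ 2 ≤ 2 * (sin a * cos b) ^ 2 + 2 * (cos a * sin b) ^ 2 := by
    nlinarith [sq_nonneg (sin a * cos b - cos a * sin b)]
  refine this.trans ?_
  have h3 : cos b ^ 2 ≤ 1 := cos_sq_le_one b
  have h4 : cos a ^ 2 ≤ 1 := cos_sq_le_one a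
  nlinarith [mul_le_mul_of_nonneg_left h3 (sq_nonneg (sin a)),
    mul_le_mul_of_nonneg_left h4 (sq_nonneg (sin b))]

theorem sin_sq_le_of_add (a b : ℝ) : sin a ^ 2 ≤ 2 * sin (a + b) ^ 2 + 2 * b ^ 2 := by
  have h := sin_sq_add_le (a + b) (-b)
  rw [add_neg_cancel_right, sin_neg, neg_sq] at h
  linarith [sin_sq_le_sq b]

theorem phi_cube_mul_le (a b : ℝ) : phi a ^ 3 * phi b ^ 3 ≤ phi (a + b) := by
  have h := exp_neg_le_one_sub_half (sq_nonneg (sin (a + b))) (sin_sq_le_one (a + b))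
  refine le_trans ?_ h
  have ha := pow_le_pow_left₀ (phi_pos a).le (phi_le_exp a) 3
  have hb := pow_le_pow_left₀ (phi_pos b).le (phi_le_exp b) 3
  calc phi a ^ 3 * phi b ^ 3 ≤ exp (-(sin a ^ 2) / 2) ^ 3 * exp (-(sin b ^ 2) / 2) ^ 3 := by
        gcongr
        exact pow_nonneg (phi_pos b).le _
    _ = exp (3 * (-(sin a ^ 2) / 2) + 3 * (-(sin b ^ 2) / 2)) := by
        rw [exp_add, ← exp_nat_mul, ← exp_nat_mul]; norm_num
    _ ≤ _ := by
        apply exp_le_exp.2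
        linarith [sin_sq_add_le a b]

end SymSing

namespace SymSing

open scoped BigOperators

open Real MeasureTheory ProbabilityTheory

/-- The standard Gaussian measure on `ι → ℝ`. -/
noncomputable def gam (ι : Type*) [Fintype ι] : Measure (ι → ℝ) :=
  Measure.pi fun _ => gaussianReal 0 1

instance (ι : Type*) [Fintype ι] : IsProbabilityMeasure (gam ι) := by
  unfold gam; infer_instance

variable {ι : Type*} [Fintype ι]

theorem integral_gauss_cos (a : ℝ) (y : ι → ℝ) :
    ∫ ξ, cos (a + ∑ i, ξ i * y i) ∂gam ι = cos a * exp (-(∑ i, y i ^ 2) / 2) := by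
  have h1 : ∫ ξ, ∏ i, Complex.exp ((ξ i * y i : ℝ) * Complex.I) ∂gam ι =
      ∏ i, Complex.exp (-(y i : ℂ) ^ 2 / 2) := by
    unfold gam
    rw [integral_fintype_prod_eq_prod (fun i (x : ℝ) => Complex.exp ((x * y i : ℝ) * Complex.I))]
    refine Finset.prod_congr rfl fun i _ => ?_
    have := charFun_gaussianReal (μ := 0) (v := 1) (y i)
    rw [charFun_apply_real] at this
    rw [show (fun x : ℝ => Complex.exp ((x * y i : ℝ) * Complex.I)) =
      fun x : ℝ => Complex.exp (y i * x * Complex.I) by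
        funext x; push_cast; ring_nf]
    rw [this]
    simp
    ring_nf
  have h2 : ∫ ξ, Complex.exp ((a + ∑ i, ξ i * y i : ℝ) * Complex.I) ∂gam ι =
      Complex.exp (a * Complex.I) * ((exp (-(∑ i, y i ^ 2) / 2) : ℝ) : ℂ) := by
    have e : ((exp (-(∑ i, y i ^ 2) / 2) : ℝ) : ℂ) = ∏ i, Complex.exp (-(y i : ℂ) ^ 2 / 2) := by
      rw [← Complex.exp_sum]
      push_cast
      congr 1
      rw [← Finset.sum_div, Finset.sum_neg_distrib]
    rw [e, ← h1, ← integral_const_mul]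
    congr 1
    funext ξ
    rw [← Complex.exp_sum, ← Complex.exp_add]
    congr 1
    push_cast
    rw [add_mul, Finset.sum_mul]
  have h3 := congrArg Complex.re h2
  rw [Complex.re_mul_ofReal, Complex.exp_ofReal_mul_I_re] at h3
  rw [← h3]
  have hintg : Integrable (fun ξ : ι → ℝ => Complex.exp ((a + ∑ i, ξ i * y i : ℝ) * Complex.I))
      (gam ι) := by
    refine Integrable.of_bound (C := 1) ?_ ?_
    · exact Continuous.aestronglyMeasurable (by fun_prop)
    · exact Filter.Eventually.of_forall fun ξ => by rw [Complex.norm_exp_ofReal_mul_I]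
  have := integral_re hintg
  simp only [RCLike.re_to_complex, Complex.exp_ofReal_mul_I_re] at this
  exact this

theorem integral_gauss_exp (y : ι → ℝ) :
    ∫ ξ, exp (∑ i, ξ i * y i) ∂gam ι = exp ((∑ i, y i ^ 2) / 2) := by
  simp_rw [exp_sum]
  unfold gam
  rw [integral_fintype_prod_eq_prod (fun i (x : ℝ) => exp (x * y i)), Finset.sum_div, exp_sum]
  refine Finset.prod_congr rfl fun i _ => ?_
  have := mgf_gaussianReal (X := id) (p := gaussianReal 0 1) (μ := 0) (v := 1)
    (by simp) (y i)
  rw [mgf] at this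
  simp only [id] at this
  simp_rw [mul_comm _ (y i)]
  rw [this]
  simp

theorem integrable_gauss_exp (y : ι → ℝ) :
    Integrable (fun ξ => exp (∑ i, ξ i * y i)) (gam ι) := by
  by_contra h
  have := integral_gauss_exp y
  rw [integral_undef h] at this
  exact (exp_pos _).ne this

theorem integral_exp_sq_one {c : ℝ} (hc : c < 1 / 2) :
    ∫ x, exp (c * x ^ 2) ∂gaussianReal 0 1 = (√(1 - 2 * c))⁻¹ := by
  rw [integral_gaussianReal_eq_integral_smul one_ne_zero]
  simp only [gaussianPDFReal, smul_eq_mul, sub_zero, NNReal.coe_one, mul_one]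
  have : ∀ x : ℝ, (√(2 * π))⁻¹ * exp (-x ^ 2 / 2) * exp (c * x ^ 2) =
      (√(2 * π))⁻¹ * exp (-(1 / 2 - c) * x ^ 2) := by
    intro x
    rw [mul_assoc, ← exp_add]
    ring_nf
  simp_rw [this]
  rw [integral_const_mul, integral_gaussian]
  rw [← sqrt_inv, ← sqrt_inv, ← sqrt_mul (by positivity)]
  congr 1
  have : 1 - 2 * c ≠ 0 := by linarith
  have : 1 / 2 - c ≠ 0 := by linarith
  field_simp
  
theorem integral_gauss_exp_sq {c : ℝ} (hc : c < 1 / 2) :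
    ∫ ξ, exp (c * ∑ i, ξ i ^ 2) ∂gam ι = ((√(1 - 2 * c))⁻¹) ^ Fintype.card ι := by
  simp_rw [Finset.mul_sum, exp_sum]
  unfold gam
  rw [integral_fintype_prod_eq_prod (fun i (x : ℝ) => exp (c * x ^ 2))]
  simp [integral_exp_sq_one hc]

theorem integrable_gauss_exp_sq {c : ℝ} (hc : c < 1 / 2) :
    Integrable (fun ξ => exp (c * ∑ i, ξ i ^ 2)) (gam ι) := by
  by_contra h
  have h1 := integral_gauss_exp_sq (ι := ι) hc
  rw [integral_undef h] at h1
  have : 0 < 1 - 2 * c := by linarith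
  have : 0 < ((√(1 - 2 * c))⁻¹) ^ Fintype.card ι := by positivity
  exact this.ne h1

theorem integrable_gam_of_bound {f : (ι → ℝ) → ℝ} (hf : Continuous f) (C : ℝ)
    (hC : ∀ x, |f x| ≤ C) : Integrable f (gam ι) :=
  Integrable.of_bound hf.aestronglyMeasurable C (Filter.Eventually.of_forall hC)

theorem exp_neg_eq_integral (y : ι → ℝ) :
    exp (-(∑ i, y i ^ 2) / 2) = ∫ ξ, cos (∑ i, ξ i * y i) ∂gam ι := by
  have := integral_gauss_cos 0 y
  simpa using this.symm

theorem expect_integral {α : Type*} [Fintype α] {Ω : Type*} [MeasurableSpace Ω] (μ : Measure Ω)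
    (f : α → Ω → ℝ) (hf : ∀ a, Integrable (f a) μ) :
    𝔼 a, ∫ x, f a x ∂μ = ∫ x, 𝔼 a, f a x ∂μ := by
  simp_rw [Fintype.expect_eq_sum_div_card]
  rw [integral_div, integral_finsetSum _ fun a _ => hf a]

end SymSing

namespace SymSing

open scoped BigOperators

open Real

theorem expect_equiv {α β : Type*} [Fintype α] [Fintype β] (e : α ≃ β) (f : β → ℝ) :
    𝔼 a, f (e a) = 𝔼 b, f b :=
  Fintype.expect_equiv e _ _ fun _ => rfl

theorem expect_update {ι κ : Type*} [Fintype ι] [DecidableEq ι] [Fintype κ] [Nonempty κ] (i : ι)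
    (g : (ι → κ) → ℝ) : 𝔼 h, g h = 𝔼 h, 𝔼 k, g (Function.update h i k) := by
  have e := (Equiv.funSplitAt i κ).symm
  rw [← expect_equiv (Equiv.funSplitAt i κ).symm, ← expect_equiv (Equiv.funSplitAt i κ).symm,
    expect_prod_type, expect_prod_type]
  have : ∀ (a : κ) (b : {j // j ≠ i} → κ) (k : κ),
      Function.update ((Equiv.funSplitAt i κ).symm (a, b)) i k =
        (Equiv.funSplitAt i κ).symm (k, b) := by
    intro a b k
    funext j
    by_cases hj : j = i
    · subst hj; simp [Equiv.funSplitAt, Equiv.piSplitAt]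
    · simp [Equiv.funSplitAt, Equiv.piSplitAt, hj]
  simp_rw [this]
  rw [Fintype.expect_const, Finset.expect_comm]

section Tilt

theorem mul_sinh_le (t : ℝ) : t * sinh t ≤ t ^ 2 * cosh t := by
  have hd : ∀ x : ℝ, HasDerivAt (fun x => x * cosh x - sinh x) (x * sinh x) x := by
    intro x
    exact (((hasDerivAt_id' x).mul (hasDerivAt_cosh x)).sub (hasDerivAt_sinh x)).congr_deriv
      (by ring)
  have hm : Monotone fun x => x * cosh x - sinh x := by
    refine monotone_of_hasDerivAt_nonneg hd fun x => ?_
    rcases le_total 0 x with h | h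
    · exact mul_nonneg h (sinh_nonneg_iff.2 h)
    · exact mul_nonneg_of_nonpos_of_nonpos h (sinh_nonpos_iff.2 h)
  rcases le_total 0 t with h | h
  · have := hm h
    simp only [zero_mul, sinh_zero, sub_zero] at this
    nlinarith
  · have := hm h
    simp only [zero_mul, sinh_zero, sub_zero] at this
    nlinarith

theorem tilt_one_step {p β : ℝ} (hp0 : 0 ≤ p) (hp1 : p ≤ 1) :
    p / 2 * 𝔼 k, exp (-(1 / 64 * (2 * lz k * β + p * lz k ^ 2))) ≤
      𝔼 k, lz k * (β + p * lz k) * exp (-(1 / 64 * (2 * lz k * β + p * lz k ^ 2))) +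
      1 / 4 * 𝔼 k, (β + p * lz k) ^ 2 * exp (-(1 / 64 * (2 * lz k * β + p * lz k ^ 2))) := by
  rw [expect_lz (fun x => exp (-(1 / 64 * (2 * x * β + p * x ^ 2)))),
    expect_lz (fun x => x * (β + p * x) * exp (-(1 / 64 * (2 * x * β + p * x ^ 2)))),
    expect_lz (fun x => (β + p * x) ^ 2 * exp (-(1 / 64 * (2 * x * β + p * x ^ 2))))]
  have e1 : exp (-(1 / 64 * (2 * 2 * β + p * 2 ^ 2))) = exp (-(p / 16)) * exp (-(β / 16)) := by
    rw [← exp_add]; ring_nf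
  have e2 : exp (-(1 / 64 * (2 * -2 * β + p * (-2) ^ 2))) = exp (-(p / 16)) * exp (β / 16) := by
    rw [← exp_add]; ring_nf
  have e3 : exp (-(1 / 64 * (2 * 0 * β + p * 0 ^ 2))) = 1 := by simp
  rw [e1, e2, e3]
  set E := exp (-(p / 16)) with hE
  set u := exp (-(β / 16)) with hu
  set v := exp (β / 16) with hv
  have hE' : 15 / 16 ≤ E := by
    have := add_one_le_exp (-(p / 16)); linarith
  have huv : 2 ≤ u + v := by
    have h1 := add_one_le_exp (-(β / 16)); have h2 := add_one_le_exp (β / 16); linarith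
  have hu0 : 0 < u := exp_pos _
  have hv0 : 0 < v := exp_pos _
  have hs : β * (v - u) ≤ β ^ 2 / 16 * (v + u) := by
    have h1 : ∀ t : ℝ, t * (exp t - exp (-t)) ≤ t ^ 2 * (exp t + exp (-t)) := by
      intro t
      have := mul_sinh_le t
      rw [sinh_eq, cosh_eq] at this
      linarith
    have := h1 (β / 16)
    rw [← hu, ← hv] at this
    nlinarith
  have hQ : β ^ 2 * (v + u) ≤ 2 * ((β + 2 * p) ^ 2 * u + (β - 2 * p) ^ 2 * v)
      + 8 * p ^ 2 * (v + u) := by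
    nlinarith [mul_nonneg hu0.le (sq_nonneg (β + 4 * p)), mul_nonneg hv0.le (sq_nonneg (β - 4 * p))]
  have hE0 : 0 < E := exp_pos _
  have h1 : E * (β * (v - u)) ≤ E / 16 * (2 * ((β + 2 * p) ^ 2 * u + (β - 2 * p) ^ 2 * v)
      + 8 * p ^ 2 * (v + u)) := by nlinarith
  have h2 : p ^ 2 * (E * (v + u)) ≤ p * (E * (v + u)) := by
    apply mul_le_mul_of_nonneg_right _ (by positivity); nlinarith
  have h3 : p * (15 / 8) ≤ p * (E * (v + u)) := by
    apply mul_le_mul_of_nonneg_left _ hp0; nlinarith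
  nlinarith [sq_nonneg β]

variable {ι : Type*} [Fintype ι] [DecidableEq ι]

theorem quad_add_single (P : Matrix ι ι ℝ) (hs : P.IsSymm) (w : ι → ℝ) (i : ι) (x : ℝ) :
    (w + Pi.single i x) ⬝ᵥ P.mulVec (w + Pi.single i x) =
      w ⬝ᵥ P.mulVec w + (2 * x * P.mulVec w i + P i i * x ^ 2) := by
  have h1 : w ⬝ᵥ P.mulVec (Pi.single i x) = x * P.mulVec w i := by
    rw [Matrix.dotProduct_mulVec, ← Matrix.mulVec_transpose, hs.eq, dotProduct_single, mul_comm]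
  rw [Matrix.mulVec_add, dotProduct_add, add_dotProduct, add_dotProduct, h1,
    single_dotProduct, single_dotProduct, Matrix.mulVec_single]
  simp
  ring

/-- A lazy vector has a large projection onto any `k`-dimensional subspace, in an exponential
moment sense. -/
theorem expect_exp_neg_quad_le (P : Matrix ι ι ℝ) (hs : P.IsSymm) (hP : P * P = P) :
    𝔼 h : ι → Fin 8, exp (-(1 / 64 * ((fun i => lz (h i)) ⬝ᵥ P.mulVec fun i => lz (h i)))) ≤
      exp (-(P.trace / 160)) := by
  set L : (ι → Fin 8) → ι → ℝ := fun h i => lz (h i) with hL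
  set Y : (ι → Fin 8) → ℝ := fun h => L h ⬝ᵥ P.mulVec (L h) with hY
  set ω : (ι → Fin 8) → ℝ := fun h => exp (-(1 / 64 * Y h)) with hω
  have hdiag : ∀ i, P i i = ∑ j, P i j ^ 2 := by
    intro i
    conv_lhs => rw [← hP]
    rw [Matrix.mul_apply]
    refine Finset.sum_congr rfl fun j _ => ?_
    rw [sq, hs.apply i j]
  have hp0 : ∀ i, 0 ≤ P i i := fun i => by rw [hdiag i]; positivity
  have hp1 : ∀ i, P i i ≤ 1 := fun i => by
    have h1 : P i i ^ 2 ≤ P i i := by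
      conv_rhs => rw [hdiag i]
      exact Finset.single_le_sum (f := fun j => P i j ^ 2) (fun j _ => sq_nonneg _)
        (Finset.mem_univ i)
    nlinarith [hp0 i]
  have hYsq : ∀ h, Y h = ∑ i, P.mulVec (L h) i ^ 2 := by
    intro h
    have : P.mulVec (L h) ⬝ᵥ P.mulVec (L h) = Y h := by
      rw [Matrix.dotProduct_mulVec, ← Matrix.mulVec_transpose, hs.eq, Matrix.mulVec_mulVec, hP,
        dotProduct_comm]
    rw [← this]
    simp [dotProduct, sq]
  have step : ∀ i, P i i / 2 * 𝔼 h, ω h ≤ 𝔼 h, L h i * P.mulVec (L h) i * ω h +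
      1 / 4 * 𝔼 h, P.mulVec (L h) i ^ 2 * ω h := by
    intro i
    rw [expect_update i ω, expect_update i fun h => L h i * P.mulVec (L h) i * ω h,
      expect_update i fun h => P.mulVec (L h) i ^ 2 * ω h, Finset.mul_expect, Finset.mul_expect,
      ← Finset.expect_add_distrib]
    refine expect_mono fun h => ?_
    set w : ι → ℝ := Function.update (L h) i 0 with hw
    have hLu : ∀ k, L (Function.update h i k) = w + Pi.single i (lz k) := by
      intro k
      funext j
      by_cases hj : j = i
      · subst hj; simp [hL, hw]
      · simp [hL, hw, hj]
    have hwi : w i = 0 := by simp [hw]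
    have h2 : ∀ k, P.mulVec (L (Function.update h i k)) i = P.mulVec w i + P i i * lz k := by
      intro k
      rw [hLu, Matrix.mulVec_add, Matrix.mulVec_single]
      simp [mul_comm]
    have h3 : ∀ k, ω (Function.update h i k) = exp (-(1 / 64 * (w ⬝ᵥ P.mulVec w))) *
        exp (-(1 / 64 * (2 * lz k * P.mulVec w i + P i i * lz k ^ 2))) := by
      intro k
      simp only [hω, hY]
      rw [hLu, quad_add_single P hs, ← exp_add]
      ring_nf
    have h4 : ∀ k, L (Function.update h i k) i = lz k := by intro k; simp [hL]
    simp_rw [h2, h3, h4]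
    have key := mul_le_mul_of_nonneg_left (tilt_one_step (β := P.mulVec w i) (hp0 i) (hp1 i))
      (exp_pos (-(1 / 64 * (w ⬝ᵥ P.mulVec w)))).le
    simp only [mul_add (exp (-(1 / 64 * (w ⬝ᵥ P.mulVec w)))), Finset.mul_expect,
      ← Finset.expect_add_distrib] at key ⊢
    refine (le_of_eq ?_).trans (key.trans (le_of_eq ?_))
    all_goals
      refine Finset.expect_congr rfl fun k _ => ?_
      ring
  have hsum : P.trace / 2 * 𝔼 h, ω h ≤ 5 / 4 * 𝔼 h, Y h * ω h := by
    have := Finset.sum_le_sum fun i (_ : i ∈ Finset.univ) => step i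
    rw [← Finset.sum_mul, ← Finset.sum_div, Finset.sum_add_distrib, ← Finset.mul_sum,
      ← Finset.expect_sum_comm, ← Finset.expect_sum_comm] at this
    simp_rw [← Finset.sum_mul, ← hYsq] at this
    have e : ∀ h, ∑ i, L h i * P.mulVec (L h) i = Y h := fun h => rfl
    simp_rw [e] at this
    change P.trace / 2 * _ ≤ _ at this
    linarith
  have hone : (1 : ℝ) = 𝔼 h, ω h * exp (1 / 64 * Y h) := by
    have : ∀ h, ω h * exp (1 / 64 * Y h) = 1 := fun h => by
      change exp (-(1 / 64 * Y h)) * _ = 1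
      rw [← exp_add, neg_add_cancel, exp_zero]
    exact ((Finset.expect_congr rfl fun h _ => this h).trans (Fintype.expect_const 1)).symm
  have hJ : exp (P.trace / 160) * 𝔼 h, ω h ≤ 1 := by
    set a := 2 / 5 * P.trace with ha
    have h1 : 𝔼 h, ω h * (exp (1 / 64 * a) * (1 + 1 / 64 * (Y h - a))) ≤ 1 := by
      refine le_trans ?_ hone.ge
      refine expect_mono fun h => mul_le_mul_of_nonneg_left ?_ (exp_pos _).le
      have : exp (1 / 64 * Y h) = exp (1 / 64 * a) * exp (1 / 64 * (Y h - a)) := by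
        rw [← exp_add]; ring_nf
      rw [this]
      refine mul_le_mul_of_nonneg_left ?_ (exp_pos _).le
      linarith [add_one_le_exp (1 / 64 * (Y h - a))]
    have h2 : 𝔼 h, ω h * (exp (1 / 64 * a) * (1 + 1 / 64 * (Y h - a))) =
        exp (1 / 64 * a) * ((𝔼 h, ω h) + 1 / 64 * (𝔼 h, Y h * ω h) - a / 64 * 𝔼 h, ω h) := by
      rw [Finset.mul_expect, Finset.mul_expect, ← Finset.expect_add_distrib,
        ← Finset.expect_sub_distrib, Finset.mul_expect]
      refine Finset.expect_congr rfl fun h _ => ?_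
      ring
    rw [h2] at h1
    have e : 1 / 64 * a = P.trace / 160 := by rw [ha]; ring
    rw [e] at h1
    refine le_trans (mul_le_mul_of_nonneg_left ?_ (exp_pos _).le) h1
    rw [ha]
    nlinarith
  rw [exp_neg]
  rw [← one_div, le_div_iff₀ (exp_pos _)]
  linarith

end Tilt

end SymSing

namespace SymSing

open scoped BigOperators

open Real MeasureTheory ProbabilityTheory

variable {ι : Type*} [Fintype ι] [DecidableEq ι]

theorem continuous_phi : Continuous phi := by unfold phi; fun_prop

theorem abs_prod_phi_le_one (s : Finset ι) (t : ι → ℝ) : |∏ i ∈ s, phi (t i)| ≤ 1 := by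
  rw [abs_of_nonneg (Finset.prod_nonneg fun i _ => (phi_pos _).le)]
  exact Finset.prod_le_one (fun i _ => (phi_pos _).le) fun i _ => phi_le_one _

theorem prod_phi_le (t : ι → ℝ) {ε : ℝ} (h1 : ε ≤ 1 / 2) :
    ∏ i, phi (t i) ≤ exp (-(ε * ∑ i, sin (t i) ^ 2)) := by
  rw [Finset.mul_sum, ← Finset.sum_neg_distrib, exp_sum]
  refine Finset.prod_le_prod (fun i _ => (phi_pos _).le) fun i _ => (phi_le_exp _).trans ?_
  apply exp_le_exp.2
  nlinarith [sq_nonneg (sin (t i))]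

/-- Gaussian linearisation of the Laplace transform of a quadratic form of a lazy vector. -/
theorem expect_cos_mul_exp_eq {μ : Type*} [Fintype μ] (y : ι → ℝ) (M : μ → ι → ℝ) :
    𝔼 h : ι → Fin 8, cos (∑ i, lz (h i) * y i) * exp (-(∑ l, (∑ i, lz (h i) * M l i) ^ 2) / 2) =
      ∫ ξ, ∏ i, phi (y i + ∑ l, ξ l * M l i) ∂gam μ := by
  simp_rw [← integral_gauss_cos]
  rw [expect_integral]
  · congr 1
    funext ξ
    have : ∀ h : ι → Fin 8, (∑ i, lz (h i) * y i) + ∑ l, ξ l * ∑ i, lz (h i) * M l i =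
        0 + ∑ i, lz (h i) * (y i + ∑ l, ξ l * M l i) := by
      intro h
      simp_rw [mul_add, Finset.sum_add_distrib, Finset.mul_sum]
      rw [zero_add, Finset.sum_comm]
      congr 1
      refine Finset.sum_congr rfl fun i _ => Finset.sum_congr rfl fun l _ => ?_
      ring
    simp_rw [this]
    rw [expect_cos_lz]
    simp
  · intro h
    refine integrable_gam_of_bound (by fun_prop) 1 fun x => abs_cos_le_one _

theorem expect_exp_eq {μ : Type*} [Fintype μ] (M : μ → ι → ℝ) :
    𝔼 h : ι → Fin 8, exp (-(∑ l, (∑ i, lz (h i) * M l i) ^ 2) / 2) =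
      ∫ ξ, ∏ i, phi (∑ l, ξ l * M l i) ∂gam μ := by
  have := expect_cos_mul_exp_eq (fun _ : ι => 0) M
  simpa using this

/-- The concentration integral of an integer vector. -/
noncomputable def conc {D : Type*} [Fintype D] (a : ℝ) (X : D → ℝ) : ℝ :=
  ∫ θ, exp (-(1 / 160 * ∑ j, sin (θ * (a * X j)) ^ 2)) ∂gaussianReal 0 1

section Frame

variable {k : ℕ} (W : Matrix ι (Fin k) ℝ) (hW : W.transpose * W = 1)

include hW in
theorem expect_exp_frame_le :
    𝔼 h : ι → Fin 8, exp (-(1 / 64 * ∑ l, (∑ i, lz (h i) * W i l) ^ 2)) ≤ exp (-(k / 160 : ℝ)) := by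
  have hs : (W * W.transpose).IsSymm := by
    rw [Matrix.IsSymm, Matrix.transpose_mul, Matrix.transpose_transpose]
  have hP : (W * W.transpose) * (W * W.transpose) = W * W.transpose := by
    rw [Matrix.mul_assoc, ← Matrix.mul_assoc W.transpose, hW, Matrix.one_mul]
  have ht : (W * W.transpose).trace = k := by
    rw [Matrix.trace_mul_comm, hW, Matrix.trace_one, Fintype.card_fin]
  have := expect_exp_neg_quad_le _ hs hP
  rw [ht] at this
  convert this using 5 with h
  rw [← Matrix.mulVec_mulVec, Matrix.dotProduct_mulVec, ← Matrix.mulVec_transpose]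
  simp only [dotProduct, Matrix.mulVec, Matrix.transpose_apply, ← sq]
  simp_rw [mul_comm]

include hW in
theorem sum_mulVec_frame (g : Fin k → ℝ) : ∑ i, (∑ l, g l * W i l) ^ 2 = ∑ l, g l ^ 2 := by
  have h1 : W.mulVec g ⬝ᵥ W.mulVec g = g ⬝ᵥ g := by
    rw [Matrix.dotProduct_mulVec, ← Matrix.mulVec_transpose, Matrix.mulVec_mulVec, hW,
      Matrix.one_mulVec]
  simp only [dotProduct, Matrix.mulVec, ← sq] at h1
  rw [← h1]
  simp_rw [mul_comm]

include hW in
theorem expect_cos_frame_le (y : ι → ℝ) :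
    𝔼 h : ι → Fin 8, cos (∑ i, lz (h i) * y i) *
      exp (-(1 / 64 * ∑ l, (∑ i, lz (h i) * W i l) ^ 2)) ≤
      exp (-(3 / 1280 * k)) * exp (-(1 / 160 * ∑ i, sin (y i) ^ 2)) := by
  set τ : ℝ := √(1 / 32) with hτ
  have hτ2 : τ ^ 2 = 1 / 32 := by rw [hτ, sq_sqrt (by norm_num)]
  set G := 𝔼 h : ι → Fin 8, cos (∑ i, lz (h i) * y i) *
      exp (-(1 / 64 * ∑ l, (∑ i, lz (h i) * W i l) ^ 2)) with hG
  have e1 : G = ∫ ξ, ∏ i, phi (y i + ∑ l, ξ l * (τ * W i l)) ∂gam (Fin k) := by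
    rw [← expect_cos_mul_exp_eq y (fun l i => τ * W i l), hG]
    refine Finset.expect_congr rfl fun h _ => ?_
    congr 2
    have : ∀ l, ∑ i, lz (h i) * (τ * W i l) = τ * ∑ i, lz (h i) * W i l := by
      intro l
      rw [Finset.mul_sum]
      exact Finset.sum_congr rfl fun i _ => by ring
    simp_rw [this, mul_pow, hτ2, ← Finset.mul_sum]
    ring
  have hG0 : 0 ≤ G := by
    rw [e1]
    exact integral_nonneg fun ξ => Finset.prod_nonneg fun i _ => (phi_pos _).le
  have b1 : G ≤ exp (-(k / 160 : ℝ)) := by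
    refine le_trans (expect_mono fun h => ?_) (expect_exp_frame_le W hW)
    exact mul_le_of_le_one_left (exp_pos _).le (cos_le_one _)
  have b2 : G ≤ exp (-(1 / 80 * ∑ i, sin (y i) ^ 2)) * exp (k / 640) := by
    rw [e1]
    have hc : (1 / 1280 : ℝ) < 1 / 2 := by norm_num
    have : ∀ ξ : Fin k → ℝ, ∏ i, phi (y i + ∑ l, ξ l * (τ * W i l)) ≤
        exp (-(1 / 80 * ∑ i, sin (y i) ^ 2)) * exp (1 / 1280 * ∑ l, ξ l ^ 2) := by
      intro ξ
      refine (prod_phi_le _ (show (1 / 40 : ℝ) ≤ 1 / 2 by norm_num)).trans ?_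
      rw [← exp_add]
      apply exp_le_exp.2
      have h1 : ∑ i, sin (y i) ^ 2 ≤ ∑ i, (2 * sin (y i + ∑ l, ξ l * (τ * W i l)) ^ 2 +
          2 * (∑ l, ξ l * (τ * W i l)) ^ 2) :=
        Finset.sum_le_sum fun i _ => sin_sq_le_of_add _ _
      rw [Finset.sum_add_distrib, ← Finset.mul_sum, ← Finset.mul_sum] at h1
      have h2 : ∑ i, (∑ l, ξ l * (τ * W i l)) ^ 2 = 1 / 32 * ∑ l, ξ l ^ 2 := by
        rw [← sum_mulVec_frame W hW ξ, ← hτ2, Finset.mul_sum]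
        refine Finset.sum_congr rfl fun i _ => ?_
        rw [← mul_pow, Finset.mul_sum]
        congr 1
        exact Finset.sum_congr rfl fun i _ => by ring
      rw [h2] at h1
      linarith
    refine (integral_mono (integrable_gam_of_bound ?_ 1 fun x => abs_prod_phi_le_one _ _)
      ((integrable_gauss_exp_sq hc).const_mul _) this).trans ?_
    · refine continuous_finsetProd _ fun i _ => continuous_phi.comp (by fun_prop)
    · rw [integral_const_mul, integral_gauss_exp_sq hc, Fintype.card_fin]
      refine mul_le_mul_of_nonneg_left ?_ (exp_pos _).le
      rw [show (k / 640 : ℝ) = k * (1 / 640) by ring, exp_nat_mul]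
      refine pow_le_pow_left₀ (by positivity) ?_ _
      have h4 : (√(1 - 2 * (1 / 1280)) : ℝ)⁻¹ ≤ ((641 / 640 : ℝ)⁻¹)⁻¹ := by
        apply inv_anti₀ (by norm_num)
        apply le_sqrt_of_sq_le
        norm_num
      refine h4.trans ?_
      have := add_one_le_exp (1 / 640 : ℝ)
      refine le_trans ?_ this
      norm_num
  have h3 : G ^ 2 ≤ (exp (-(3 / 1280 * k)) * exp (-(1 / 160 * ∑ i, sin (y i) ^ 2))) ^ 2 := by
    rw [sq]
    refine (mul_le_mul b1 b2 hG0 (exp_pos _).le).trans (le_of_eq ?_)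
    rw [← exp_add, ← exp_add, ← exp_add, ← exp_nat_mul]
    congr 1
    push_cast
    ring
  exact le_of_sq_le_sq h3 (by positivity)

end Frame

/-- The weight of a pair of rows. -/
noncomputable def roww {D : Type*} [Fintype D] (a : ℝ) (X : D → ℝ) (h : D ⊕ D → Fin 8) : ℝ :=
  exp (-((∑ j, lz (h (.inl j)) * (a * X j)) ^ 2 + (∑ j, lz (h (.inr j)) * (a * X j)) ^ 2) / 2)

theorem expect_roww_le {D : Type*} [Fintype D] [DecidableEq D] (a : ℝ) (X : D → ℝ) {k : ℕ}
    (W : Matrix (D ⊕ D) (Fin k) ℝ) (hW : W.transpose * W = 1) :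
    𝔼 h : D ⊕ D → Fin 8, roww a X h *
      (if ∑ l, (∑ i, lz (h i) * W i l) ^ 2 ≤ k / 20 then 1 else 0) ≤
      exp (-(k / 640 : ℝ)) * conc a X ^ 2 := by
  set y : (Bool → ℝ) → D ⊕ D → ℝ := fun θ =>
    Sum.elim (fun j => θ true * (a * X j)) (fun j => θ false * (a * X j)) with hy
  have hw : ∀ h, roww a X h = ∫ θ, cos (∑ i, lz (h i) * y θ i) ∂gam Bool := by
    intro h
    set v : Bool → ℝ := fun b => if b then ∑ j, lz (h (.inl j)) * (a * X j)
      else ∑ j, lz (h (.inr j)) * (a * X j) with hv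
    have := exp_neg_eq_integral v
    simp only [Fintype.sum_bool] at this
    rw [roww]
    simp only [hv, if_true, Bool.false_eq_true, if_false] at this
    rw [this]
    congr 1
    funext θ
    congr 1
    simp only [Fintype.sum_sum_type, hy, Sum.elim_inl, Sum.elim_inr, Finset.mul_sum]
    congr 1 <;> refine Finset.sum_congr rfl fun j _ => by ring
  have hcont : ∀ h : D ⊕ D → Fin 8, Continuous fun θ => cos (∑ i, lz (h i) * y θ i) := by
    intro h
    simp only [Fintype.sum_sum_type, hy, Sum.elim_inl, Sum.elim_inr]
    fun_prop
  have step1 : 𝔼 h : D ⊕ D → Fin 8, roww a X h *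
      (if ∑ l, (∑ i, lz (h i) * W i l) ^ 2 ≤ k / 20 then 1 else 0) ≤
      exp (k / 1280) * 𝔼 h : D ⊕ D → Fin 8, roww a X h *
        exp (-(1 / 64 * ∑ l, (∑ i, lz (h i) * W i l) ^ 2)) := by
    rw [Finset.mul_expect]
    refine expect_mono fun h => ?_
    rw [mul_left_comm]
    refine mul_le_mul_of_nonneg_left ?_ (exp_pos _).le
    rw [← exp_add]
    split_ifs with hc
    · apply one_le_exp
      linarith
    · positivity
  refine step1.trans ?_
  have step2 : 𝔼 h : D ⊕ D → Fin 8, roww a X h *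
        exp (-(1 / 64 * ∑ l, (∑ i, lz (h i) * W i l) ^ 2)) ≤
      exp (-(3 / 1280 * k)) * conc a X ^ 2 := by
    simp_rw [hw, ← integral_mul_const]
    rw [expect_integral]
    swap
    · intro h
      exact (integrable_gam_of_bound (hcont h) 1 fun x => abs_cos_le_one _).mul_const _
    have hprod : conc a X ^ 2 = ∫ θ, exp (-(1 / 160 * ∑ i, sin (y θ i) ^ 2)) ∂gam Bool := by
      have := integral_fintype_prod_eq_prod (μ := fun _ : Bool => gaussianReal 0 1)
        (fun (_ : Bool) (θ : ℝ) => exp (-(1 / 160 * ∑ j, sin (θ * (a * X j)) ^ 2)))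
      simp only [Fintype.prod_bool] at this
      rw [conc, sq, ← this]
      unfold gam
      congr 1
      funext θ
      rw [← exp_add]
      simp only [Fintype.sum_sum_type, hy, Sum.elim_inl, Sum.elim_inr]
      ring_nf
    rw [hprod, ← integral_const_mul]
    refine integral_mono ?_ ?_ fun θ => expect_cos_frame_le W hW (y θ)
    · refine integrable_gam_of_bound ?_ 1 fun x => ?_
      · simp_rw [Fintype.expect_eq_sum_div_card]
        refine Continuous.div_const (continuous_finsetSum _ fun h _ => (hcont h).mul
          continuous_const) _
      · refine (Finset.abs_expect_le _ _).trans (expect_le_of_forall_le fun h => ?_)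
        rw [abs_mul, abs_exp]
        refine mul_le_one₀ (abs_cos_le_one _) (exp_pos _).le ?_
        apply exp_le_one_iff.2
        simp only [Left.neg_nonpos_iff]
        positivity
    · refine (integrable_gam_of_bound ?_ 1 fun x => ?_).const_mul _
      · simp only [Fintype.sum_sum_type, hy, Sum.elim_inl, Sum.elim_inr]
        fun_prop
      · rw [abs_exp]
        apply exp_le_one_iff.2
        simp only [Left.neg_nonpos_iff]
        positivity
  refine (mul_le_mul_of_nonneg_left step2 (exp_pos _).le).trans (le_of_eq ?_)
  rw [← mul_assoc, ← exp_add]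
  congr 2
  ring

end SymSing

namespace SymSing

open scoped BigOperators

open Real

section

variable {ι : Type*} [Fintype ι]

/-- Squared length of the coordinates of `z` in the frame `W`. -/
def nsq {k : ℕ} (W : Matrix ι (Fin k) ℝ) (z : ι → ℝ) : ℝ := ∑ l, (∑ i, z i * W i l) ^ 2

theorem nsq_nonneg {k : ℕ} (W : Matrix ι (Fin k) ℝ) (z : ι → ℝ) : 0 ≤ nsq W z :=
  Finset.sum_nonneg fun _ _ => sq_nonneg _

theorem exists_frame_compl {k : ℕ} (u : Fin (k + 1) → ℝ) (hu : ∑ i, u i ^ 2 = 1) :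
    ∃ Q : Matrix (Fin (k + 1)) (Fin k) ℝ, Q.transpose * Q = 1 ∧
      ∀ y : Fin (k + 1) → ℝ, ∑ i, y i ^ 2 = (∑ l, (∑ i, y i * Q i l) ^ 2) + (∑ i, y i * u i) ^ 2 := by
  let v : Fin (k + 1) → EuclideanSpace ℝ (Fin (k + 1)) := fun _ => WithLp.toLp 2 u
  have hv : Orthonormal ℝ (Set.domRestrict {(0 : Fin (k + 1))} v) := by
    constructor
    · intro i
      change ‖v i‖ = 1
      simp only [v, EuclideanSpace.norm_eq, norm_eq_abs, sq_abs, hu, sqrt_one]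
    · intro i j hij
      exact absurd (Subsingleton.elim i j) hij
  obtain ⟨b, hb⟩ := hv.exists_orthonormalBasis_extension_of_card_eq (by simp)
  have hb0 : b 0 = WithLp.toLp 2 u := hb 0 rfl
  have hinner : ∀ i j, ∑ l, b i l * b j l = if i = j then 1 else 0 := by
    intro i j
    have := orthonormal_iff_ite.1 b.orthonormal i j
    rw [← this]
    simp [PiLp.inner_apply, mul_comm]
  refine ⟨Matrix.of fun i l => b l.succ i, ?_, fun y => ?_⟩
  · ext i j
    rw [Matrix.mul_apply, Matrix.one_apply]
    simp only [Matrix.transpose_apply, Matrix.of_apply, hinner, Fin.succ_inj]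
  · have h := b.sum_sq_norm_inner_right (WithLp.toLp 2 y)
    rw [EuclideanSpace.norm_sq_eq, Fin.sum_univ_succ, hb0] at h
    simp only [PiLp.inner_apply, norm_eq_abs, sq_abs] at h
    simp only [Matrix.of_apply]
    rw [← h, add_comm]
    congr 1

theorem exists_frame_step {k : ℕ} (W : Matrix ι (Fin (k + 1)) ℝ) (hW : W.transpose * W = 1)
    (h : ι → ℝ) (hpos : 0 < nsq W h) :
    ∃ (W' : Matrix ι (Fin k) ℝ) (β : (ι → ℝ) → ℝ), W'.transpose * W' = 1 ∧
      ∀ (z : ι → ℝ) (x : ℝ), nsq W (z + x • h) = nsq W' z + (β z + x * √(nsq W h)) ^ 2 := by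
  set a := √(nsq W h) with ha
  have ha0 : 0 < a := sqrt_pos.2 hpos
  have ha2 : a ^ 2 = nsq W h := sq_sqrt hpos.le
  set c : (ι → ℝ) → Fin (k + 1) → ℝ := fun z l => ∑ i, z i * W i l with hc
  set u : Fin (k + 1) → ℝ := fun l => c h l / a with hu
  have hu1 : ∑ l, u l ^ 2 = 1 := by
    simp only [hu, div_pow, ← Finset.sum_div]
    rw [div_eq_one_iff_eq (by positivity), ha2]
    rfl
  obtain ⟨Q, hQ, hQ2⟩ := exists_frame_compl u hu1
  have hWQ : ∀ z l, ∑ i, z i * (W * Q) i l = ∑ j, c z j * Q j l := by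
    intro z l
    simp only [hc, Matrix.mul_apply, Finset.mul_sum, Finset.sum_mul]
    rw [Finset.sum_comm]
    exact Finset.sum_congr rfl fun _ _ => Finset.sum_congr rfl fun _ _ => by ring
  have hsplit : ∀ z, nsq W z = nsq (W * Q) z + (∑ i, c z i * u i) ^ 2 := by
    intro z
    rw [nsq, nsq]
    simp_rw [hWQ]
    exact hQ2 (c z)
  have hcu : ∑ i, c h i * u i = a := by
    have : ∀ i, c h i * u i = a * u i ^ 2 := by
      intro i; simp only [hu]; field_simp
    simp_rw [this, ← Finset.mul_sum, hu1, mul_one]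
  have hker : nsq (W * Q) h = 0 := by
    have := hsplit h
    rw [hcu, ha2] at this
    linarith
  have hker' : ∀ l, ∑ i, h i * (W * Q) i l = 0 := by
    intro l
    rw [nsq, Finset.sum_eq_zero_iff_of_nonneg fun _ _ => sq_nonneg _] at hker
    exact pow_eq_zero_iff two_ne_zero |>.1 (hker l (Finset.mem_univ l))
  refine ⟨W * Q, fun z => ∑ i, c z i * u i, ?_, fun z x => ?_⟩
  · rw [Matrix.transpose_mul, Matrix.mul_assoc, ← Matrix.mul_assoc W.transpose, hW,
      Matrix.one_mul, hQ]
  · rw [hsplit]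
    congr 1
    · simp only [nsq, Pi.add_apply, Pi.smul_apply, smul_eq_mul, add_mul, Finset.sum_add_distrib,
        mul_assoc, ← Finset.mul_sum, hker', mul_zero, add_zero]
    · congr 1
      have : ∀ i, c (z + x • h) i = c z i + x * c h i := by
        intro i
        simp only [hc, Pi.add_apply, Pi.smul_apply, smul_eq_mul, add_mul, Finset.sum_add_distrib,
          mul_assoc, ← Finset.mul_sum]
      simp_rw [this, add_mul, Finset.sum_add_distrib, mul_assoc, ← Finset.mul_sum, hcu]

end

section Recursion

variable {ι : Type*} [Fintype ι] [DecidableEq ι] {K : Type*} [Fintype K]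

/-- The bound for the peeling recursion. -/
noncomputable def peel (p A B : ℝ) (s : ℕ → ℝ) : ℕ → ℕ → ℝ
  | 0, _ => 1
  | j + 1, 0 => p * A * peel p A B s j 0
  | j + 1, k + 1 => p * (B * s (k + 1)) * peel p A B s j k +
      p * exp (-((k + 1 : ℕ) / 640 : ℝ)) * A * peel p A B s j (k + 1)

theorem peel_nonneg_of {p A B : ℝ} {s : ℕ → ℝ} (hp : 0 ≤ p) (hA : 0 ≤ A) {K₀ : ℕ}
    (hs : ∀ k, 0 < k → k ≤ K₀ → 0 ≤ B * s k) : ∀ j k, k ≤ K₀ → 0 ≤ peel p A B s j k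
  | 0, _, _ => by simp [peel]
  | j + 1, 0, h => by
      have := peel_nonneg_of hp hA hs j 0 h
      rw [peel]; positivity
  | j + 1, k + 1, h => by
      have h1 := peel_nonneg_of hp hA hs j k (by omega)
      have h2 := peel_nonneg_of hp hA hs j (k + 1) h
      have h3 := hs (k + 1) (Nat.succ_pos k) h
      rw [peel]; positivity

theorem peel_nonneg {p A B : ℝ} {s : ℕ → ℝ} (hp : 0 ≤ p) (hA : 0 ≤ A) (hB : 0 ≤ B)
    (hs : ∀ k, 0 ≤ s k) (j k : ℕ) : 0 ≤ peel p A B s j k :=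
  peel_nonneg_of hp hA (fun k _ _ => mul_nonneg hB (hs k)) j k le_rfl

theorem expect_fin_succ {α : Type*} [Fintype α] {j : ℕ} (f : (Fin (j + 1) → α) → ℝ) :
    𝔼 h, f h = 𝔼 h0, 𝔼 h', f (Fin.cons h0 h') := by
  rw [← expect_prod_type (fun p : α × (Fin j → α) => f (Fin.cons p.1 p.2)),
    ← expect_equiv (Fin.consEquiv fun _ : Fin (j + 1) => α)]
  rfl

theorem sum_fin_succ {α : Type*} [Fintype α] {j : ℕ} (f : (Fin (j + 1) → α) → ℝ) :
    ∑ h, f h = ∑ h0, ∑ h', f (Fin.cons h0 h') := by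
  rw [← Fintype.sum_prod_type (fun p : α × (Fin j → α) => f (Fin.cons p.1 p.2)),
    ← Equiv.sum_comp (Fin.consEquiv fun _ : Fin (j + 1) => α)]
  rfl

/-- Peeling off the rows of the random block one at a time. -/
theorem exists_peel_bound (w : (ι → Fin 8) → ℝ) (hw0 : ∀ h, 0 ≤ w h) {p A B ν : ℝ} (hp : 0 ≤ p)
    (hν : 0 ≤ ν) (hA0 : 0 ≤ A) (hB0 : 0 ≤ B)
    (hrow : ∀ (k : ℕ) (W : Matrix ι (Fin k) ℝ), W.transpose * W = 1 →
      𝔼 h, w h * (if nsq W (fun i => lz (h i)) ≤ k / 20 then 1 else 0) ≤ exp (-(k / 640 : ℝ)) * p)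
    (c g : K → ℝ) (hg0 : ∀ t, 0 ≤ g t) (hg1 : ∀ t, g t ≤ 1) (hA : ∑ t, g t ≤ A) (s : ℕ → ℝ)
    (hs0 : ∀ k, 0 ≤ s k)
    (hB : ∀ (k : ℕ) (b a : ℝ), 0 < k → √(k / 20) ≤ a →
      ∑ t, exp (-(b + c t * a) ^ 2 * ν) ≤ B * s k) :
    ∀ (j k : ℕ) (W : Matrix ι (Fin k) ℝ), W.transpose * W = 1 →
      ∃ Z : (Fin j → ι → Fin 8) → ℝ, (∀ h, 0 ≤ Z h) ∧
        (∀ h b, ∑ x : Fin j → K, (∏ i, g (x i)) *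
          exp (-nsq W (b + ∑ i, c (x i) • fun l => lz (h i l)) * ν) ≤ Z h) ∧
        𝔼 h : Fin j → ι → Fin 8, (∏ i, w (h i)) * Z h ≤ peel p A B s j k := by
  have hEw : 𝔼 h, w h ≤ p := by
    have h := hrow 0 (Matrix.of fun _ i => i.elim0) (by ext i; exact i.elim0)
    simpa [nsq] using h
  intro j
  induction j with
  | zero =>
    intro k W _
    refine ⟨fun _ => 1, fun _ => zero_le_one, fun h b => ?_, ?_⟩
    · simp only [Finset.univ_unique, Finset.univ_eq_empty, Finset.prod_empty, Finset.sum_empty,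
        add_zero, one_mul, Finset.sum_const, Finset.card_singleton, one_smul]
      apply exp_le_one_iff.2
      nlinarith [nsq_nonneg W b]
    · simp [peel]
  | succ j ih =>
    intro k W hW
    obtain ⟨Z0, hZ0, hZ0s, hZ0e⟩ := ih k W hW
    have hsmall : ∀ (h0 : ι → Fin 8) (hs : Fin j → ι → Fin 8) (b : ι → ℝ),
        ∑ x : Fin (j + 1) → K, (∏ i, g (x i)) * exp (-nsq W (b + ∑ i, c (x i) •
          fun l => lz ((Fin.cons h0 hs : Fin (j + 1) → ι → Fin 8) i l)) * ν) ≤ A * Z0 hs := by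
      intro h0 hs b
      rw [sum_fin_succ]
      simp only [Fin.prod_univ_succ, Fin.sum_univ_succ, Fin.cons_zero, Fin.cons_succ]
      refine le_trans ?_ (mul_le_mul_of_nonneg_right hA (hZ0 hs))
      rw [Finset.sum_mul]
      refine Finset.sum_le_sum fun t _ => ?_
      simp_rw [mul_assoc (g t), ← Finset.mul_sum, ← add_assoc]
      exact mul_le_mul_of_nonneg_left (hZ0s hs _) (hg0 t)
    have hsmalle : 𝔼 hs : Fin j → ι → Fin 8, (∏ i, w (hs i)) * (A * Z0 hs) ≤
        A * peel p A B s j k := by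
      simp_rw [mul_left_comm _ A, ← Finset.mul_expect]
      exact mul_le_mul_of_nonneg_left hZ0e hA0
    cases k with
    | zero =>
      refine ⟨fun h => A * Z0 (Fin.tail h), fun h => mul_nonneg hA0 (hZ0 _), fun h b => ?_, ?_⟩
      · have := hsmall (h 0) (Fin.tail h) b
        rwa [Fin.cons_self_tail] at this
      · rw [expect_fin_succ]
        simp only [Fin.prod_univ_succ, Fin.cons_zero, Fin.cons_succ, Fin.tail_cons, mul_assoc,
          ← Finset.mul_expect, ← Finset.expect_mul, peel]
        exact mul_le_mul hEw hsmalle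
          (expect_nonneg' fun h => mul_nonneg (Finset.prod_nonneg fun i _ => hw0 _)
            (mul_nonneg hA0 (hZ0 h))) hp
    | succ k =>
      have hstep : ∀ h0 : ι → Fin 8, ∃ Z : (Fin j → ι → Fin 8) → ℝ, (∀ h, 0 ≤ Z h) ∧
          (∀ (hs : Fin j → ι → Fin 8) (b : ι → ℝ),
            ∑ x : Fin (j + 1) → K, (∏ i, g (x i)) * exp (-nsq W (b + ∑ i, c (x i) •
              fun l => lz ((Fin.cons h0 hs : Fin (j + 1) → ι → Fin 8) i l)) * ν) ≤ Z hs) ∧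
          𝔼 hs : Fin j → ι → Fin 8, (∏ i, w (hs i)) * Z hs ≤
            A * peel p A B s j (k + 1) *
              (if nsq W (fun i => lz (h0 i)) ≤ (k + 1 : ℕ) / 20 then 1 else 0) +
            B * s (k + 1) * peel p A B s j k := by
        intro h0
        have hpk := peel_nonneg hp hA0 hB0 hs0 j k
        have hBs := mul_nonneg hB0 (hs0 (k + 1))
        split_ifs with hc
        · refine ⟨fun hs => A * Z0 hs, fun h => mul_nonneg hA0 (hZ0 h), hsmall h0, ?_⟩
          refine hsmalle.trans ?_
          rw [mul_one]
          exact le_add_of_nonneg_right (mul_nonneg hBs hpk)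
        · push Not at hc
          have hpos : 0 < nsq W (fun i => lz (h0 i)) := lt_of_le_of_lt (by positivity) hc
          obtain ⟨W', β, hW', hdec⟩ := exists_frame_step W hW _ hpos
          obtain ⟨Z1, hZ1, hZ1s, hZ1e⟩ := ih k W' hW'
          refine ⟨fun hs => B * s (k + 1) * Z1 hs, fun h => mul_nonneg hBs (hZ1 h),
            fun hs b => ?_, ?_⟩
          · rw [sum_fin_succ, Finset.sum_comm]
            simp only [Fin.prod_univ_succ, Fin.sum_univ_succ, Fin.cons_zero, Fin.cons_succ]
            refine le_trans ?_ (mul_le_mul_of_nonneg_left (hZ1s hs b) hBs)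
            rw [Finset.mul_sum]
            refine Finset.sum_le_sum fun x _ => ?_
            have e : ∀ t, -nsq W (b + (c t • (fun l => lz (h0 l)) +
                ∑ i, c (x i) • fun l => lz (hs i l))) * ν =
                -nsq W' (b + ∑ i, c (x i) • fun l => lz (hs i l)) * ν +
                -(β (b + ∑ i, c (x i) • fun l => lz (hs i l)) +
                  c t * √(nsq W fun i => lz (h0 i))) ^ 2 * ν := by
              intro t
              rw [add_left_comm, add_comm (c t • _), hdec]
              ring
            have hsum : ∑ t, g t * exp (-(β (b + ∑ i, c (x i) • fun l => lz (hs i l)) +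
                  c t * √(nsq W fun i => lz (h0 i))) ^ 2 * ν) ≤ B * s (k + 1) := by
              refine le_trans (Finset.sum_le_sum fun t _ => ?_)
                (hB (k + 1) (β (b + ∑ i, c (x i) • fun l => lz (hs i l))) _ (Nat.succ_pos k) (sqrt_le_sqrt hc.le))
              exact mul_le_of_le_one_left (exp_pos _).le (hg1 t)
            simp_rw [e, exp_add]
            refine (le_of_eq ?_).trans (mul_le_mul_of_nonneg_right hsum
              (mul_nonneg (Finset.prod_nonneg fun i _ => hg0 _) (exp_pos _).le))
            rw [Finset.sum_mul]
            exact Finset.sum_congr rfl fun t _ => by ring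
          · rw [mul_zero, zero_add]
            simp_rw [mul_left_comm _ (B * s (k + 1)), ← Finset.mul_expect]
            exact mul_le_mul_of_nonneg_left hZ1e hBs
      choose Z hZ hZs hZe using hstep
      refine ⟨fun h => Z (h 0) (Fin.tail h), fun h => hZ _ _, fun h b => ?_, ?_⟩
      · have := hZs (h 0) (Fin.tail h) b
        rwa [Fin.cons_self_tail] at this
      · rw [expect_fin_succ]
        simp only [Fin.prod_univ_succ, Fin.cons_zero, Fin.cons_succ, Fin.tail_cons, mul_assoc,
          ← Finset.mul_expect]
        refine (expect_mono fun h0 => mul_le_mul_of_nonneg_left (hZe h0) (hw0 h0)).trans ?_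
        simp_rw [mul_add, Finset.expect_add_distrib, ← Finset.expect_mul]
        rw [peel, add_comm]
        have hpk := peel_nonneg hp hA0 hB0 hs0 j k
        have hpk' := peel_nonneg hp hA0 hB0 hs0 j (k + 1)
        have hBs := mul_nonneg hB0 (hs0 (k + 1))
        refine add_le_add ?_ ?_
        · refine ((le_of_eq ?_).trans
            (mul_le_mul_of_nonneg_right hEw (mul_nonneg hBs hpk))).trans (le_of_eq ?_) <;> ring
        · simp_rw [mul_left_comm (w _) (A * _), ← Finset.mul_expect]
          refine (mul_le_mul_of_nonneg_left (hrow (k + 1) W hW) (mul_nonneg hA0 hpk')).trans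
            (le_of_eq ?_)
          ring

theorem peel_le {p A B N T : ℝ} {s : ℕ → ℝ} (hp : 0 ≤ p) (hN : 0 < N) (hNA : N ≤ A)
    (hT : N = exp (T / 640)) {K₀ : ℕ} (hs : ∀ k, 0 < k → k ≤ K₀ → 1 ≤ B * s k) :
    ∀ j k, k ≤ K₀ → peel p A B s j k ≤
      (2 * p * A) ^ j * (∏ i ∈ Finset.range k, (B * s (i + 1) / N)) *
        exp (k * max 0 (T - j + k) / 640) := by
  have hA0 : 0 ≤ A := hN.le.trans hNA
  have hPi : ∀ k, k ≤ K₀ → 0 ≤ ∏ i ∈ Finset.range k, (B * s (i + 1) / N) := by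
    intro k hk
    refine Finset.prod_nonneg fun i hi => ?_
    have := hs (i + 1) (Nat.succ_pos i) (by have := Finset.mem_range.1 hi; omega)
    exact div_nonneg (by linarith) hN.le
  intro j
  induction j with
  | zero =>
    intro k hk
    rw [peel, pow_zero, one_mul]
    have h1 : (∏ i ∈ Finset.range k, N⁻¹) ≤ ∏ i ∈ Finset.range k, (B * s (i + 1) / N) := by
      refine Finset.prod_le_prod (fun i _ => by positivity) fun i hi => ?_
      have := hs (i + 1) (Nat.succ_pos i) (by have := Finset.mem_range.1 hi; omega)
      rw [inv_eq_one_div]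
      gcongr
    have h2 : N ^ k ≤ exp (k * max 0 (T - (0 : ℕ) + k) / 640) := by
      rw [hT, ← exp_nat_mul]
      apply exp_le_exp.2
      have : T ≤ max 0 (T - (0 : ℕ) + k) := le_trans (by simp) (le_max_right _ _)
      rw [mul_div_assoc]
      gcongr
    refine le_trans (le_of_eq ?_) (mul_le_mul h1 h2 (by positivity) (hPi k hk))
    rw [Finset.prod_const, Finset.card_range, ← mul_pow, inv_mul_cancel₀ hN.ne', one_pow]
  | succ j ih =>
    intro k hk
    cases k with
    | zero =>
      rw [peel]
      have := ih 0 (Nat.zero_le _)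
      simp only [Finset.range_zero, Finset.prod_empty, mul_one, Nat.cast_zero, zero_mul, zero_div,
        exp_zero] at this ⊢
      have hpA := mul_nonneg hp hA0
      have h3 : 0 ≤ (2 * p * A) ^ j := by positivity
      refine (mul_le_mul_of_nonneg_left this hpA).trans ?_
      rw [pow_succ]
      nlinarith
    | succ k =>
      rw [peel]
      have h1 := ih k (by omega)
      have h2 := ih (k + 1) hk
      have hb := hs (k + 1) (Nat.succ_pos k) hk
      have hpA := mul_nonneg hp hA0
      have h3 : 0 ≤ (2 * p * A) ^ j := by positivity
      set G := exp (((k + 1 : ℕ) : ℝ) * max 0 (T - ((j + 1 : ℕ) : ℝ) + ((k + 1 : ℕ) : ℝ)) / 640)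
        with hG
      have t1 : exp (k * max 0 (T - j + k) / 640) ≤ G := by
        apply exp_le_exp.2
        have e : T - ((j + 1 : ℕ) : ℝ) + ((k + 1 : ℕ) : ℝ) = T - j + k := by push_cast; ring
        rw [e]
        have : (0 : ℝ) ≤ max 0 (T - j + k) := le_max_left _ _
        push_cast
        gcongr
        linarith
      have t2 : exp (-((k + 1 : ℕ) / 640 : ℝ)) *
          exp (((k + 1 : ℕ) : ℝ) * max 0 (T - j + ((k + 1 : ℕ) : ℝ)) / 640) ≤
          G := by
        rw [← exp_add]
        apply exp_le_exp.2
        have e : max 0 (T - j + ((k + 1 : ℕ) : ℝ)) - 1 ≤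
            max 0 (T - ((j + 1 : ℕ) : ℝ) + ((k + 1 : ℕ) : ℝ)) := by
          push_cast
          rcases le_total 0 (T - j + (k + 1)) with h | h
          · rw [max_eq_right h]
            exact le_trans (by linarith) (le_max_right _ _)
          · rw [max_eq_left h]
            exact le_trans (by linarith) (le_max_left _ _)
        have := mul_le_mul_of_nonneg_left e (Nat.cast_nonneg (α := ℝ) (k + 1))
        linarith
      rw [Finset.prod_range_succ] at h2 ⊢
      set Q := ∏ i ∈ Finset.range k, (B * s (i + 1) / N) with hQ
      have hQ0 : 0 ≤ Q := hPi k (by omega)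
      have s1 : p * (B * s (k + 1)) * peel p A B s j k ≤
          p * A * (2 * p * A) ^ j * (Q * (B * s (k + 1) / N)) * G := by
        have : B * s (k + 1) ≤ A * (B * s (k + 1) / N) := by
          rw [mul_div_assoc', le_div_iff₀ hN]
          nlinarith
        calc p * (B * s (k + 1)) * peel p A B s j k ≤
            p * (A * (B * s (k + 1) / N)) * ((2 * p * A) ^ j * Q * G) := by
              refine mul_le_mul (mul_le_mul_of_nonneg_left this hp)
                (h1.trans (mul_le_mul_of_nonneg_left t1 (mul_nonneg h3 hQ0)))
                (peel_nonneg_of hp hA0 (K₀ := K₀)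
                  (fun k hk hk' => by linarith [hs k hk hk']) j k (by omega)) ?_
              · have : 0 ≤ B * s (k + 1) / N := div_nonneg (by linarith) hN.le
                positivity
          _ = _ := by ring
      have s2 : p * exp (-((k + 1 : ℕ) / 640 : ℝ)) * A * peel p A B s j (k + 1) ≤
          p * A * (2 * p * A) ^ j * (Q * (B * s (k + 1) / N)) * G := by
        have hb' : 0 ≤ B * s (k + 1) / N := div_nonneg (by linarith) hN.le
        calc p * exp (-((k + 1 : ℕ) / 640 : ℝ)) * A * peel p A B s j (k + 1) ≤
            p * exp (-((k + 1 : ℕ) / 640 : ℝ)) * A * ((2 * p * A) ^ j *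
              (Q * (B * s (k + 1) / N)) *
              exp (((k + 1 : ℕ) : ℝ) * max 0 (T - j + ((k + 1 : ℕ) : ℝ)) / 640)) :=
              mul_le_mul_of_nonneg_left h2 (by positivity)
          _ = p * A * (2 * p * A) ^ j * (Q * (B * s (k + 1) / N)) *
              (exp (-((k + 1 : ℕ) / 640 : ℝ)) *
              exp (((k + 1 : ℕ) : ℝ) * max 0 (T - j + ((k + 1 : ℕ) : ℝ)) / 640)) := by ring
          _ ≤ _ := mul_le_mul_of_nonneg_left t2 (by positivity)
      refine (add_le_add s1 s2).trans (le_of_eq ?_)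
      ring

end Recursion

end SymSing

namespace SymSing

open scoped BigOperators

open Real

theorem sum_le_geometric {K : Type*} (S : Finset K) (m : K → ℕ) (hm : Set.InjOn m S) {f : K → ℝ}
    {C r : ℝ} (hC : 0 ≤ C) (hr0 : 0 ≤ r) (hr1 : r < 1) (hf : ∀ i ∈ S, f i ≤ C * r ^ m i) :
    ∑ i ∈ S, f i ≤ C / (1 - r) := by
  refine (Finset.sum_le_sum hf).trans ?_
  rw [← Finset.mul_sum, div_eq_mul_inv]
  refine mul_le_mul_of_nonneg_left ?_ hC
  rw [← Finset.sum_image (f := fun k => r ^ k) (g := m) hm]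
  exact sum_le_hasSum _ (fun _ _ => by positivity) (hasSum_geometric_of_lt_one hr0 hr1)

theorem one_sub_exp_ge {a : ℝ} (ha : 0 < a) : a / (1 + a) ≤ 1 - exp (-a) := by
  have h1 : 1 + a ≤ exp a := by linarith [add_one_le_exp a]
  rw [exp_neg, div_le_iff₀ (by linarith)]
  have : (exp a)⁻¹ * (1 + a) ≤ 1 := by
    rw [inv_mul_le_iff₀ (exp_pos a)]; linarith
  nlinarith

theorem sum_exp_sq_le {K : Type*} [Fintype K] (c : K → ℤ) (hc : Function.Injective c) {α : ℝ}
    (hα : 0 < α) (β : ℝ) : ∑ t, exp (-(β + c t * α) ^ 2) ≤ 6 * (1 + 1 / α) := by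
  classical
  set r := exp (-(2 * α)) with hr
  have hr1 : r < 1 := by rw [hr, exp_lt_one_iff]; linarith
  have hr0 : 0 ≤ r := (exp_pos _).le
  set z := ⌊β / α⌋ with hz
  have hz1 : (z : ℝ) * α ≤ β := by
    rw [← le_div_iff₀ hα]; exact Int.floor_le _
  have hz2 : β < ((z : ℝ) + 1) * α := by
    rw [← div_lt_iff₀ hα]; exact Int.lt_floor_add_one _
  have hsq : ∀ y w : ℝ, 0 ≤ w → w ≤ |y| → exp (-y ^ 2) ≤ exp 1 * exp (-(2 * w)) := by
    intro y w h0 hw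
    rw [← exp_add]
    apply exp_le_exp.2
    have := sq_abs y
    nlinarith [sq_nonneg (|y| - 1)]
  have hpow : ∀ k : ℕ, exp (-(2 * (α * k))) = r ^ k := by
    intro k; rw [hr, ← exp_nat_mul]; congr 1; ring
  have h1 : ∑ t with 0 ≤ c t + z, exp (-(β + c t * α) ^ 2) ≤ exp 1 / (1 - r) := by
    refine sum_le_geometric _ (fun t => (c t + z).toNat) ?_ (exp_pos 1).le hr0 hr1 ?_
    · intro a ha b hb hab
      simp only [Finset.coe_filter, Finset.mem_univ, true_and, Set.mem_ofPred_eq] at ha hb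
      apply hc
      have : (c a + z).toNat = (c b + z).toNat := hab
      omega
    · intro t ht
      simp only [Finset.mem_filter, Finset.mem_univ, true_and] at ht
      have hcast : (((c t + z).toNat : ℕ) : ℝ) = c t + z := by
        have : (((c t + z).toNat : ℕ) : ℤ) = c t + z := Int.toNat_of_nonneg ht
        exact_mod_cast this
      rw [← hpow]
      refine hsq _ _ (by positivity) ?_
      rw [hcast]
      refine le_trans ?_ (le_abs_self _)
      linarith
  have h2 : ∑ t with ¬ 0 ≤ c t + z, exp (-(β + c t * α) ^ 2) ≤ exp 1 / (1 - r) := by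
    refine sum_le_geometric _ (fun t => (-(c t + z) - 1).toNat) ?_ (exp_pos 1).le hr0 hr1 ?_
    · intro a ha b hb hab
      simp only [Finset.coe_filter, Finset.mem_univ, true_and, Set.mem_ofPred_eq] at ha hb
      apply hc
      have : (-(c a + z) - 1).toNat = (-(c b + z) - 1).toNat := hab
      omega
    · intro t ht
      simp only [Finset.mem_filter, Finset.mem_univ, true_and] at ht
      have hcast : (((-(c t + z) - 1).toNat : ℕ) : ℝ) = -(c t + z) - 1 := by
        have : (((-(c t + z) - 1).toNat : ℕ) : ℤ) = -(c t + z) - 1 :=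
          Int.toNat_of_nonneg (by omega)
        exact_mod_cast this
      rw [← hpow]
      refine hsq _ _ (by positivity) ?_
      rw [hcast]
      refine le_trans ?_ (neg_le_abs _)
      linarith
  rw [← Finset.sum_filter_add_sum_filter_not Finset.univ (fun t => 0 ≤ c t + z)]
  have h3 := one_sub_exp_ge (a := 2 * α) (by linarith)
  have h4 : exp 1 / (1 - r) ≤ 2.72 * (1 + 1 / (2 * α)) := by
    have e : (1 + 1 / (2 * α)) = ((2 * α) / (1 + 2 * α))⁻¹ := by field_simp; ring
    rw [e, div_eq_mul_inv]
    have he : exp 1 ≤ 2.72 := by linarith [exp_one_lt_d9]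
    gcongr
  have : 1 / (2 * α) = 1 / α / 2 := by field_simp
  have h5 : 0 < 1 / α := by positivity
  rw [this] at h4
  linarith

theorem prod_div_factorial_le (c : ℝ) (hc : 0 ≤ c) (k : ℕ) :
    ∏ i ∈ Finset.range k, (c / (i + 1)) ≤ exp c := by
  have : ∏ i ∈ Finset.range k, (c / (i + 1)) = c ^ k / k.factorial := by
    rw [Finset.prod_div_distrib, Finset.prod_const, Finset.card_range,
      ← Finset.prod_range_add_one_eq_factorial]
    push_cast
    rfl
  rw [this]
  exact pow_div_factorial_le_exp c hc k

section SecondMoment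

variable {D : Type*} [Fintype D] [DecidableEq D] {K : Type*} [Fintype K]

theorem expect_roww_sum_le (a : ℝ) (X : D → ℝ) (c : K → ℤ) (hc : Function.Injective c) {n m : ℕ}
    {N : ℝ} (hN : 1 ≤ N) (hdn : 2 * Fintype.card D ≤ n)
    (hNm : 640 * log N + 2 * Fintype.card D ≤ m) (hD : 0 < Fintype.card D) :
    𝔼 h : Fin m → D ⊕ D → Fin 8, (∏ i, roww a X (h i)) *
      ∑ x : Fin m → K, (∏ i, exp (-((c (x i) : ℝ) / N) ^ 2)) *
        exp (-(∑ l, (∑ i, (c (x i) : ℝ) * lz (h i l)) ^ 2) / (2 * n)) ≤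
    (24 * N * conc a X ^ 2) ^ m *
      ((48 / N) ^ (2 * Fintype.card D) * exp (n / 2)) := by
  set d := Fintype.card D with hd
  have hn0 : 0 < n := by omega
  have hN0 : 0 < N := by linarith
  have hcard : Fintype.card (D ⊕ D) = 2 * d := by rw [Fintype.card_sum]; omega
  let e : D ⊕ D ≃ Fin (2 * d) := Fintype.equivFinOfCardEq hcard
  let W : Matrix (D ⊕ D) (Fin (2 * d)) ℝ := Matrix.of fun i l => if e i = l then 1 else 0
  have hW : W.transpose * W = 1 := by
    ext i j
    rw [Matrix.mul_apply, Matrix.one_apply, ← Equiv.sum_comp e.symm]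
    simp [W, eq_comm]
  have hnsq : ∀ z, nsq W z = ∑ l, z l ^ 2 := by
    intro z
    rw [nsq, ← Equiv.sum_comp e]
    simp [W, eq_comm]
  set s : ℕ → ℝ := fun k => max 1 √(n / k) with hs
  have hp : 0 ≤ conc a X ^ 2 := sq_nonneg _
  have hg : ∑ t, exp (-((c t : ℝ) / N) ^ 2) ≤ 12 * N := by
    have := sum_exp_sq_le c hc (α := 1 / N) (by positivity) 0
    simp only [zero_add, mul_one_div, one_div_one_div] at this
    linarith
  obtain ⟨Z, hZ0, hZs, hZe⟩ := exists_peel_bound (roww a X)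
    (fun h => (exp_pos _).le) (p := conc a X ^ 2) (A := 12 * N) (B := 48) (ν := 1 / (2 * n))
    hp (by positivity) (by positivity) (by norm_num)
    (fun k W hW => by
      have := expect_roww_le a X W hW
      simpa only [nsq] using this)
    (fun t => (c t : ℝ)) (fun t => exp (-((c t : ℝ) / N) ^ 2)) (fun t => (exp_pos _).le)
    (fun t => exp_le_one_iff.2 (by nlinarith [sq_nonneg ((c t : ℝ) / N)])) hg s
    (fun k => le_max_of_le_left zero_le_one)
    (by
      intro k b u hk hu
      have hk' : (0 : ℝ) < k := by exact_mod_cast hk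
      have hn' : (0 : ℝ) < n := by exact_mod_cast hn0
      have hu0 : 0 < u := lt_of_lt_of_le (sqrt_pos.2 (by positivity)) hu
      set q := √(1 / (2 * n) : ℝ) with hq
      have hq0 : 0 < q := sqrt_pos.2 (by positivity)
      have hq2 : q ^ 2 = 1 / (2 * n) := sq_sqrt (by positivity)
      have h1 := sum_exp_sq_le c hc (α := u * q) (by positivity) (b * q)
      have h2 : ∀ t, exp (-(b + c t * u) ^ 2 * (1 / (2 * n))) =
          exp (-(b * q + c t * (u * q)) ^ 2) := by
        intro t; rw [← hq2]; congr 1; ring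
      simp_rw [h2]
      refine h1.trans ?_
      have h3 : 1 / (u * q) ≤ 7 * √(n / k) := by
        rw [div_le_iff₀ (by positivity)]
        have h4 : √(n / k : ℝ) * (√(k / 20) * q) = √(1 / 40) := by
          rw [hq, ← sqrt_mul (by positivity), ← sqrt_mul (by positivity)]
          congr 1
          field_simp
          norm_num
        have h5 : (1 : ℝ) / 7 ≤ √(1 / 40) := by
          apply le_sqrt_of_sq_le; norm_num
        have h6 : √(n / k : ℝ) * (√(k / 20) * q) ≤ √(n / k) * (u * q) := by gcongr
        linarith
      have h7 : (1 : ℝ) ≤ s k := le_max_left _ _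
      have h8 : √(n / k) ≤ s k := le_max_right _ _
      linarith)
    m (2 * d) W hW
  have hZ1 : ∀ h : Fin m → D ⊕ D → Fin 8, ∑ x : Fin m → K, (∏ i, exp (-((c (x i) : ℝ) / N) ^ 2)) *
        exp (-(∑ l, (∑ i, (c (x i) : ℝ) * lz (h i l)) ^ 2) / (2 * n)) ≤ Z h := by
    intro h
    refine (le_of_eq ?_).trans (hZs h 0)
    refine Finset.sum_congr rfl fun x _ => ?_
    rw [hnsq]
    congr 2
    rw [div_eq_mul_one_div]
    simp
  refine (expect_mono fun h => mul_le_mul_of_nonneg_left (hZ1 h)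
    (Finset.prod_nonneg fun i _ => (exp_pos _).le)).trans (hZe.trans ?_)
  have hNexp : N = exp (640 * log N / 640) := by
    rw [mul_div_cancel_left₀ _ (by norm_num : (640 : ℝ) ≠ 0), exp_log hN0]
  refine (peel_le hp hN0 (by linarith) hNexp (K₀ := 2 * d) (fun k _ _ => by
    have : (1 : ℝ) ≤ s k := le_max_left _ _
    linarith) m (2 * d) le_rfl).trans ?_
  have hmax : max 0 (640 * log N - m + ((2 * d : ℕ) : ℝ)) = 0 := by
    apply max_eq_left
    push_cast
    linarith
  rw [hmax, mul_zero, zero_div, exp_zero, mul_one]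
  have e1 : 2 * conc a X ^ 2 * (12 * N) = 24 * N * conc a X ^ 2 := by ring
  rw [e1]
  refine mul_le_mul_of_nonneg_left ?_ (by positivity)
  have e2 : ∀ i ∈ Finset.range (2 * d), 48 * s (i + 1) / N = 48 / N * √(n / (i + 1)) := by
    intro i hi
    have hi' := Finset.mem_range.1 hi
    have : s (i + 1) = √(n / (i + 1)) := by
      simp only [hs, Nat.cast_add, Nat.cast_one]
      apply max_eq_right
      apply le_sqrt_of_sq_le
      rw [one_pow, le_div_iff₀ (by positivity), one_mul]
      exact_mod_cast (by omega : i + 1 ≤ n)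
    rw [this]; ring
  rw [Finset.prod_congr rfl e2, Finset.prod_mul_distrib, Finset.prod_const, Finset.card_range]
  refine mul_le_mul_of_nonneg_left ?_ (by positivity)
  have e3 : (∏ i ∈ Finset.range (2 * d), √((n : ℝ) / (i + 1))) ^ 2 ≤ exp (n / 2) ^ 2 := by
    rw [← Finset.prod_pow]
    have : ∀ i ∈ Finset.range (2 * d), √((n : ℝ) / (i + 1)) ^ 2 = n / (i + 1) :=
      fun i _ => sq_sqrt (by positivity)
    rw [Finset.prod_congr rfl this, ← exp_nat_mul]
    refine (prod_div_factorial_le n (by positivity) _).trans (exp_le_exp.2 ?_)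
    push_cast; linarith
  exact le_of_sq_le_sq e3 (exp_pos _).le

end SecondMoment

end SymSing

namespace SymSing

open scoped BigOperators

open Real MeasureTheory ProbabilityTheory

section Block

variable {R D : Type} [Fintype R] [Fintype D]

/-- The quadratic form attached to an off-diagonal block `h`. -/
def blockq (h : R → D → Fin 8) (x : R → ℝ) (y : D → ℝ) : ℝ :=
  (∑ i, (∑ j, lz (h i j) * y j) ^ 2) + ∑ j, (∑ i, x i * lz (h i j)) ^ 2

theorem blockq_nonneg (h : R → D → Fin 8) (x : R → ℝ) (y : D → ℝ) : 0 ≤ blockq h x y :=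
  add_nonneg (Finset.sum_nonneg fun _ _ => sq_nonneg _) (Finset.sum_nonneg fun _ _ => sq_nonneg _)

variable [DecidableEq R] [DecidableEq D]

/-- The Gaussian-type average of the block form. -/
noncomputable def blockf (n : ℕ) (x : R → ℝ) (y : D → ℝ) : ℝ :=
  𝔼 h : R → D → Fin 8, exp (-blockq h x y / (2 * n))

theorem blockf_nonneg (n : ℕ) (x : R → ℝ) (y : D → ℝ) : 0 ≤ blockf n x y :=
  expect_nonneg' fun _ => (exp_pos _).le

theorem expect_mul_expect_fun {κ : Type*} [Fintype κ] (F : (R → D → κ) → ℝ) :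
    (𝔼 h, F h) ^ 2 = 𝔼 h : R → D ⊕ D → κ,
      F (fun i j => h i (.inl j)) * F (fun i j => h i (.inr j)) := by
  let e : (R → D ⊕ D → κ) ≃ (R → D → κ) × (R → D → κ) :=
    (Equiv.piCongrRight fun _ => Equiv.sumArrowEquivProdArrow D D κ).trans
      (Equiv.arrowProdEquivProdArrow R (fun _ => D → κ) (fun _ => D → κ))
  have := expect_equiv e fun p => F p.1 * F p.2
  rw [expect_prod_type] at this
  simp_rw [← Finset.mul_expect, ← Finset.expect_mul] at this
  rw [sq, ← this]
  rfl

theorem blockf_sq (n : ℕ) (hn : 0 < n) (x : R → ℝ) (y : D → ℝ) :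
    blockf n x y ^ 2 = 𝔼 h : R → D ⊕ D → Fin 8, (∏ i, roww (1 / √n) y (h i)) *
      exp (-(∑ l, (∑ i, x i * lz (h i l)) ^ 2) / (2 * n)) := by
  rw [blockf, expect_mul_expect_fun]
  refine Finset.expect_congr rfl fun h _ => ?_
  simp only [roww]
  rw [← exp_sum, ← exp_add, ← exp_add, Fintype.sum_sum_type]
  congr 1
  have hn' : (0 : ℝ) < n := by exact_mod_cast hn
  have e : ∀ u : D → ℝ, (∑ j, u j * (1 / √n * y j)) ^ 2 = (∑ j, u j * y j) ^ 2 / n := by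
    intro u
    have : ∑ j, u j * (1 / √n * y j) = (∑ j, u j * y j) / √n := by
      rw [Finset.sum_div]; exact Finset.sum_congr rfl fun _ _ => by ring
    rw [this, div_pow, sq_sqrt hn'.le]
  simp only [e, blockq, neg_div, Finset.sum_neg_distrib, Finset.sum_add_distrib,
    ← Finset.sum_div]
  field_simp
  ring

theorem sum_blockf_sq_le {K : Type} [Fintype K] (c : K → ℤ) (hc : Function.Injective c) {n : ℕ}
    {N : ℝ} (hN : 1 ≤ N) (hdn : 2 * Fintype.card D ≤ n)
    (hNm : 640 * log N + 2 * Fintype.card D ≤ Fintype.card R) (hD : 0 < Fintype.card D)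
    (y : D → ℝ) :
    ∑ x : R → K, exp (-(∑ i, ((c (x i) : ℝ) / N) ^ 2)) * blockf n (fun i => c (x i)) y ^ 2 ≤
    (24 * N * conc (1 / √n) y ^ 2) ^ Fintype.card R *
      ((48 / N) ^ (2 * Fintype.card D) * exp (n / 2)) := by
  refine le_trans (le_of_eq ?_) (expect_roww_sum_le (1 / √n) y c hc hN hdn hNm hD)
  simp_rw [blockf_sq n (by omega), Finset.mul_expect, ← Finset.sum_neg_distrib, exp_sum]
  rw [← Finset.expect_sum_comm]
  let e := Fintype.equivFin R
  rw [← expect_equiv (e.arrowCongr (Equiv.refl (D ⊕ D → Fin 8)))]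
  refine Finset.expect_congr rfl fun h _ => ?_
  rw [Finset.mul_sum, ← Equiv.sum_comp (e.arrowCongr (Equiv.refl K))]
  refine Finset.sum_congr rfl fun x _ => ?_
  simp only [Equiv.arrowCongr_apply, Equiv.coe_refl, Function.comp_apply, id]
  rw [Equiv.prod_comp e.symm (fun i => roww (1 / √n) y (h i)),
    Equiv.prod_comp e.symm (fun i => exp (-((c (x i) : ℝ) / N) ^ 2))]
  have : ∀ l, ∑ i, (c (x (e.symm i)) : ℝ) * lz (h (e.symm i) l) = ∑ i, (c (x i) : ℝ) * lz (h i l) :=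
    fun l => Equiv.sum_comp e.symm (fun i => (c (x i) : ℝ) * lz (h i l))
  simp only [this]
  ring

end Block

/-- A vector whose dilates stay away from the lattice `πℤ` on a long range of scales. -/
def Spread {D : Type} [Fintype D] (y : D → ℝ) (B α δ : ℝ) : Prop :=
  ∀ t : ℝ, 1 / (2 * B) ≤ t → t ≤ δ → α * Fintype.card D ≤ ∑ j, sin (t * y j) ^ 2

theorem Spread.abs {D : Type} [Fintype D] {y : D → ℝ} {B α δ : ℝ} (h : Spread y B α δ) {t : ℝ}
    (h1 : 1 / (2 * B) ≤ |t|) (h2 : |t| ≤ δ) : α * Fintype.card D ≤ ∑ j, sin (t * y j) ^ 2 := by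
  refine (h |t| h1 h2).trans (le_of_eq (Finset.sum_congr rfl fun j _ => ?_))
  rcases abs_choice t with e | e <;> rw [e]
  rw [neg_mul, sin_neg, neg_sq]

theorem sin_sq_ge_of_abs_le {x : ℝ} (hx : |x| ≤ 1) : x ^ 2 / 4 ≤ sin x ^ 2 := by
  have h1 : ∀ z : ℝ, 0 ≤ z → z ≤ 1 → z / 2 ≤ sin z := by
    intro z h0 h1
    rcases h0.eq_or_lt with rfl | h
    · simp
    have := sin_gt_sub_cube h
    nlinarith [mul_nonneg h0 (by nlinarith : 0 ≤ 1 - z ^ 2)]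
  have h2 := h1 |x| (abs_nonneg _) hx
  have h3 : sin |x| ^ 2 = sin x ^ 2 := by
    rcases abs_choice x with e | e <;> rw [e]
    rw [sin_neg, neg_sq]
  rw [← h3, ← sq_abs x]
  nlinarith [abs_nonneg x]

theorem inv_sqrt_integrable {c : ℝ} (hc : c < 1 / 2) :
    Integrable (fun x => exp (c * x ^ 2)) (gaussianReal 0 1) := by
  by_contra h
  have h1 := integral_exp_sq_one hc
  rw [integral_undef h] at h1
  have : 0 < 1 - 2 * c := by linarith
  have : 0 < (√(1 - 2 * c))⁻¹ := by positivity
  exact this.ne h1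

theorem conc_le {D : Type} [Fintype D] {y : D → ℝ} {B α δ b : ℝ} {n : ℕ} (hn : 0 < n)
    (hB : 0 < B) (hδ : 0 < δ) (hb : 0 < b) (hy : Spread y B α δ) (hyB : ∀ j, |y j| ≤ B)
    (hyb : 640 * n * b ≤ ∑ j, y j ^ 2) :
    conc (1 / √n) y ≤ 1 / √(2 * b) + exp (-(α * Fintype.card D / 160)) +
      2 * exp (-(δ ^ 2 * n / 4)) := by
  have hn' : (0 : ℝ) < n := by exact_mod_cast hn
  have hs : 0 < √(n : ℝ) := sqrt_pos.2 hn'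
  have hs2 : √(n : ℝ) ^ 2 = n := sq_sqrt hn'.le
  have hpt : ∀ θ : ℝ, exp (-(1 / 160 * ∑ j, sin (θ * (1 / √n * y j)) ^ 2)) ≤
      exp (-b * θ ^ 2) + exp (-(α * Fintype.card D / 160)) +
        exp (-(δ ^ 2 * n / 4)) * exp (1 / 4 * θ ^ 2) := by
    intro θ
    have hre : ∀ j, θ * (1 / √n * y j) = θ / √n * y j := fun j => by ring
    simp_rw [hre]
    set t := θ / √n with ht
    have hθ : θ = t * √n := by rw [ht]; field_simp
    have hθ2 : θ ^ 2 = t ^ 2 * n := by rw [hθ, mul_pow, hs2]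
    have p1 := exp_pos (-b * θ ^ 2)
    have p2 := exp_pos (-(α * Fintype.card D / 160))
    have p3 : 0 < exp (-(δ ^ 2 * n / 4)) * exp (1 / 4 * θ ^ 2) := by positivity
    rcases le_total |t| (1 / (2 * B)) with h | h
    · suffices exp (-(1 / 160 * ∑ j, sin (t * y j) ^ 2)) ≤ exp (-b * θ ^ 2) by linarith
      apply exp_le_exp.2
      have h1 : ∀ j, t ^ 2 * y j ^ 2 / 4 ≤ sin (t * y j) ^ 2 := by
        intro j
        rw [← mul_pow]
        apply sin_sq_ge_of_abs_le
        rw [abs_mul]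
        calc |t| * |y j| ≤ 1 / (2 * B) * B := by
              gcongr
              exact hyB j
          _ ≤ 1 := by field_simp; norm_num
      have h2 : t ^ 2 / 4 * ∑ j, y j ^ 2 ≤ ∑ j, sin (t * y j) ^ 2 := by
        rw [Finset.mul_sum]
        exact Finset.sum_le_sum fun j _ => by linarith [h1 j]
      rw [hθ2]
      nlinarith [mul_le_mul_of_nonneg_left hyb (sq_nonneg t)]
    · rcases le_total |t| δ with h' | h'
      · suffices exp (-(1 / 160 * ∑ j, sin (t * y j) ^ 2)) ≤
            exp (-(α * Fintype.card D / 160)) by linarith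
        apply exp_le_exp.2
        linarith [hy.abs h h']
      · suffices exp (-(1 / 160 * ∑ j, sin (t * y j) ^ 2)) ≤
            exp (-(δ ^ 2 * n / 4)) * exp (1 / 4 * θ ^ 2) by linarith
        rw [← exp_add]
        apply exp_le_exp.2
        have h1 : δ ^ 2 ≤ t ^ 2 := by
          rw [← sq_abs t]; gcongr
        have h2 : 0 ≤ ∑ j, sin (t * y j) ^ 2 := Finset.sum_nonneg fun _ _ => sq_nonneg _
        rw [hθ2]
        nlinarith
  have i1 : Integrable (fun x => exp (-b * x ^ 2)) (gaussianReal 0 1) :=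
    inv_sqrt_integrable (by linarith)
  have i2 : Integrable (fun x => exp (1 / 4 * x ^ 2)) (gaussianReal 0 1) :=
    inv_sqrt_integrable (by norm_num)
  have i12 : Integrable (fun x => exp (-b * x ^ 2) + exp (-(α * Fintype.card D / 160)))
      (gaussianReal 0 1) := i1.add (integrable_const _)
  have hintg := integral_mono_of_nonneg (μ := gaussianReal 0 1)
    (Filter.Eventually.of_forall fun θ => (exp_pos _).le)
    (i12.add (i2.const_mul _)) (Filter.Eventually.of_forall hpt)
  rw [conc]
  refine hintg.trans ?_
  change ∫ θ, (exp (-b * θ ^ 2) + exp (-(α * Fintype.card D / 160))) +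
    exp (-(δ ^ 2 * n / 4)) * exp (1 / 4 * θ ^ 2) ∂gaussianReal 0 1 ≤ _
  rw [integral_add i12 (i2.const_mul _),
    integral_add i1 (integrable_const _), integral_const_mul,
    integral_exp_sq_one (by linarith), integral_exp_sq_one (by norm_num)]
  simp only [integral_const, probReal_univ, one_smul, smul_eq_mul]
  have e1 : (√(1 - 2 * -b))⁻¹ ≤ 1 / √(2 * b) := by
    rw [inv_eq_one_div]
    gcongr
    linarith
  have e2 : (√(1 - 2 * (1 / 4 : ℝ)))⁻¹ ≤ 2 := by
    rw [inv_le_comm₀ (by apply sqrt_pos.2; norm_num) (by norm_num)]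
    apply le_sqrt_of_sq_le; norm_num
  have p3 := exp_pos (-(δ ^ 2 * n / 4))
  nlinarith

end SymSing

namespace SymSing

open scoped BigOperators

open Real

theorem card_le_of_diff_le (S : Finset ℤ) {w : ℝ} (hw : 0 ≤ w)
    (h : ∀ a ∈ S, ∀ b ∈ S, ((b - a : ℤ) : ℝ) ≤ w) : (S.card : ℝ) ≤ w + 1 := by
  rcases S.eq_empty_or_nonempty with rfl | hS
  · simp; linarith
  have hsub : S ⊆ Finset.Icc (S.min' hS) (S.max' hS) := fun x hx =>
    Finset.mem_Icc.2 ⟨S.min'_le x hx, S.le_max' x hx⟩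
  have h1 := Finset.card_le_card hsub
  rw [Int.card_Icc] at h1
  have h2 := h _ (S.min'_mem hS) _ (S.max'_mem hS)
  have h3 : S.min' hS ≤ S.max' hS := S.min'_le _ (S.max'_mem hS)
  have h4 : ((S.max' hS + 1 - S.min' hS).toNat : ℤ) = S.max' hS + 1 - S.min' hS :=
    Int.toNat_of_nonneg (by omega)
  have h5 : (S.card : ℤ) ≤ S.max' hS + 1 - S.min' hS := by rw [← h4]; exact_mod_cast h1
  have h6 : (S.card : ℝ) ≤ ((S.max' hS + 1 - S.min' hS : ℤ) : ℝ) := by exact_mod_cast h5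
  push_cast at h6 h2
  linarith

theorem card_small_sin_le {B : ℕ} (hB : 1 ≤ B) {t η : ℝ} (ht0 : 1 / (4 * B) ≤ t) (ht1 : t ≤ 1)
    (hη : 0 < η) :
    (((Finset.Icc (-B : ℤ) B).filter fun x : ℤ => |sin (t * x)| < η).card : ℝ) ≤
      32 * B * η + 8 * B * t := by
  have hB' : (1 : ℝ) ≤ B := by exact_mod_cast hB
  have ht : 0 < t := lt_of_lt_of_le (by positivity) ht0
  have hBt : 1 ≤ 4 * B * t := by
    rw [div_le_iff₀ (by positivity)] at ht0; linarith
  set S := (Finset.Icc (-B : ℤ) B).filter fun x : ℤ => |sin (t * x)| < η with hS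
  set L : ℕ := ⌊1 / t⌋₊ with hL
  have hL1 : 1 ≤ L := by
    rw [hL, Nat.one_le_floor_iff, le_div_iff₀ ht]; linarith
  have hL2 : (L : ℝ) ≤ 1 / t := Nat.floor_le (by positivity)
  have hL3 : 1 / (2 * t) ≤ L := by
    have h1 : 1 / t < L + 1 := Nat.lt_floor_add_one _
    have h2 : (1 : ℝ) ≤ L := by exact_mod_cast hL1
    have : 1 / (2 * t) = 1 / t / 2 := by field_simp
    rw [this]; linarith
  have hLpos : (0 : ℝ) < L := by exact_mod_cast hL1
  have hfib : ∀ j ∈ Finset.range (2 * B / L + 1),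
      ((S.filter fun x : ℤ => ((x + B).toNat / L) = j).card : ℝ) ≤ 4 * η / t + 1 := by
    intro j _
    apply card_le_of_diff_le _ (by positivity)
    intro a ha b hb
    rw [Finset.mem_filter, hS, Finset.mem_filter, Finset.mem_Icc] at ha hb
    rcases le_total b a with hab | hab
    · have : ((b - a : ℤ) : ℝ) ≤ 0 := by exact_mod_cast (by omega)
      exact this.trans (by positivity)
    have hdiff : b - a < L := by
      have h1 := Nat.div_add_mod (a + B).toNat L
      have h2 := Nat.div_add_mod (b + B).toNat L
      have h3 := Nat.mod_lt (b + B).toNat (by omega : L > 0)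
      rw [ha.2] at h1
      rw [hb.2] at h2
      omega
    have hy0 : (0 : ℝ) ≤ ((b - a : ℤ) : ℝ) := by exact_mod_cast (by omega)
    have hy1 : ((b - a : ℤ) : ℝ) ≤ L := by exact_mod_cast hdiff.le
    set y : ℝ := ((b - a : ℤ) : ℝ) with hy
    have hty : |t * y| ≤ 1 := by
      rw [abs_of_nonneg (by positivity)]
      calc t * y ≤ t * (1 / t) := by gcongr; linarith
        _ = 1 := by field_simp
    have h1 := sin_sq_ge_of_abs_le hty
    have h2 : |sin (t * y)| ≤ 2 * η := by
      have : t * y = t * b - t * a := by rw [hy]; push_cast; ring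
      rw [this, sin_sub]
      have c1 := abs_cos_le_one (t * a)
      have c2 := abs_cos_le_one (t * b)
      calc |sin (t * b) * cos (t * a) - cos (t * b) * sin (t * a)|
          ≤ |sin (t * b) * cos (t * a)| + |cos (t * b) * sin (t * a)| := abs_sub _ _
        _ = |sin (t * b)| * |cos (t * a)| + |cos (t * b)| * |sin (t * a)| := by
            rw [abs_mul, abs_mul]
        _ ≤ |sin (t * b)| * 1 + 1 * |sin (t * a)| := by gcongr
        _ ≤ 2 * η := by linarith [ha.1.2, hb.1.2]
    have h3 : (t * y / 2) ^ 2 ≤ (2 * η) ^ 2 := by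
      have : sin (t * y) ^ 2 ≤ (2 * η) ^ 2 := by
        rw [← sq_abs (sin (t * y))]; gcongr
      nlinarith
    have h4 := abs_le_of_sq_le_sq h3 (by positivity)
    rw [le_div_iff₀ ht]
    linarith [le_abs_self (t * y / 2)]
  have hmaps : ∀ x ∈ S, (x + B).toNat / L ∈ Finset.range (2 * B / L + 1) := by
    intro x hx
    rw [hS, Finset.mem_filter, Finset.mem_Icc] at hx
    rw [Finset.mem_range]
    exact Nat.lt_succ_of_le (Nat.div_le_div_right (by omega))
  have hcard := Finset.card_eq_sum_card_fiberwise hmaps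
  have hcard' : (S.card : ℝ) ≤ ((2 * B / L + 1 : ℕ) : ℝ) * (4 * η / t + 1) := by
    rw [hcard]
    push_cast
    refine (Finset.sum_le_sum hfib).trans (le_of_eq ?_)
    rw [Finset.sum_const, Finset.card_range, nsmul_eq_mul]
    push_cast
    ring
  have hwin : ((2 * B / L + 1 : ℕ) : ℝ) ≤ 8 * B * t := by
    have h1 : ((2 * B / L : ℕ) : ℝ) ≤ (2 * B : ℝ) / L := by
      have := @Nat.cast_div_le ℝ _ _ _ (2 * B) L
      simpa using this
    have h2 : (2 * B : ℝ) / L ≤ 4 * B * t := by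
      rw [div_le_iff₀ hLpos]
      calc (2 * B : ℝ) = 4 * B * t * (1 / (2 * t)) := by field_simp; norm_num
        _ ≤ 4 * B * t * L := by gcongr
    push_cast at h1 ⊢
    linarith
  refine hcard'.trans ((mul_le_mul_of_nonneg_right hwin (by positivity)).trans (le_of_eq ?_))
  field_simp
  ring

theorem sum_exp_sin_sq_le {B : ℕ} (hB : 1 ≤ B) {t η s δ : ℝ} (ht0 : 1 / (4 * B) ≤ t) (ht1 : t ≤ 1)
    (hη : 0 < η) (hs : 0 ≤ s) (htδ : t ≤ δ) :
    ∑ x ∈ Finset.Icc (-B : ℤ) B, exp (-(s * sin (t * x) ^ 2)) ≤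
      (32 * η + 8 * δ + 3 * exp (-(s * η ^ 2))) * B := by
  have hB' : (1 : ℝ) ≤ B := by exact_mod_cast hB
  rw [← Finset.sum_filter_add_sum_filter_not _ (fun x : ℤ => |sin (t * x)| < η)]
  have h1 : ∑ x ∈ (Finset.Icc (-B : ℤ) B).filter (fun x : ℤ => |sin (t * x)| < η),
      exp (-(s * sin (t * x) ^ 2)) ≤ 32 * B * η + 8 * B * t := by
    refine le_trans (Finset.sum_le_card_nsmul _ _ 1 fun x _ => ?_) ?_
    · exact exp_le_one_iff.2 (by nlinarith [mul_nonneg hs (sq_nonneg (sin (t * x)))])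
    · rw [nsmul_eq_mul, mul_one]
      exact card_small_sin_le hB ht0 ht1 hη
  have h2 : ∑ x ∈ (Finset.Icc (-B : ℤ) B).filter (fun x : ℤ => ¬|sin (t * x)| < η),
      exp (-(s * sin (t * x) ^ 2)) ≤ 3 * B * exp (-(s * η ^ 2)) := by
    refine le_trans (Finset.sum_le_card_nsmul _ _ (exp (-(s * η ^ 2))) fun x hx => ?_) ?_
    · rw [Finset.mem_filter, not_lt] at hx
      apply exp_le_exp.2
      have : η ^ 2 ≤ sin (t * x) ^ 2 := by
        rw [← sq_abs (sin _)]; exact pow_le_pow_left₀ hη.le hx.2 2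
      nlinarith
    · rw [nsmul_eq_mul]
      refine mul_le_mul_of_nonneg_right ?_ (exp_pos _).le
      have h3 := Finset.card_filter_le (Finset.Icc (-B : ℤ) B) (fun x : ℤ => ¬|sin (t * x)| < η)
      rw [Int.card_Icc] at h3
      have h4 : ((B : ℤ) + 1 - (-B : ℤ)).toNat = 2 * B + 1 := by omega
      rw [h4] at h3
      have h5 : (((Finset.Icc (-B : ℤ) B).filter (fun x : ℤ => ¬|sin (t * x)| < η)).card : ℝ) ≤
          2 * B + 1 := by exact_mod_cast h3
      linarith
  nlinarith

open Classical in
theorem card_not_spread_le {ε : ℝ} (hε : 0 < ε) : ∃ α > 0, ∃ δ > 0, ∃ C > 0,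
    ∀ (D : Type) [Fintype D] [DecidableEq D] (B : ℕ), 1 ≤ B →
      ((Finset.univ.filter fun y : D → ↥(Finset.Icc (-B : ℤ) B) =>
        ¬ Spread (fun j => ((y j : ℤ) : ℝ)) B α δ).card : ℝ) ≤
        C * B * (ε * B) ^ Fintype.card D := by
  set e₁ := ε / exp 1 with he₁
  have he₁0 : 0 < e₁ := by positivity
  set η := e₁ / 96 with hη
  set δ := min 1 (e₁ / 24) with hδ
  set s := 9 / (e₁ * η ^ 2) with hs
  set α := min (1 / 4) (1 / (3 * s)) with hα
  have hη0 : 0 < η := by positivity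
  have hδ0 : 0 < δ := by positivity
  have hs0 : 0 < s := by positivity
  have hα0 : 0 < α := by positivity
  have hα4 : α ≤ 1 / 4 := min_le_left _ _
  have hαs : s * (3 * α) ≤ 1 := by
    have : α ≤ 1 / (3 * s) := min_le_right _ _
    rw [le_div_iff₀ (by positivity)] at this
    linarith
  have hsq0 : 0 < √α := sqrt_pos.2 hα0
  have hsq2 : √α ^ 2 = α := sq_sqrt hα0.le
  have hsq1 : √α ≤ 1 / 2 := by
    apply sqrt_le_iff.2; constructor <;> linarith
  have hrow : ∀ (B : ℕ), 1 ≤ B → ∀ t : ℝ, 1 / (4 * B) ≤ t → t ≤ δ →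
      ∑ x ∈ Finset.Icc (-B : ℤ) B, exp (-(s * sin (t * x) ^ 2)) ≤ e₁ * B := by
    intro B hB t h0 h1
    refine (sum_exp_sin_sq_le hB h0 (h1.trans (min_le_left _ _)) hη0 hs0.le h1).trans ?_
    refine mul_le_mul_of_nonneg_right ?_ (by positivity)
    have h2 : exp (-(s * η ^ 2)) ≤ e₁ / 9 := by
      have h3 : s * η ^ 2 = 9 / e₁ := by rw [hs]; field_simp
      rw [h3, exp_neg, inv_le_comm₀ (exp_pos _) (by positivity), inv_div]
      linarith [add_one_le_exp (9 / e₁)]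
    have h4 : δ ≤ e₁ / 24 := min_le_right _ _
    rw [hη]
    linarith
  refine ⟨α, hα0, δ, hδ0, 2 / √α + 1, by positivity, fun D _ _ B hB => ?_⟩
  have hB' : (1 : ℝ) ≤ B := by exact_mod_cast hB
  set h := √α / (2 * B) with hh
  have hh0 : 0 < h := by positivity
  set M := ⌊2 * B / √α⌋₊ + 1 with hM
  set T := (Finset.range M).filter fun k : ℕ => 1 / (4 * B) ≤ k * h ∧ k * h ≤ δ with hT
  set d := Fintype.card D with hd
  have hpt : ∀ y : D → ↥(Finset.Icc (-B : ℤ) B), ¬ Spread (fun j => ((y j : ℤ) : ℝ)) B α δ →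
      1 ≤ ∑ k ∈ T, exp 1 ^ d * ∏ j, exp (-(s * sin (k * h * (y j : ℤ)) ^ 2)) := by
    intro y hy
    simp only [Spread, not_forall, not_le] at hy
    obtain ⟨t, ht0, ht1, hlt⟩ := hy
    have ht : 0 < t := lt_of_lt_of_le (by positivity) ht0
    set k := ⌊t / h⌋₊ with hk
    have hk1 : k * h ≤ t := by
      rw [← le_div_iff₀ hh0]; exact Nat.floor_le (by positivity)
    have hk2 : t - k * h ≤ h := by
      have := Nat.lt_floor_add_one (t / h)
      rw [div_lt_iff₀ hh0] at this
      linarith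
    have hkT : k ∈ T := by
      rw [hT, Finset.mem_filter, Finset.mem_range]
      refine ⟨Nat.lt_succ_of_le (Nat.floor_le_floor ?_), ?_, hk1.trans ht1⟩
      · have : 2 * B / √α = 1 / h := by rw [hh]; field_simp
        rw [this]
        gcongr
        exact ht1.trans (min_le_left _ _)
      · have e1 : (1 : ℝ) / (4 * B) = 1 / (2 * B) - 1 / (4 * B) := by field_simp; norm_num
        have e2 : h ≤ 1 / (4 * B) := by
          rw [hh, div_le_div_iff₀ (by positivity) (by positivity)]
          nlinarith
        linarith
    refine le_trans ?_ (Finset.single_le_sum (f := fun k : ℕ => exp 1 ^ d *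
      ∏ j, exp (-(s * sin (k * h * (y j : ℤ)) ^ 2))) (fun k _ => by positivity) hkT)
    rw [← exp_sum, ← exp_nat_mul, ← exp_add, Finset.sum_neg_distrib, ← Finset.mul_sum]
    apply one_le_exp
    have h1 : ∀ j, sin (k * h * (y j : ℤ)) ^ 2 ≤ 2 * sin (t * (y j : ℤ)) ^ 2 + α / 2 := by
      intro j
      have := sin_sq_le_of_add (k * h * (y j : ℤ)) ((t - k * h) * (y j : ℤ))
      rw [← add_mul, add_sub_cancel] at this
      have hyb : |((y j : ℤ) : ℝ)| ≤ B := by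
        have := Finset.mem_Icc.1 (y j).2
        rw [abs_le]
        exact ⟨by exact_mod_cast this.1, by exact_mod_cast this.2⟩
      have h2 : ((t - k * h) * (y j : ℤ)) ^ 2 ≤ α / 4 := by
        have h3 : |(t - k * h) * (y j : ℤ)| ≤ h * B := by
          rw [abs_mul, abs_of_nonneg (by linarith : 0 ≤ t - k * h)]
          gcongr
        have h4 : h * B = √α / 2 := by rw [hh]; field_simp
        rw [← sq_abs]
        calc |(t - k * h) * (y j : ℤ)| ^ 2 ≤ (√α / 2) ^ 2 := by rw [← h4]; gcongr
          _ = α / 4 := by rw [div_pow, hsq2]; norm_num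
      linarith
    have h2 : ∑ j, sin (k * h * (y j : ℤ)) ^ 2 ≤ 3 * α * d := by
      calc ∑ j, sin (k * h * (y j : ℤ)) ^ 2 ≤ ∑ j, (2 * sin (t * (y j : ℤ)) ^ 2 + α / 2) :=
            Finset.sum_le_sum fun j _ => h1 j
        _ = 2 * ∑ j, sin (t * (y j : ℤ)) ^ 2 + α / 2 * d := by
            rw [Finset.sum_add_distrib, ← Finset.mul_sum, Finset.sum_const, Finset.card_univ,
              nsmul_eq_mul]
            ring
        _ ≤ 3 * α * d := by
            have : 0 ≤ α * (d : ℝ) := by positivity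
            nlinarith
    have h3 := mul_le_mul_of_nonneg_left h2 hs0.le
    have h4 := mul_le_mul_of_nonneg_right hαs (Nat.cast_nonneg (α := ℝ) d)
    nlinarith
  calc ((Finset.univ.filter fun y : D → ↥(Finset.Icc (-B : ℤ) B) =>
        ¬ Spread (fun j => ((y j : ℤ) : ℝ)) B α δ).card : ℝ)
      = ∑ y ∈ Finset.univ.filter fun y : D → ↥(Finset.Icc (-B : ℤ) B) =>
        ¬ Spread (fun j => ((y j : ℤ) : ℝ)) B α δ, (1 : ℝ) := by simp
    _ ≤ ∑ y ∈ Finset.univ.filter fun y : D → ↥(Finset.Icc (-B : ℤ) B) =>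
        ¬ Spread (fun j => ((y j : ℤ) : ℝ)) B α δ,
        ∑ k ∈ T, exp 1 ^ d * ∏ j, exp (-(s * sin (k * h * (y j : ℤ)) ^ 2)) :=
        Finset.sum_le_sum fun y hy => hpt y (Finset.mem_filter.1 hy).2
    _ ≤ ∑ y : D → ↥(Finset.Icc (-B : ℤ) B),
        ∑ k ∈ T, exp 1 ^ d * ∏ j, exp (-(s * sin (k * h * (y j : ℤ)) ^ 2)) :=
        Finset.sum_le_sum_of_subset_of_nonneg (Finset.filter_subset _ _)
          fun y _ _ => Finset.sum_nonneg fun k _ => by positivity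
    _ = ∑ k ∈ T, exp 1 ^ d *
        (∑ x ∈ Finset.Icc (-B : ℤ) B, exp (-(s * sin (k * h * x) ^ 2))) ^ d := by
        rw [Finset.sum_comm]
        refine Finset.sum_congr rfl fun k _ => ?_
        rw [← Finset.mul_sum]
        congr 1
        rw [← Finset.sum_coe_sort (Finset.Icc (-B : ℤ) B)
          (fun x : ℤ => exp (-(s * sin (k * h * x) ^ 2))), hd, ← Finset.card_univ,
          ← Finset.prod_const]
        rw [Finset.prod_univ_sum, Fintype.piFinset_univ]
    _ ≤ ∑ k ∈ T, exp 1 ^ d * (e₁ * B) ^ d := by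
        refine Finset.sum_le_sum fun k hk => ?_
        have hk' := (Finset.mem_filter.1 hk).2
        refine mul_le_mul_of_nonneg_left ?_ (by positivity)
        exact pow_le_pow_left₀ (Finset.sum_nonneg fun _ _ => (exp_pos _).le)
          (hrow B hB _ hk'.1 hk'.2) _
    _ = T.card * (ε * B) ^ d := by
        rw [Finset.sum_const, nsmul_eq_mul, ← mul_pow]
        congr 2
        rw [he₁]; field_simp
    _ ≤ (2 / √α + 1) * B * (ε * B) ^ d := by
        refine mul_le_mul_of_nonneg_right ?_ (by positivity)
        have h1 : (T.card : ℝ) ≤ M := by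
          have : T.card ≤ (Finset.range M).card := Finset.card_le_card (Finset.filter_subset _ _)
          rw [Finset.card_range] at this
          exact_mod_cast this
        have h2 : (M : ℝ) ≤ 2 * B / √α + 1 := by
          rw [hM]; push_cast
          linarith [Nat.floor_le (by positivity : 0 ≤ 2 * B / √α)]
        have h3 : 2 * B / √α = 2 / √α * B := by ring
        nlinarith

end SymSing

namespace SymSing

open scoped BigOperators

open Real

section

variable {R : Type} [Fintype R] [DecidableEq R]

theorem sum_gauss_pi_le (b : ℕ) {N : ℝ} (hN : 1 ≤ N) :
    ∑ x : R → ↥(Finset.Icc (-b : ℤ) b), exp (-(∑ i, (((x i : ℤ) : ℝ) / N) ^ 2)) ≤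
      (12 * N) ^ Fintype.card R := by
  simp_rw [← Finset.sum_neg_distrib, exp_sum]
  have h := Finset.prod_univ_sum (ι := R) (fun _ => Finset.univ)
    (fun (_ : R) (t : ↥(Finset.Icc (-b : ℤ) b)) => exp (-(((t : ℤ) : ℝ) / N) ^ 2))
  rw [Fintype.piFinset_univ] at h
  rw [← h, Finset.prod_const, Finset.card_univ]
  refine pow_le_pow_left₀ (Finset.sum_nonneg fun _ _ => (exp_pos _).le) ?_ _
  have := sum_exp_sq_le (fun t : ↥(Finset.Icc (-b : ℤ) b) => (t : ℤ)) Subtype.val_injective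
    (α := 1 / N) (by positivity) 0
  simp only [zero_add, mul_one_div, one_div_one_div] at this
  linarith

omit [DecidableEq R] in
theorem one_le_weight {n : ℕ} {N : ℝ} (hN : 1 ≤ N) {b : ℕ} (x : R → ↥(Finset.Icc (-b : ℤ) b))
    (hx : ∑ i, ((x i : ℤ) : ℝ) ^ 2 ≤ 4 * N ^ 2 * n) :
    1 ≤ exp (4 * n) * exp (-(∑ i, (((x i : ℤ) : ℝ) / N) ^ 2)) := by
  rw [← exp_add]
  apply one_le_exp
  have : ∑ i, (((x i : ℤ) : ℝ) / N) ^ 2 = (∑ i, ((x i : ℤ) : ℝ) ^ 2) / N ^ 2 := by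
    rw [Finset.sum_div]; exact Finset.sum_congr rfl fun _ _ => div_pow _ _ _
  rw [this]
  have : (∑ i, ((x i : ℤ) : ℝ) ^ 2) / N ^ 2 ≤ 4 * n := by
    rw [div_le_iff₀ (by positivity)]; linarith
  linarith

end

theorem good_total_le {n m d : ℕ} {N L c₁ κ : ℝ} (hN0 : 0 < N) (hL0 : 0 < L) (hRD : m + d = n)
    (hc₁ : 1 ≤ c₁) (hκ : 1 ≤ κ) :
    (6 * κ * N) ^ d * (exp (4 * n) * ((exp (-n) * (L / N) ^ n) ^ 2)⁻¹ *
      ((c₁ / N) ^ m * ((48 / N) ^ (2 * d) * exp (n / 2)))) ≤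
      (exp 7 * c₁ * (48 ^ 2 * (6 * κ)) * N / L ^ 2) ^ n := by
  set c₂ : ℝ := 48 ^ 2 * (6 * κ) with hc₂
  have hc₂1 : 1 ≤ c₂ := by rw [hc₂]; nlinarith
  have h1 : ((exp (-n) * (L / N) ^ n) ^ 2)⁻¹ = exp (2 * n) * (N / L) ^ (2 * n) := by
    rw [mul_pow, mul_inv, ← exp_nat_mul, ← exp_neg, ← pow_mul, ← inv_pow, inv_div,
      mul_comm n 2]
    congr 2
    push_cast; ring
  have h2 : (6 * κ * N) ^ d * (exp (4 * n) * (exp (2 * n) * (N / L) ^ (2 * n)) *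
      ((c₁ / N) ^ m * ((48 / N) ^ (2 * d) * exp (n / 2)))) =
      (exp (4 * n) * exp (2 * n) * exp (n / 2)) *
      (c₁ ^ m * c₂ ^ d) * (N ^ d * (N / L) ^ (2 * n) * (N⁻¹) ^ m * (N⁻¹) ^ (2 * d)) := by
    have e1 : (6 * κ * N) ^ d = (6 * κ) ^ d * N ^ d := mul_pow _ _ _
    have e2 : (48 / N) ^ (2 * d) = (48 ^ 2) ^ d * (N⁻¹) ^ (2 * d) := by
      rw [div_eq_mul_inv, mul_pow, pow_mul]
    have e3 : c₂ ^ d = (48 ^ 2) ^ d * (6 * κ) ^ d := mul_pow _ _ _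
    have e4 : (c₁ / N) ^ m = c₁ ^ m * (N⁻¹) ^ m := by rw [div_eq_mul_inv, mul_pow]
    rw [e1, e2, e3, e4]
    ac_rfl
  have h3 : N ^ d * (N / L) ^ (2 * n) * (N⁻¹) ^ m * (N⁻¹) ^ (2 * d) = (N / L ^ 2) ^ n := by
    have e : (N / L : ℝ) ^ (2 * n) = N ^ d * N ^ m * N ^ n * (1 / L ^ 2) ^ n := by
      have : 2 * n = d + m + n := by omega
      rw [div_pow, one_div, inv_pow, ← pow_mul, this, pow_add, pow_add, div_eq_mul_inv]
    rw [e, div_eq_mul_inv N, mul_pow, one_div, two_mul, pow_add]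
    have e1 : N ^ d * (N⁻¹) ^ d = 1 := by rw [← mul_pow, mul_inv_cancel₀ hN0.ne', one_pow]
    have e2 : N ^ m * (N⁻¹) ^ m = 1 := by rw [← mul_pow, mul_inv_cancel₀ hN0.ne', one_pow]
    calc _ = (N ^ d * (N⁻¹) ^ d) * (N ^ d * (N⁻¹) ^ d) * (N ^ m * (N⁻¹) ^ m) *
          (N ^ n * ((L ^ 2)⁻¹) ^ n) := by ac_rfl
      _ = _ := by rw [e1, e2, one_mul, one_mul, one_mul]
  have h4 : c₁ ^ m * c₂ ^ d ≤ (c₁ * c₂) ^ n := by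
    rw [mul_pow c₁ c₂ n]
    have hm : m ≤ n := by omega
    have hd : d ≤ n := by omega
    exact mul_le_mul (pow_le_pow_right₀ hc₁ hm) (pow_le_pow_right₀ hc₂1 hd)
      (by positivity) (by positivity)
  have h5 : exp (4 * n) * exp (2 * n) * exp (n / 2) ≤ exp 7 ^ n := by
    rw [← exp_add, ← exp_add, ← exp_nat_mul]
    apply exp_le_exp.2
    have : (0 : ℝ) ≤ n := Nat.cast_nonneg n
    linarith
  have h6 : (exp 7 * c₁ * c₂ * N / L ^ 2) ^ n =
      exp 7 ^ n * (c₁ * c₂) ^ n * (N / L ^ 2) ^ n := by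
    rw [← mul_pow, ← mul_pow]; congr 1; ring
  rw [h1, h2, h3, h6]
  gcongr

theorem bad_total_le {n m d k : ℕ} {N L A K₁ : ℝ} (hN0 : 0 < N) (hL : 1 ≤ L) (hRD : m + d = n)
    (hkd : 2 * n ≤ k * d) (hA : A ≤ exp n) (h12 : exp 5 * 12 ≤ K₁) :
    A * ((1 / L) ^ k * N) ^ d * (exp (4 * n) * (12 * N) ^ m) ≤ (K₁ * N / L ^ 2) ^ n := by
  have hL0 : 0 < L := by linarith
  have h2 : ((1 / L) ^ k) ^ d ≤ (1 / L ^ 2) ^ n := by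
    have e : (1 / L ^ 2) ^ n = (1 / L) ^ (2 * n) := by rw [pow_mul, one_div_pow L 2]
    rw [← pow_mul, e]
    apply pow_le_pow_of_le_one (by positivity) _ hkd
    rw [div_le_one hL0]; exact hL
  have h4 : N ^ d * (12 * N) ^ m ≤ 12 ^ n * N ^ n := by
    have : (12 : ℝ) ^ m ≤ 12 ^ n := pow_le_pow_right₀ (by norm_num) (by omega)
    calc N ^ d * (12 * N) ^ m = 12 ^ m * N ^ n := by
          rw [mul_pow, ← hRD, pow_add N]; ring
      _ ≤ _ := by gcongr
  have h5 : exp n * exp (4 * n) = exp 5 ^ n := by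
    rw [← exp_add, ← exp_nat_mul]; congr 1; ring
  calc A * ((1 / L) ^ k * N) ^ d * (exp (4 * n) * (12 * N) ^ m)
      = A * exp (4 * n) * ((1 / L) ^ k) ^ d * (N ^ d * (12 * N) ^ m) := by
        rw [mul_pow _ N]; ring
    _ ≤ exp n * exp (4 * n) * (1 / L ^ 2) ^ n * (12 ^ n * N ^ n) := by gcongr
    _ = (exp 5 * 12 * N / L ^ 2) ^ n := by
        rw [h5, ← mul_pow, ← mul_pow, ← mul_pow]
        congr 1; ring
    _ ≤ _ := by gcongr

set_option maxHeartbeats 1000000 in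
open Classical in
theorem card_net_le {κ₀ δ : ℝ} (hκ₀ : 0 < κ₀) (hδ : 0 < δ) {κ₁ : ℕ} (hκ₁ : 1 ≤ κ₁) :
    ∃ K > 0, ∀ L : ℝ, 1 ≤ L → ∃ c > 0, ∃ n₀ : ℕ, ∀ n ≥ n₀, ∀ (R D : Type) [Fintype R] [Fintype D]
      [DecidableEq R] [DecidableEq D],
      Fintype.card R + Fintype.card D = n → 4 * Fintype.card D ≤ n →
      δ * n ≤ Fintype.card D → ∀ N : ℕ, 1 ≤ N → (N : ℝ) ≤ exp (c * n) → ∀ b : ℕ,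
      ((Finset.univ.filter fun p : (R → ↥(Finset.Icc (-b : ℤ) b)) ×
          (D → ↥(Finset.Icc (-(2 * κ₁ * N : ℕ) : ℤ) (2 * κ₁ * N : ℕ))) =>
        (∀ j, κ₀ * N / 2 ≤ |((p.2 j : ℤ) : ℝ)|) ∧
        ∑ i, ((p.1 i : ℤ) : ℝ) ^ 2 ≤ 4 * (N : ℝ) ^ 2 * n ∧
        exp (-n) * (L / N) ^ n ≤ blockf n (fun i => ((p.1 i : ℤ) : ℝ))
          (fun j => ((p.2 j : ℤ) : ℝ))).card : ℝ) ≤ (K * N / L ^ 2) ^ n := by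
  have hκ₁' : (1 : ℝ) ≤ κ₁ := by exact_mod_cast hκ₁
  set R₁ := 1 / √(δ * κ₀ ^ 2 / 1280) with hR₁
  have hR₁0 : 0 < R₁ := by positivity
  set R₀ := R₁ + 3 with hR₀
  have hR₀3 : 3 ≤ R₀ := by linarith
  set c₁ : ℝ := 24 * R₀ ^ 2 with hc₁
  set c₂ : ℝ := 48 ^ 2 * (6 * κ₁) with hc₂
  have hc₁1 : 1 ≤ c₁ := by rw [hc₁]; nlinarith
  have hc₂1 : 1 ≤ c₂ := by rw [hc₂]; nlinarith
  set K₁ := exp 7 * c₁ * c₂ with hK₁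
  have hK₁0 : 0 < K₁ := by positivity
  refine ⟨2 * K₁, by positivity, fun L hL => ?_⟩
  set k := ⌈2 / δ⌉₊ with hk
  have hkδ : 2 ≤ δ * k := by
    have := Nat.le_ceil (2 / δ)
    rw [div_le_iff₀ hδ] at this
    linarith
  set ε : ℝ := (1 / L) ^ k / (2 * κ₁) with hε
  have hL0 : 0 < L := by linarith
  have hε0 : 0 < ε := by positivity
  obtain ⟨α, hα, δ₁, hδ₁, C, hC, hbad⟩ := card_not_spread_le hε0
  set c := min (1 / 2560) (min (α * δ / 160) (δ₁ ^ 2 / 4)) with hc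
  have hc0 : 0 < c := by positivity
  refine ⟨c, hc0, ⌈2 * (C * (2 * κ₁))⌉₊ + 1, fun n hn R D _ _ _ _ hRD hdn hδd N hN hNc b => ?_⟩
  have hn1 : 1 ≤ n := by omega
  have hn' : (1 : ℝ) ≤ n := by exact_mod_cast hn1
  have hN' : (1 : ℝ) ≤ N := by exact_mod_cast hN
  have hN0 : (0 : ℝ) < N := by linarith
  set m := Fintype.card R with hm
  set d := Fintype.card D with hd
  have hd0 : 0 < d := by
    have : (0 : ℝ) < d := lt_of_lt_of_le (by positivity) hδd
    exact_mod_cast this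
  set B := 2 * κ₁ * N with hB
  have hB' : (B : ℝ) = 2 * κ₁ * N := by rw [hB]; push_cast; ring
  have hB1 : 1 ≤ B := by rw [hB]; nlinarith
  set lam := exp (-n) * (L / N) ^ n with hlam
  have hlam0 : 0 < lam := by positivity
  set Y := D → ↥(Finset.Icc (-B : ℤ) B)
  set XX := R → ↥(Finset.Icc (-b : ℤ) b)
  set P : XX → Y → Prop := fun x y => (∀ j, κ₀ * N / 2 ≤ |((y j : ℤ) : ℝ)|) ∧
        ∑ i, ((x i : ℤ) : ℝ) ^ 2 ≤ 4 * (N : ℝ) ^ 2 * n ∧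
        lam ≤ blockf n (fun i => ((x i : ℤ) : ℝ)) (fun j => ((y j : ℤ) : ℝ)) with hP
  have hcardP : ((Finset.univ.filter fun p : XX × Y => P p.1 p.2).card : ℝ) =
      ∑ y : Y, ((Finset.univ.filter fun x : XX => P x y).card : ℝ) := by
    simp_rw [Finset.card_filter]
    push_cast
    rw [Fintype.sum_prod_type_right]
  change ((Finset.univ.filter fun p : XX × Y => P p.1 p.2).card : ℝ) ≤ _
  rw [hcardP]
  set G := exp (4 * n) * (lam ^ 2)⁻¹ * ((c₁ / N) ^ m * ((48 / N) ^ (2 * d) * exp (n / 2))) with hG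
  set H := exp (4 * n) * (12 * (N : ℝ)) ^ m with hH
  have hG0 : 0 ≤ G := by positivity
  have hH0 : 0 ≤ H := by positivity
  have hlogN : 640 * log N + 2 * d ≤ m := by
    have h1 : log N ≤ c * n := by rw [log_le_iff_le_exp hN0]; exact hNc
    have h2 : c ≤ 1 / 2560 := min_le_left _ _
    have h3 : (m : ℝ) + d = n := by exact_mod_cast hRD
    have h4 : 4 * (d : ℝ) ≤ n := by exact_mod_cast hdn
    nlinarith
  have hyabs : ∀ (y : Y) j, |((y j : ℤ) : ℝ)| ≤ B := by
    intro y j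
    have := Finset.mem_Icc.1 (y j).2
    rw [abs_le]
    exact ⟨by exact_mod_cast this.1, by exact_mod_cast this.2⟩
  have hgood : ∀ y : Y, Spread (fun j => ((y j : ℤ) : ℝ)) B α δ₁ →
      ((Finset.univ.filter fun x : XX => P x y).card : ℝ) ≤ G := by
    intro y hy
    by_cases hyκ : ∀ j, κ₀ * N / 2 ≤ |((y j : ℤ) : ℝ)|
    swap
    · have : (Finset.univ.filter fun x : XX => P x y) = ∅ := by
        apply Finset.filter_false_of_mem
        intro x _ hx
        exact hyκ hx.1
      rw [this]
      simpa using hG0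
    have hconc : conc (1 / √n) (fun j => ((y j : ℤ) : ℝ)) ≤ R₀ / N := by
      have hb0 : 0 < δ * κ₀ ^ 2 * N ^ 2 / 2560 := by positivity
      refine (conc_le (by omega) (by exact_mod_cast hB1) hδ₁ hb0 hy (hyabs y) ?_).trans ?_
      · calc 640 * n * (δ * κ₀ ^ 2 * N ^ 2 / 2560) = (δ * n) * (κ₀ * N / 2) ^ 2 := by ring
          _ ≤ d * (κ₀ * N / 2) ^ 2 := by gcongr
          _ = ∑ j : D, (κ₀ * N / 2) ^ 2 := by
              rw [Finset.sum_const, Finset.card_univ, nsmul_eq_mul]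
          _ ≤ _ := by
              refine Finset.sum_le_sum fun j _ => ?_
              rw [← sq_abs ((y j : ℤ) : ℝ)]
              exact pow_le_pow_left₀ (by positivity) (hyκ j) 2
      · have e1 : 1 / √(2 * (δ * κ₀ ^ 2 * N ^ 2 / 2560)) = R₁ / N := by
          have : 2 * (δ * κ₀ ^ 2 * N ^ 2 / 2560) = δ * κ₀ ^ 2 / 1280 * (N : ℝ) ^ 2 := by ring
          rw [this, sqrt_mul (by positivity), sqrt_sq hN0.le, hR₁, div_div]
        have hcn : ∀ u, c ≤ u → exp (-(u * n)) ≤ 1 / N := by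
          intro u hu
          rw [exp_neg, ← one_div]
          apply one_div_le_one_div_of_le hN0
          refine hNc.trans (exp_le_exp.2 ?_)
          gcongr
        have e2 : exp (-(α * d / 160)) ≤ 1 / N := by
          refine le_trans (exp_le_exp.2 ?_) (hcn _ ((min_le_right _ _).trans (min_le_left _ _)))
          have := mul_le_mul_of_nonneg_left hδd hα.le
          linarith
        have e3 : exp (-(δ₁ ^ 2 * n / 4)) ≤ 1 / N := by
          refine le_trans (exp_le_exp.2 ?_) (hcn _ ((min_le_right _ _).trans (min_le_right _ _)))
          linarith
        rw [e1, hR₀, add_div]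
        have : (3 : ℝ) / N = 3 * (1 / N) := by ring
        linarith
    have hconc0 : 0 ≤ conc (1 / √n) (fun j => ((y j : ℤ) : ℝ)) :=
      MeasureTheory.integral_nonneg fun _ => (exp_pos _).le
    have hsm := sum_blockf_sq_le (R := R) (fun t : ↥(Finset.Icc (-b : ℤ) b) => (t : ℤ))
      Subtype.val_injective (n := n) hN' (by omega) hlogN hd0 (fun j => ((y j : ℤ) : ℝ))
    have hsm2 : (24 * N * conc (1 / √n) (fun j => ((y j : ℤ) : ℝ)) ^ 2) ^ m ≤ (c₁ / N) ^ m := by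
      apply pow_le_pow_left₀ (by positivity)
      calc 24 * N * conc (1 / √n) (fun j => ((y j : ℤ) : ℝ)) ^ 2 ≤ 24 * N * (R₀ / N) ^ 2 := by
            gcongr
        _ = c₁ / N := by rw [hc₁]; field_simp
    calc ((Finset.univ.filter fun x : XX => P x y).card : ℝ)
        = ∑ x ∈ Finset.univ.filter fun x : XX => P x y, (1 : ℝ) := by simp
      _ ≤ ∑ x ∈ Finset.univ.filter fun x : XX => P x y,
          exp (4 * n) * (lam ^ 2)⁻¹ * (exp (-(∑ i, (((x i : ℤ) : ℝ) / N) ^ 2)) *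
            blockf n (fun i => ((x i : ℤ) : ℝ)) (fun j => ((y j : ℤ) : ℝ)) ^ 2) := by
          refine Finset.sum_le_sum fun x hx => ?_
          obtain ⟨-, hx2, hx3⟩ := (Finset.mem_filter.1 hx).2
          have h1 := one_le_weight (n := n) hN' x hx2
          have h2 : 1 ≤ (lam ^ 2)⁻¹ *
              blockf n (fun i => ((x i : ℤ) : ℝ)) (fun j => ((y j : ℤ) : ℝ)) ^ 2 := by
            rw [inv_mul_eq_div, one_le_div (by positivity)]
            exact pow_le_pow_left₀ hlam0.le hx3 2
          have := one_le_mul_of_one_le_of_one_le h1 h2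
          refine this.trans (le_of_eq ?_)
          ring
      _ ≤ ∑ x : XX, exp (4 * n) * (lam ^ 2)⁻¹ * (exp (-(∑ i, (((x i : ℤ) : ℝ) / N) ^ 2)) *
            blockf n (fun i => ((x i : ℤ) : ℝ)) (fun j => ((y j : ℤ) : ℝ)) ^ 2) :=
          Finset.sum_le_sum_of_subset_of_nonneg (Finset.filter_subset _ _)
            fun x _ _ => by positivity
      _ ≤ G := by
          rw [← Finset.mul_sum, hG]
          refine mul_le_mul_of_nonneg_left (hsm.trans ?_) (by positivity)
          exact mul_le_mul_of_nonneg_right hsm2 (by positivity)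
  have hall : ∀ y : Y, ((Finset.univ.filter fun x : XX => P x y).card : ℝ) ≤ H := by
    intro y
    calc ((Finset.univ.filter fun x : XX => P x y).card : ℝ)
        = ∑ x ∈ Finset.univ.filter fun x : XX => P x y, (1 : ℝ) := by simp
      _ ≤ ∑ x ∈ Finset.univ.filter fun x : XX => P x y,
          exp (4 * n) * exp (-(∑ i, (((x i : ℤ) : ℝ) / N) ^ 2)) :=
          Finset.sum_le_sum fun x hx => one_le_weight hN' x (Finset.mem_filter.1 hx).2.2.1
      _ ≤ ∑ x : XX, exp (4 * n) * exp (-(∑ i, (((x i : ℤ) : ℝ) / N) ^ 2)) :=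
          Finset.sum_le_sum_of_subset_of_nonneg (Finset.filter_subset _ _)
            fun x _ _ => by positivity
      _ ≤ H := by
          rw [← Finset.mul_sum, hH]
          exact mul_le_mul_of_nonneg_left (sum_gauss_pi_le b hN') (by positivity)
  have hYcard : (Fintype.card Y : ℝ) ≤ (6 * κ₁ * N) ^ d := by
    have h1 : Fintype.card Y = (2 * B + 1) ^ d := by
      rw [Fintype.card_fun, Fintype.card_coe, Int.card_Icc]
      congr 1
      omega
    rw [h1]
    push_cast
    apply pow_le_pow_left₀ (by positivity)
    have : (1 : ℝ) ≤ κ₁ * N := one_le_mul_of_one_le_of_one_le hκ₁' hN'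
    linarith
  have hgoodtot : (6 * κ₁ * (N : ℝ)) ^ d * G ≤ (K₁ * N / L ^ 2) ^ n := by
    rw [hG, hlam]
    exact good_total_le hN0 hL0 hRD hc₁1 hκ₁'
  have hbadtot : C * B * (ε * B) ^ d * H ≤ (K₁ * N / L ^ 2) ^ n := by
    have h12 : exp 5 * 12 ≤ K₁ := by
      have e1 : exp 5 ≤ exp 7 := exp_le_exp.2 (by norm_num)
      have e2 : 12 ≤ c₂ := by rw [hc₂]; nlinarith
      have e3 : 12 ≤ c₁ * c₂ := by nlinarith
      rw [hK₁, mul_assoc]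
      gcongr
    have hkd : 2 * n ≤ k * d := by
      have : (2 * n : ℝ) ≤ k * d := by
        have h3 := mul_le_mul_of_nonneg_right hkδ (Nat.cast_nonneg (α := ℝ) n)
        have h4 := mul_le_mul_of_nonneg_left hδd (Nat.cast_nonneg (α := ℝ) k)
        linarith
      exact_mod_cast this
    have hCB : C * B ≤ exp n := by
      have e1 : (N : ℝ) ≤ exp (n / 2) := by
        refine hNc.trans (exp_le_exp.2 ?_)
        have : c ≤ 1 / 2560 := min_le_left _ _
        nlinarith
      have e2 : C * (2 * κ₁) ≤ exp (n / 2) := by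
        have h1 : ⌈2 * (C * (2 * κ₁))⌉₊ ≤ n := by omega
        have h2 : (⌈2 * (C * (2 * κ₁))⌉₊ : ℝ) ≤ n := Nat.cast_le.2 h1
        have := (Nat.le_ceil (2 * (C * (2 * κ₁)))).trans h2
        linarith [add_one_le_exp ((n : ℝ) / 2)]
      calc C * B = C * (2 * κ₁) * N := by rw [hB']; ring
        _ ≤ exp (n / 2) * exp (n / 2) := by gcongr
        _ = exp n := by rw [← exp_add]; ring_nf
    have h1 : ε * B = (1 / L) ^ k * N := by rw [hε, hB']; field_simp
    rw [h1, hH]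
    exact bad_total_le hN0 hL hRD hkd hCB h12
  have hsum : ∑ y : Y, ((Finset.univ.filter fun x : XX => P x y).card : ℝ) ≤
      (6 * κ₁ * (N : ℝ)) ^ d * G + C * B * (ε * B) ^ d * H := by
    rw [← Finset.sum_filter_add_sum_filter_not Finset.univ
      (fun y : Y => Spread (fun j => ((y j : ℤ) : ℝ)) B α δ₁)]
    refine add_le_add ?_ ?_
    · refine (Finset.sum_le_card_nsmul _ _ G fun y hy => hgood y (Finset.mem_filter.1 hy).2).trans ?_
      rw [nsmul_eq_mul]
      refine mul_le_mul_of_nonneg_right (le_trans ?_ hYcard) hG0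
      exact_mod_cast Finset.card_le_univ _
    · refine (Finset.sum_le_card_nsmul _ _ H fun y _ => hall y).trans ?_
      rw [nsmul_eq_mul]
      exact mul_le_mul_of_nonneg_right (hbad D B hB1) hH0
  refine hsum.trans ((add_le_add hgoodtot hbadtot).trans ?_)
  have e : (2 * K₁ * N / L ^ 2) ^ n = 2 ^ n * (K₁ * N / L ^ 2) ^ n := by
    rw [← mul_pow]; congr 1; ring
  have h2 : (2 : ℝ) ≤ 2 ^ n := by
    calc (2 : ℝ) = 2 ^ 1 := by norm_num
      _ ≤ 2 ^ n := pow_le_pow_right₀ (by norm_num) hn1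
  rw [e]
  have : 0 ≤ (K₁ * N / L ^ 2) ^ n := by positivity
  nlinarith

end SymSing

namespace SymSing

open scoped BigOperators

open Real MeasureTheory ProbabilityTheory

section Probability

variable {α : Type*} [Fintype α]

open Classical in
/-- The probability of an event under the uniform distribution. -/
noncomputable def pr (P : α → Prop) : ℝ := 𝔼 a, if P a then (1 : ℝ) else 0

theorem pr_mono {P Q : α → Prop} (h : ∀ a, P a → Q a) : pr P ≤ pr Q :=
  expect_mono fun a => by
    by_cases hP : P a
    · simp [hP, h a hP]
    · simp only [hP, if_false]
      split_ifs <;> norm_num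

theorem pr_le_expect {P : α → Prop} {f : α → ℝ} (hf : ∀ a, 0 ≤ f a) (h : ∀ a, P a → 1 ≤ f a) :
    pr P ≤ 𝔼 a, f a :=
  expect_mono fun a => by
    split_ifs with hP
    · exact h a hP
    · exact hf a

theorem pr_le_one [Nonempty α] (P : α → Prop) : pr P ≤ 1 := by
  have := pr_le_expect (P := P) (f := fun _ => 1) (fun _ => zero_le_one) fun _ _ => le_rfl
  simpa using this

theorem pr_or_le (P Q : α → Prop) : pr (fun a => P a ∨ Q a) ≤ pr P + pr Q := by
  unfold pr
  rw [← Finset.expect_add_distrib]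
  refine expect_mono fun a => ?_
  by_cases hP : P a <;> by_cases hQ : Q a <;> simp [hP, hQ]

open Classical in
theorem pr_exists_le {ι : Type*} (s : Finset ι) (P : ι → α → Prop) :
    pr (fun a => ∃ i ∈ s, P i a) ≤ ∑ i ∈ s, pr (P i) := by
  unfold pr
  rw [← Finset.expect_sum_comm]
  refine expect_mono fun a => ?_
  have h0 : ∀ i ∈ s, (0 : ℝ) ≤ if P i a then 1 else 0 := fun i _ => by split_ifs <;> norm_num
  split_ifs with h
  · obtain ⟨i, hi, hP⟩ := h
    refine le_trans ?_ (Finset.single_le_sum h0 hi)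
    simp [hP]
  · exact Finset.sum_nonneg h0

theorem pr_exists_le_card {ι : Type*} (s : Finset ι) (P : ι → α → Prop) {p : ℝ}
    (h : ∀ i ∈ s, pr (P i) ≤ p) : pr (fun a => ∃ i ∈ s, P i a) ≤ s.card * p := by
  refine (pr_exists_le s P).trans ((Finset.sum_le_sum h).trans ?_)
  simp

theorem pr_equiv {β : Type*} [Fintype β] (e : α ≃ β) (P : β → Prop) :
    pr (fun a => P (e a)) = pr P := by
  classical
  exact expect_equiv e fun b => if P b then (1 : ℝ) else 0

end Probability

section Comparison

variable {ι E μ : Type*} [Fintype ι] [Fintype E] [Fintype μ] [DecidableEq ι] [DecidableEq E]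

omit [DecidableEq ι] in
theorem abs_prod_cos_le_prod_phi (f : ι → E) (hf : Function.Injective f) (t : E → ℝ) :
    |∏ e, cos (t e)| ≤ ∏ i, phi (t (f i)) := by
  classical
  rw [Finset.abs_prod]
  have h1 : ∏ i, phi (t (f i)) = ∏ e ∈ Finset.univ.map ⟨f, hf⟩, phi (t e) := by
    rw [Finset.prod_map]; rfl
  rw [h1, ← Finset.prod_mul_prod_compl (Finset.univ.map ⟨f, hf⟩) (fun e => |cos (t e)|)]
  refine (mul_le_of_le_one_right (Finset.prod_nonneg fun _ _ => abs_nonneg _)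
    (Finset.prod_le_one (fun _ _ => abs_nonneg _) fun e _ => abs_cos_le_one _)).trans ?_
  exact Finset.prod_le_prod (fun _ _ => abs_nonneg _) fun e _ => abs_cos_le_phi _

/-- Replacing signs by lazy signs on a subset of the coordinates, and forgetting the others,
increases the Laplace transform of a shifted quadratic form. -/
theorem expect_exp_sg_le_lz (M : μ → E → ℝ) (y : μ → ℝ) (f : ι → E)
    (hf : Function.Injective f) :
    𝔼 A : E → Bool, exp (-(∑ l, (y l + ∑ e, sg (A e) * M l e) ^ 2) / 2) ≤
      𝔼 h : ι → Fin 8, exp (-(∑ l, (∑ i, lz (h i) * M l (f i)) ^ 2) / 2) := by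
  classical
  rw [expect_exp_eq]
  simp_rw [exp_neg_eq_integral]
  rw [expect_integral]
  · refine integral_mono ?_ ?_ ?_
    · refine integrable_gam_of_bound ?_ 1 ?_
      · simp_rw [Fintype.expect_eq_sum_div_card]
        fun_prop
      · intro ξ
        rw [abs_le]
        exact ⟨le_expect_of_forall_le fun A => neg_one_le_cos _,
          expect_le_of_forall_le fun A => cos_le_one _⟩
    · exact integrable_gam_of_bound
        (continuous_finsetProd _ fun i _ => continuous_phi.comp (by fun_prop)) 1
        fun x => abs_prod_phi_le_one _ _
    · intro ξ
      have h1 : ∀ A : E → Bool, ∑ l, ξ l * (y l + ∑ e, sg (A e) * M l e) =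
          ∑ l, ξ l * y l + ∑ e, sg (A e) * ∑ l, ξ l * M l e := by
        intro A
        simp_rw [mul_add, Finset.sum_add_distrib, Finset.mul_sum]
        congr 1
        rw [Finset.sum_comm]
        refine Finset.sum_congr rfl fun e _ => Finset.sum_congr rfl fun l _ => by ring
      simp_rw [h1]
      rw [expect_cos_sg]
      refine (le_abs_self _).trans ?_
      rw [abs_mul]
      refine (mul_le_of_le_one_left (abs_nonneg _) (abs_cos_le_one _)).trans ?_
      exact abs_prod_cos_le_prod_phi f hf fun e => ∑ l, ξ l * M l e
  · intro A
    exact integrable_gam_of_bound (by fun_prop) 1 fun _ => abs_cos_le_one _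

end Comparison

section Matrix

variable {V : Type} [Fintype V] [DecidableEq V]

/-- The action of the symmetric sign matrix `A` on the vector `v`. -/
noncomputable def av (A : Sym2 V → Bool) (v : V → ℝ) (i : V) : ℝ := ∑ j, sg (A s(i, j)) * v j

theorem sum_mem_add_sum_notMem (D : Finset V) (g : V → ℝ) :
    ∑ j : {j // j ∈ D}, g j + ∑ i : {i // i ∉ D}, g i = ∑ i, g i := by
  rw [← Fintype.sum_subtype_add_sum_subtype (fun i => i ∈ D)]
  congr 1
  exact Finset.sum_congr (by ext; simp) fun _ _ => rfl

theorem sum_mk_eq (v : V → ℝ) {a b : V} (hab : a ≠ b) (l : V) :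
    (∑ k, if s(l, k) = s(a, b) then v k else 0) =
      (if l = a then v b else 0) + if l = b then v a else 0 := by
  have : ∀ k, (if s(l, k) = s(a, b) then v k else 0) =
      (if k = b then (if l = a then v b else 0) else 0) +
        if k = a then (if l = b then v a else 0) else 0 := by
    intro k
    simp only [Sym2.eq_iff]
    by_cases h1 : l = a <;> by_cases h2 : k = b <;> by_cases h3 : l = b <;>
      by_cases h4 : k = a <;> simp_all
  simp_rw [this, Finset.sum_add_distrib]
  simp

theorem mul_av_eq (s : ℝ) (A : Sym2 V → Bool) (v : V → ℝ) (i : V) :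
    s * av A v i = ∑ e, sg (A e) * (s * ∑ k, if s(i, k) = e then v k else 0) := by
  unfold av
  simp_rw [Finset.mul_sum]
  rw [Finset.sum_comm]
  refine Finset.sum_congr rfl fun k _ => ?_
  rw [Finset.sum_eq_single s(i, k)]
  · simp; ring
  · intro e _ he
    rw [if_neg (Ne.symm he)]; simp
  · simp

theorem expect_exp_av_le (D : Finset V) {n : ℕ} (hn : 0 < n) (v b : V → ℝ) :
    𝔼 A : Sym2 V → Bool, exp (-(∑ i, (av A v i - b i) ^ 2) / (2 * n)) ≤
      blockf n (fun i : {i // i ∉ D} => v i) (fun j : {j // j ∈ D} => v j) := by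
  have hn' : (0 : ℝ) < n := by exact_mod_cast hn
  set s : ℝ := (√n)⁻¹ with hs
  have hs2 : s ^ 2 = 1 / n := by rw [hs, inv_pow, sq_sqrt hn'.le, one_div]
  let f : {i // i ∉ D} × {j // j ∈ D} → Sym2 V := fun p => s(p.1.1, p.2.1)
  have hf : Function.Injective f := by
    rintro ⟨⟨a, ha⟩, ⟨b, hb⟩⟩ ⟨⟨c, hc⟩, ⟨d, hd⟩⟩ h
    simp only [f, Sym2.eq_iff] at h
    rcases h with ⟨rfl, rfl⟩ | ⟨rfl, rfl⟩
    · rfl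
    · exact absurd hd ha
  have key := expect_exp_sg_le_lz (fun i e => s * ∑ k, if s(i, k) = e then v k else 0)
    (fun i => -(s * b i)) f hf
  refine le_trans (le_of_eq ?_) (key.trans (le_of_eq ?_))
  · refine Finset.expect_congr rfl fun A _ => ?_
    congr 1
    simp_rw [← mul_av_eq]
    have : ∀ i, (-(s * b i) + s * av A v i) ^ 2 = (av A v i - b i) ^ 2 * (1 / n) := by
      intro i; rw [← hs2]; ring
    simp_rw [this, ← Finset.sum_mul]
    field_simp
  · unfold blockf
    rw [← expect_equiv (Equiv.curry _ _ _)]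
    refine Finset.expect_congr rfl fun h _ => ?_
    congr 1
    unfold blockq
    have hne : ∀ (i : {i // i ∉ D}) (j : {j // j ∈ D}), (i : V) ≠ j := by
      rintro ⟨i, hi⟩ ⟨j, hj⟩ rfl; exact hi hj
    have hR : ∀ l : {i // i ∉ D}, ∑ p, lz (h p) *
        (s * ∑ k, if s((l : V), k) = f p then v k else 0) =
        s * ∑ j : {j // j ∈ D}, lz (Equiv.curry _ _ _ h l j) * v j := by
      intro l
      rw [Fintype.sum_prod_type, Finset.sum_eq_single l]
      · rw [Finset.mul_sum]
        refine Finset.sum_congr rfl fun j _ => ?_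
        simp only [f]
        rw [sum_mk_eq v (hne l j)]
        simp [hne l j]; ring
      · intro i _ hi
        refine Finset.sum_eq_zero fun j _ => ?_
        simp only [f]
        rw [sum_mk_eq v (hne i j)]
        have : (l : V) ≠ i := fun h => hi (Subtype.ext h.symm)
        simp [this, hne l j]
      · simp
    have hD : ∀ l : {j // j ∈ D}, ∑ p, lz (h p) *
        (s * ∑ k, if s((l : V), k) = f p then v k else 0) =
        s * ∑ i : {i // i ∉ D}, v i * lz (Equiv.curry _ _ _ h i l) := by
      intro l
      rw [Fintype.sum_prod_type_right, Finset.sum_eq_single l]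
      · rw [Finset.mul_sum]
        refine Finset.sum_congr rfl fun i _ => ?_
        simp only [f]
        rw [sum_mk_eq v (hne i l)]
        simp [(hne i l).symm]; ring
      · intro j _ hj
        refine Finset.sum_eq_zero fun i _ => ?_
        simp only [f]
        rw [sum_mk_eq v (hne i j)]
        have : (l : V) ≠ j := fun h => hj (Subtype.ext h.symm)
        simp [this, (hne i l).symm]
      · simp
    rw [← sum_mem_add_sum_notMem D]
    simp_rw [hR, hD, mul_pow, ← Finset.mul_sum, hs2]
    field_simp
    ring

end Matrix

end SymSing

namespace SymSing

open scoped BigOperators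

open Real MeasureTheory ProbabilityTheory

section Row

variable {R D : Type} [Fintype R] [Fintype D] [DecidableEq R] [DecidableEq D]

omit [DecidableEq R] in
theorem expect_row_le {n : ℕ} (hn : 0 < n) (y : D → ℝ) (hy : (n : ℝ) / 32 ≤ ∑ j, y j ^ 2) :
    𝔼 h : D → Fin 8, exp (-(∑ j, lz (h j) * y j) ^ 2 / (2 * n)) ≤ exp (-(1 / 160)) := by
  have hn' : (0 : ℝ) < n := by exact_mod_cast hn
  set s := ∑ j, y j ^ 2 with hs
  have hs0 : 0 < s := by linarith [show (0 : ℝ) < n / 32 by positivity]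
  obtain ⟨P, hP⟩ : ∃ P : Matrix D D ℝ, ∀ i j, P i j = y i * y j / s :=
    ⟨Matrix.of fun i j => y i * y j / s, fun _ _ => rfl⟩
  have hP1 : P.IsSymm := by
    ext i j; simp only [Matrix.transpose_apply, hP]; ring
  have hP2 : P * P = P := by
    ext i j
    simp only [Matrix.mul_apply, hP]
    have : ∀ k, y i * y k / s * (y k * y j / s) = y i * y j / s / s * y k ^ 2 := by
      intro k; ring
    simp_rw [this, ← Finset.mul_sum, ← hs]
    field_simp
  have hP3 : P.trace = 1 := by
    simp only [Matrix.trace, Matrix.diag, hP, ← sq, ← Finset.sum_div, ← hs]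
    field_simp
  have h1 := expect_exp_neg_quad_le P hP1 hP2
  rw [hP3] at h1
  refine le_trans (expect_mono fun h => ?_) h1
  apply exp_le_exp.2
  have h2 : (fun i => lz (h i)) ⬝ᵥ P.mulVec (fun i => lz (h i)) =
      (∑ j, lz (h j) * y j) ^ 2 / s := by
    simp only [dotProduct, Matrix.mulVec, hP]
    rw [sq, Finset.sum_mul_sum, Finset.sum_div]
    refine Finset.sum_congr rfl fun i _ => ?_
    rw [Finset.mul_sum, Finset.sum_div]
    exact Finset.sum_congr rfl fun j _ => by ring
  rw [h2, neg_div, neg_le_neg_iff, ← mul_div_assoc, div_le_div_iff₀ hs0 (by positivity)]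
  nlinarith [sq_nonneg (∑ j, lz (h j) * y j)]

theorem blockf_le_exp {n : ℕ} (hn : 0 < n) (x : R → ℝ) (y : D → ℝ)
    (hy : (n : ℝ) / 32 ≤ ∑ j, y j ^ 2) :
    blockf n x y ≤ exp (-(Fintype.card R / 160)) := by
  have h1 : blockf n x y ≤ 𝔼 h : R → D → Fin 8,
      ∏ i, exp (-(∑ j, lz (h i j) * y j) ^ 2 / (2 * n)) := by
    refine expect_mono fun h => ?_
    rw [← exp_sum]
    apply exp_le_exp.2
    rw [← Finset.sum_div, Finset.sum_neg_distrib]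
    refine div_le_div_of_nonneg_right ?_ (by positivity)
    rw [neg_le_neg_iff]
    exact le_add_of_nonneg_right (Finset.sum_nonneg fun _ _ => sq_nonneg _)
  refine h1.trans ?_
  rw [expect_prod_pi (fun _ (h : D → Fin 8) => exp (-(∑ j, lz (h j) * y j) ^ 2 / (2 * n)))]
  refine (Finset.prod_le_prod (fun _ _ => expect_nonneg' fun _ => (exp_pos _).le)
    fun _ _ => expect_row_le hn y hy).trans ?_
  rw [Finset.prod_const, ← exp_nat_mul, Finset.card_univ]
  apply le_of_eq
  congr 1
  ring

end Row

section Matrix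

variable {V : Type} [Fintype V] [DecidableEq V]

omit [DecidableEq V] in
theorem av_smul (A : Sym2 V → Bool) (s : ℝ) (v : V → ℝ) (i : V) :
    av A (fun j => s * v j) i = s * av A v i := by
  unfold av
  rw [Finset.mul_sum]
  exact Finset.sum_congr rfl fun j _ => by ring

omit [DecidableEq V] in
theorem av_sub (A : Sym2 V → Bool) (v w : V → ℝ) (i : V) :
    av A (fun j => v j - w j) i = av A v i - av A w i := by
  unfold av
  rw [← Finset.sum_sub_distrib]
  exact Finset.sum_congr rfl fun j _ => by ring

/-- Small ball estimate through the block function. -/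
theorem pr_ball_le_blockf (D : Finset V) {n : ℕ} (hn : 0 < n) (v b : V → ℝ) (s : ℝ) {T : ℝ} :
    pr (fun A : Sym2 V → Bool => ∑ i, (av A v i - b i) ^ 2 ≤ T) ≤ exp (s ^ 2 * T / (2 * n)) *
      blockf n (fun i : {i // i ∉ D} => s * v i) (fun j : {j // j ∈ D} => s * v j) := by
  have hn' : (0 : ℝ) < n := by exact_mod_cast hn
  have h1 := expect_exp_av_le D hn (fun i => s * v i) (fun i => s * b i)
  refine le_trans ?_ (mul_le_mul_of_nonneg_left h1 (exp_pos _).le)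
  rw [Finset.mul_expect]
  refine pr_le_expect (fun A => by positivity) fun A hA => ?_
  rw [← exp_add]
  apply one_le_exp
  simp_rw [av_smul, ← mul_sub, mul_pow, ← Finset.mul_sum]
  rw [← add_div]
  refine div_nonneg ?_ (by positivity)
  nlinarith [sq_nonneg s]

theorem pr_small_le (hV : 2 ≤ Fintype.card V) (y b : V → ℝ)
    (hy : (Fintype.card V : ℝ) / 4 ≤ ∑ i, y i ^ 2) :
    pr (fun A : Sym2 V → Bool => ∑ i, (av A y i - b i) ^ 2 ≤ (Fintype.card V : ℝ) ^ 2 / 480) ≤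
      exp (-(Fintype.card V / 600)) := by
  set n := Fintype.card V with hn
  have hn0 : 0 < n := by omega
  have hn' : (0 : ℝ) < n := by exact_mod_cast hn0
  obtain ⟨D, hD1, hD2⟩ : ∃ D : Finset V, (n : ℝ) / 8 ≤ ∑ j : {j // j ∈ D}, y j ^ 2 ∧
      n ≤ 3 * Fintype.card {i // i ∉ D} := by
    obtain ⟨D, -, hD⟩ := Finset.exists_subset_card_eq (s := (Finset.univ : Finset V)) (n := n / 2)
      (by rw [Finset.card_univ]; omega)
    have h1 := sum_mem_add_sum_notMem D (fun i => y i ^ 2)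
    have h2 : Fintype.card {i // i ∉ D} = n - D.card := by
      rw [Fintype.card_subtype_compl, Fintype.card_coe]
    have h3 := sum_mem_add_sum_notMem Dᶜ (fun i => y i ^ 2)
    have h4 : Fintype.card {i // i ∉ Dᶜ} = D.card := by
      rw [Fintype.card_subtype_compl, Fintype.card_coe, Finset.card_compl]
      have := D.card_le_univ
      omega
    by_cases h : (n : ℝ) / 8 ≤ ∑ j : {j // j ∈ D}, y j ^ 2
    · exact ⟨D, h, by omega⟩
    · refine ⟨Dᶜ, ?_, by omega⟩
      have h5 : ∑ j : {j // j ∈ Dᶜ}, y j ^ 2 = ∑ i : {i // i ∉ D}, y i ^ 2 := by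
        rw [Finset.sum_coe_sort Dᶜ (fun j => y j ^ 2)]
        have := Finset.sum_coe_sort D (fun j => y j ^ 2)
        have := Finset.sum_add_sum_compl D (fun j => y j ^ 2)
        linarith
      rw [h5]
      push Not at h
      linarith
  refine (pr_ball_le_blockf D hn0 y b (1 / 2)).trans ?_
  have h1 := blockf_le_exp (R := {i // i ∉ D}) hn0 (fun i => 1 / 2 * y i)
    (fun j : {j // j ∈ D} => 1 / 2 * y j) (by
      simp_rw [mul_pow, ← Finset.mul_sum]
      linarith)
  refine (mul_le_mul_of_nonneg_left h1 (exp_pos _).le).trans ?_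
  rw [← exp_add]
  apply exp_le_exp.2
  have h2 : (n : ℝ) ≤ 3 * Fintype.card {i // i ∉ D} := by exact_mod_cast hD2
  have h3 : (1 / 2 : ℝ) ^ 2 * ((n : ℝ) ^ 2 / 480) / (2 * n) = n / 3840 := by
    field_simp; norm_num
  rw [h3]
  linarith

theorem cosh_le_exp_sq (x : ℝ) : cosh x ≤ exp (x ^ 2 / 2) := cosh_le_exp_half_sq x

theorem expect_exp_sg {E : Type*} [Fintype E] [DecidableEq E] (t : E → ℝ) :
    𝔼 A : E → Bool, exp (∑ e, sg (A e) * t e) ≤ exp ((∑ e, t e ^ 2) / 2) := by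
  simp_rw [exp_sum]
  rw [expect_prod_pi (fun e b => exp (sg b * t e)), Finset.sum_div, exp_sum]
  refine Finset.prod_le_prod (fun _ _ => expect_nonneg' fun _ => (exp_pos _).le) fun e _ => ?_
  refine le_trans (le_of_eq ?_) (cosh_le_exp_sq (t e))
  rw [expect_bool, cosh_eq]
  simp [sg]
  try ring

theorem sum_sq_fiber_le (g : V → V → ℝ) :
    ∑ e : Sym2 V, (∑ i, ∑ k, if s(i, k) = e then g i k else 0) ^ 2 ≤
      2 * ∑ i, ∑ k, g i k ^ 2 := by
  have h1 : ∀ e : Sym2 V, (∑ i, ∑ k, if s(i, k) = e then g i k else 0) ^ 2 ≤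
      2 * ∑ i, ∑ k, if s(i, k) = e then g i k ^ 2 else 0 := by
    intro e
    rw [← Fintype.sum_prod_type' (f := fun i k => if s(i, k) = e then g i k else 0),
      ← Fintype.sum_prod_type' (f := fun i k => if s(i, k) = e then g i k ^ 2 else 0),
      ← Finset.sum_filter, ← Finset.sum_filter]
    refine sq_sum_le_card_mul_sum_sq.trans ?_
    refine mul_le_mul_of_nonneg_right ?_ (Finset.sum_nonneg fun _ _ => sq_nonneg _)
    have : (Finset.univ.filter fun p : V × V => s(p.1, p.2) = e).card ≤ 2 := by
      induction e with | _ a b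
      refine (Finset.card_le_card (t := {(a, b), (b, a)}) ?_).trans Finset.card_le_two
      rintro ⟨i, k⟩ h
      simp only [Finset.mem_filter, Finset.mem_univ, true_and, Sym2.eq_iff] at h
      simpa using h
    exact_mod_cast this
  refine (Finset.sum_le_sum fun e _ => h1 e).trans ?_
  rw [← Finset.mul_sum, Finset.sum_comm]
  apply le_of_eq
  congr 1
  refine Finset.sum_congr rfl fun i _ => ?_
  rw [Finset.sum_comm]
  refine Finset.sum_congr rfl fun k _ => ?_
  simp

theorem expect_exp_av_sq_le (hV : 0 < Fintype.card V) (r : V → ℝ) (hr : ∀ i, |r i| ≤ 1) :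
    𝔼 A : Sym2 V → Bool, exp ((∑ i, av A r i ^ 2) / (16 * Fintype.card V)) ≤
      ((√(1 - 2 * (1 / 8)))⁻¹) ^ Fintype.card V := by
  set n := Fintype.card V with hn
  have hn' : (0 : ℝ) < n := by exact_mod_cast hV
  set κ : ℝ := √(1 / (8 * n)) with hκ
  have hκ2 : κ ^ 2 = 1 / (8 * n) := by rw [hκ, sq_sqrt (by positivity)]
  have h1 : ∀ A : Sym2 V → Bool, exp ((∑ i, av A r i ^ 2) / (16 * n)) =
      ∫ ξ, exp (∑ i, ξ i * (κ * av A r i)) ∂gam V := by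
    intro A
    rw [integral_gauss_exp]
    congr 1
    simp_rw [mul_pow, ← Finset.mul_sum, hκ2]
    field_simp
    ring
  simp_rw [h1]
  rw [expect_integral _ _ fun A => integrable_gauss_exp _]
  rw [← integral_gauss_exp_sq (ι := V) (c := 1 / 8) (by norm_num)]
  refine integral_mono ?_ (integrable_gauss_exp_sq (by norm_num)) fun ξ => ?_
  · simp_rw [Fintype.expect_eq_sum_div_card]
    exact (integrable_finsetSum _ fun A _ => integrable_gauss_exp _).div_const _
  · have h2 : ∀ A : Sym2 V → Bool, ∑ i, ξ i * (κ * av A r i) = ∑ e, sg (A e) *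
        (∑ i, ∑ k, if s(i, k) = e then κ * (ξ i * r k) else 0) := by
      intro A
      simp_rw [mul_av_eq, Finset.mul_sum]
      rw [Finset.sum_comm]
      refine Finset.sum_congr rfl fun e _ => Finset.sum_congr rfl fun i _ =>
        Finset.sum_congr rfl fun k _ => ?_
      split_ifs
      · ring
      · simp
    simp_rw [h2]
    refine (expect_exp_sg _).trans (exp_le_exp.2 ?_)
    have h3 := sum_sq_fiber_le (fun i k => κ * (ξ i * r k))
    have h4 : ∑ i, ∑ k, (κ * (ξ i * r k)) ^ 2 ≤ 1 / 8 * ∑ i, ξ i ^ 2 := by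
      rw [Finset.mul_sum]
      refine Finset.sum_le_sum fun i _ => ?_
      have h5 : ∀ k ∈ Finset.univ, (κ * (ξ i * r k)) ^ 2 ≤ 1 / (8 * n) * ξ i ^ 2 := by
        intro k _
        rw [mul_pow, mul_pow, hκ2]
        refine mul_le_mul_of_nonneg_left ?_ (by positivity)
        refine mul_le_of_le_one_right (sq_nonneg _) ?_
        rw [← sq_abs]
        exact pow_le_one₀ (abs_nonneg _) (hr k)
      refine (Finset.sum_le_card_nsmul _ _ _ h5).trans (le_of_eq ?_)
      rw [Finset.card_univ, ← hn, nsmul_eq_mul]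
      field_simp
    linarith

/-- The matrix `A` is bounded from `ℓ^∞` to `ℓ^2` as expected. -/
def OpGood (A : Sym2 V → Bool) : Prop :=
  ∀ (r : V → ℝ) (t : ℝ), (∀ i, |r i| ≤ t) →
    ∑ i, av A r i ^ 2 ≤ 32 * (Fintype.card V : ℝ) ^ 2 * t ^ 2

omit [DecidableEq V] in
theorem opGood_of_signs (A : Sym2 V → Bool)
    (h : ∀ ε : V → Bool, ∑ i, av A (fun j => sg (ε j)) i ^ 2 ≤ 32 * (Fintype.card V : ℝ) ^ 2) :
    OpGood A := by
  set C := 32 * (Fintype.card V : ℝ) ^ 2 with hC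
  have h1 : ∀ r : V → ℝ, (∀ i, |r i| ≤ 1) → ∑ i, av A r i ^ 2 ≤ C := by
    intro r hr
    have hconv : ConvexOn ℝ Set.univ fun r : V → ℝ => ∑ i, av A r i ^ 2 := by
      refine ⟨convex_univ, fun x _ y _ a b ha hb hab => ?_⟩
      simp only [smul_eq_mul]
      rw [Finset.mul_sum, Finset.mul_sum, ← Finset.sum_add_distrib]
      refine Finset.sum_le_sum fun i _ => ?_
      have : av A (a • x + b • y) i = a * av A x i + b * av A y i := by
        unfold av
        rw [Finset.mul_sum, Finset.mul_sum, ← Finset.sum_add_distrib]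
        refine Finset.sum_congr rfl fun j _ => ?_
        simp only [Pi.add_apply, Pi.smul_apply, smul_eq_mul]
        ring
      rw [this]
      obtain rfl : b = 1 - a := by linarith
      nlinarith [mul_nonneg (mul_nonneg ha hb) (sq_nonneg (av A x i - av A y i))]
    have hset : Convex ℝ {r : V → ℝ | r ∈ Set.univ ∧ ∑ i, av A r i ^ 2 ≤ C} :=
      hconv.convex_le C
    have hmem : r ∈ convexHull ℝ (Set.univ.pi fun _ : V => ({-1, 1} : Set ℝ)) := by
      rw [convexHull_pi]
      intro i _
      rw [convexHull_pair, segment_eq_Icc (by norm_num)]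
      exact abs_le.1 (hr i)
    have hsub := convexHull_min (s := Set.univ.pi fun _ : V => ({-1, 1} : Set ℝ)) ?_ hset
    · exact (hsub hmem).2
    · intro x hx
      refine ⟨trivial, ?_⟩
      have := h fun j => decide (0 < x j)
      convert this using 4 with i
      funext j
      have hxj := hx j trivial
      simp only [Set.mem_insert_iff, Set.mem_singleton_iff] at hxj
      rcases hxj with hxj | hxj <;> rw [hxj] <;> norm_num [sg]
  intro r t hr
  rcases le_or_gt t 0 with ht | ht
  · have h0 : ∀ i, r i = 0 := fun i => abs_nonpos_iff.1 ((hr i).trans ht)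
    have : ∑ i, av A r i ^ 2 = 0 := by
      simp [av, h0]
    rw [this]
    positivity
  · have := h1 (fun i => t⁻¹ * r i) (fun i => by
      rw [abs_mul, abs_of_pos (inv_pos.2 ht), inv_mul_le_one₀ ht]; exact hr i)
    simp_rw [av_smul, mul_pow, ← Finset.mul_sum] at this
    rw [inv_pow, inv_mul_le_iff₀ (by positivity)] at this
    linarith

theorem pr_not_opGood_le (hV : 0 < Fintype.card V) :
    pr (fun A : Sym2 V → Bool => ¬ OpGood A) ≤ exp (-Fintype.card V) := by
  set n := Fintype.card V with hn
  have hn' : (0 : ℝ) < n := by exact_mod_cast hV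
  have h1 : pr (fun A : Sym2 V → Bool => ¬ OpGood A) ≤
      pr (fun A : Sym2 V → Bool => ∃ ε ∈ (Finset.univ : Finset (V → Bool)),
        32 * (n : ℝ) ^ 2 < ∑ i, av A (fun j => sg (ε j)) i ^ 2) := by
    refine pr_mono fun A hA => ?_
    by_contra hcon
    push Not at hcon
    exact hA (opGood_of_signs A fun ε => hcon ε (Finset.mem_univ _))
  refine h1.trans ((pr_exists_le_card _ _ (p := exp (-2 * n) *
    ((√(1 - 2 * (1 / 8)))⁻¹) ^ n) fun ε _ => ?_).trans ?_)
  · have h2 := expect_exp_av_sq_le hV (fun j => sg (ε j)) fun j => (abs_sg _).le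
    refine le_trans ?_ (mul_le_mul_of_nonneg_left h2 (exp_pos _).le)
    rw [Finset.mul_expect]
    refine pr_le_expect (fun A => by positivity) fun A hA => ?_
    rw [← exp_add]
    apply one_le_exp
    have : 2 * (n : ℝ) ≤ (∑ i, av A (fun j => sg (ε j)) i ^ 2) / (16 * n) := by
      rw [le_div_iff₀ (by positivity)]
      nlinarith
    linarith
  · rw [Finset.card_univ, Fintype.card_fun, Fintype.card_bool, ← hn]
    push_cast
    have h3 : (√(1 - 2 * (1 / 8)) : ℝ)⁻¹ ≤ 5 / 4 := by
      rw [inv_le_comm₀ (by positivity) (by norm_num)]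
      apply le_sqrt_of_sq_le
      norm_num
    have h4 : (2 : ℝ) * (√(1 - 2 * (1 / 8)))⁻¹ ≤ exp 1 := by
      have := exp_one_gt_d9
      linarith
    have h5 : (2 : ℝ) ^ n * (exp (-2 * n) * ((√(1 - 2 * (1 / 8)))⁻¹) ^ n) =
        (2 * (√(1 - 2 * (1 / 8)))⁻¹) ^ n * exp (-2 * n) := by
      rw [mul_pow]; ring
    rw [h5]
    refine (mul_le_mul_of_nonneg_right (pow_le_pow_left₀ (by positivity) h4 n)
      (exp_pos _).le).trans (le_of_eq ?_)
    rw [← exp_nat_mul, ← exp_add]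
    congr 1
    ring

end Matrix

end SymSing

namespace SymSing

open scoped BigOperators

open Real

variable {V : Type} [Fintype V] [DecidableEq V]

omit [DecidableEq V] in
/-- A one-dimensional net for a line. -/
theorem exists_line_net (x : V → ℝ) : ∃ e : V → ℝ, ∀ (s r : ℝ) (m : ℕ), 0 < r →
    ∑ i, (s * x i) ^ 2 ≤ (r * m) ^ 2 →
    ∃ k ∈ Finset.Icc (-m : ℤ) m, ∑ i, (s * x i - k * r * e i) ^ 2 ≤ r ^ 2 := by
  set q := ∑ i, x i ^ 2 with hq
  have hq0 : 0 ≤ q := Finset.sum_nonneg fun _ _ => sq_nonneg _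
  rcases hq0.eq_or_lt with h0 | h0
  · have hx : ∀ i, x i = 0 := by
      intro i
      have := (Finset.sum_eq_zero_iff_of_nonneg (fun i _ => sq_nonneg (x i))).1 h0.symm i
        (Finset.mem_univ _)
      exact pow_eq_zero_iff (two_ne_zero) |>.1 this
    refine ⟨fun _ => 0, fun s r m hr _ => ⟨0, by simp, ?_⟩⟩
    simp only [hx, mul_zero, sub_zero]
    simp [sq_nonneg]
  · refine ⟨fun i => x i / √q, fun s r m hr h => ?_⟩
    have hs : 0 < √q := sqrt_pos.2 h0
    have hs2 : √q ^ 2 = q := sq_sqrt hq0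
    simp_rw [mul_pow, ← Finset.mul_sum] at h
    rw [← hq, ← hs2, ← mul_pow, ← mul_pow] at h
    have habs : |s * √q| ≤ r * m := abs_le_of_sq_le_sq h (by positivity)
    have h1 := Int.floor_le (s * √q / r)
    have h2 := Int.lt_floor_add_one (s * √q / r)
    refine ⟨⌊s * √q / r⌋, ?_, ?_⟩
    · rw [Finset.mem_Icc]
      rw [abs_le] at habs
      constructor
      · rw [Int.le_floor, le_div_iff₀ hr]
        push_cast
        nlinarith [habs.1]
      · have : s * √q / r ≤ m := by
          rw [div_le_iff₀ hr]
          nlinarith [habs.2]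
        exact_mod_cast h1.trans this
    · set k := ⌊s * √q / r⌋
      have h3 : ∀ i, (s * x i - k * r * (x i / √q)) ^ 2 =
          ((s * √q / r - k) * r) ^ 2 / q * x i ^ 2 := by
        intro i
        have h4 : (s * x i - k * r * (x i / √q)) ^ 2 =
            ((s * √q / r - k) * r) ^ 2 / √q ^ 2 * x i ^ 2 := by field_simp
        rw [h4, hs2]
      simp_rw [h3, ← Finset.mul_sum]
      rw [← hq, div_mul_cancel₀ _ h0.ne', mul_pow]
      refine mul_le_of_le_one_left (sq_nonneg _) (pow_le_one₀ (by linarith) (by linarith))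

theorem sum_sparse_weight_le (b : ℕ) :
    ∑ t : ↥(Finset.Icc (-b : ℤ) b),
      exp (-(((t : ℤ) : ℝ) ^ 2 / 2 ^ 28 + if (t : ℤ) ≠ 0 then 30 else 0)) ≤ exp (1 / 8192) := by
  have h1 : ∀ t : ↥(Finset.Icc (-b : ℤ) b),
      exp (-(((t : ℤ) : ℝ) ^ 2 / 2 ^ 28 + if (t : ℤ) ≠ 0 then 30 else 0)) ≤
      (if t = ⟨0, by simp⟩ then 1 else 0) +
        exp (-30) * exp (-(0 + ((t : ℤ) : ℝ) * (1 / 2 ^ 14)) ^ 2) := by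
    intro t
    by_cases h : (t : ℤ) = 0
    · have : t = ⟨0, by simp⟩ := Subtype.ext h
      rw [if_pos this, h]
      simp
      positivity
    · rw [if_pos h, ← exp_add]
      refine le_add_of_nonneg_of_le (by split_ifs <;> norm_num) (exp_le_exp.2 ?_)
      apply le_of_eq
      ring
  refine (Finset.sum_le_sum fun t _ => h1 t).trans ?_
  rw [Finset.sum_add_distrib, ← Finset.mul_sum]
  have h2 := sum_exp_sq_le (fun t : ↥(Finset.Icc (-b : ℤ) b) => (t : ℤ)) Subtype.val_injective
    (α := 1 / 2 ^ 14) (by positivity) 0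
  have h3 : exp (-30) ≤ 1 / 2 ^ 30 := by
    rw [exp_neg, one_div]
    apply inv_anti₀ (by positivity)
    rw [show (30 : ℝ) = (30 : ℕ) * 1 by norm_num, exp_nat_mul]
    exact pow_le_pow_left₀ (by norm_num) (by linarith [exp_one_gt_d9]) _
  have h4 := add_one_le_exp (1 / 8192 : ℝ)
  have h5 := mul_le_mul h3 h2 (Finset.sum_nonneg fun _ _ => (exp_pos _).le) (by positivity)
  simp only [Finset.sum_ite_eq', Finset.mem_univ, if_true]
  norm_num at h5 h4 ⊢
  linarith

theorem card_sparse_le (b : ℕ) :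
    ((Finset.univ.filter fun y : V → ↥(Finset.Icc (-b : ℤ) b) =>
      (Finset.univ.filter fun i => (y i : ℤ) ≠ 0).card * 2 ^ 17 ≤ Fintype.card V ∧
        ∑ i, ((y i : ℤ) : ℝ) ^ 2 ≤ 65536 * Fintype.card V).card : ℝ) ≤
      exp (5 * Fintype.card V / 8192) := by
  set n := Fintype.card V with hn
  set g : ↥(Finset.Icc (-b : ℤ) b) → ℝ := fun t =>
    exp (-(((t : ℤ) : ℝ) ^ 2 / 2 ^ 28 + if (t : ℤ) ≠ 0 then 30 else 0)) with hg
  have h1 : ∑ y : V → ↥(Finset.Icc (-b : ℤ) b), ∏ i, g (y i) = (∑ t, g t) ^ n := by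
    have h := Finset.prod_univ_sum (ι := V) (fun _ => Finset.univ)
      (fun (_ : V) (t : ↥(Finset.Icc (-b : ℤ) b)) => g t)
    rw [Fintype.piFinset_univ] at h
    rw [← h, Finset.prod_const, Finset.card_univ]
  rw [Finset.card_filter]
  push_cast
  have h2 : ∀ y : V → ↥(Finset.Icc (-b : ℤ) b),
      (if (Finset.univ.filter fun i => (y i : ℤ) ≠ 0).card * 2 ^ 17 ≤ n ∧
        ∑ i, ((y i : ℤ) : ℝ) ^ 2 ≤ 65536 * n then (1 : ℝ) else 0) ≤
      exp (n / 4096 + 30 * n / 2 ^ 17) * ∏ i, g (y i) := by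
    intro y
    split_ifs with h
    · obtain ⟨ha, hb⟩ := h
      rw [hg, ← exp_sum, ← exp_add]
      apply one_le_exp
      rw [Finset.sum_neg_distrib, Finset.sum_add_distrib, ← Finset.sum_div, ← Finset.sum_filter,
        Finset.sum_const, nsmul_eq_mul]
      have ha' : ((Finset.univ.filter fun i => (y i : ℤ) ≠ 0).card : ℝ) * 2 ^ 17 ≤ n := by
        exact_mod_cast ha
      linarith
    · exact mul_nonneg (exp_pos _).le (Finset.prod_nonneg fun _ _ => (exp_pos _).le)
  refine (Finset.sum_le_sum fun y _ => h2 y).trans ?_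
  rw [← Finset.mul_sum, h1]
  have h3 : (∑ t, g t) ^ n ≤ exp (1 / 8192) ^ n :=
    pow_le_pow_left₀ (Finset.sum_nonneg fun _ _ => (exp_pos _).le) (sum_sparse_weight_le b) n
  refine (mul_le_mul_of_nonneg_left h3 (exp_pos _).le).trans ?_
  rw [← exp_nat_mul, ← exp_add]
  apply exp_le_exp.2
  have : (0 : ℝ) ≤ n := by positivity
  linarith

/-- Truncation of a compressible vector to a sparse integer vector. -/
theorem exists_sparse (v : V → ℝ) (hv : ∑ i, v i ^ 2 = Fintype.card V)
    (hS : ((Finset.univ.filter fun i => 1 / 256 ≤ |v i| ∧ |v i| ≤ 512).card : ℝ) <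
      Fintype.card V / 2 ^ 18) :
    ∃ y : V → ℤ, (Finset.univ.filter fun i => y i ≠ 0).card * 2 ^ 17 ≤ Fintype.card V ∧
      ∑ i, (y i : ℝ) ^ 2 ≤ 65536 * Fintype.card V ∧
      ∀ i, |v i - 1 / 256 * y i| ≤ 1 / 256 := by
  set n := Fintype.card V with hn
  have hB : ((Finset.univ.filter fun i => 512 < |v i|).card : ℝ) * 2 ^ 18 ≤ n := by
    rw [← hv, ← nsmul_eq_mul]
    refine (Finset.card_nsmul_le_sum _ (fun i => v i ^ 2) _ fun i hi => ?_).trans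
      (Finset.sum_le_sum_of_subset_of_nonneg (Finset.filter_subset _ _) fun _ _ _ => sq_nonneg _)
    rw [Finset.mem_filter] at hi
    rw [← sq_abs]
    nlinarith [hi.2]
  refine ⟨fun i => if 0 ≤ v i then ⌊v i * 256⌋ else ⌈v i * 256⌉, ?_, ?_, fun i => ?_⟩
  · have hsub : (Finset.univ.filter fun i =>
        (if 0 ≤ v i then ⌊v i * 256⌋ else ⌈v i * 256⌉) ≠ 0) ⊆
        (Finset.univ.filter fun i => 1 / 256 ≤ |v i| ∧ |v i| ≤ 512) ∪
          (Finset.univ.filter fun i => 512 < |v i|) := by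
      intro i hi
      simp only [Finset.mem_union, Finset.mem_filter, Finset.mem_univ, true_and] at hi ⊢
      by_contra hcon
      push Not at hcon
      have h1 : |v i| < 1 / 256 := by
        by_contra h
        push Not at h
        exact absurd (hcon.1 h) (not_lt.2 hcon.2)
      rw [abs_lt] at h1
      apply hi
      split_ifs with h
      · rw [Int.floor_eq_zero_iff]
        constructor <;> linarith [h1.2]
      · rw [Int.ceil_eq_zero_iff]
        push Not at h
        constructor <;> linarith [h1.1]
    have h1 := (Finset.card_le_card hsub).trans (Finset.card_union_le _ _)
    have h2 : ((Finset.univ.filter fun i =>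
        (if 0 ≤ v i then ⌊v i * 256⌋ else ⌈v i * 256⌉) ≠ 0).card : ℝ) ≤
        (Finset.univ.filter fun i => 1 / 256 ≤ |v i| ∧ |v i| ≤ 512).card +
          (Finset.univ.filter fun i => 512 < |v i|).card := by exact_mod_cast h1
    have h3 : ((Finset.univ.filter fun i =>
        (if 0 ≤ v i then ⌊v i * 256⌋ else ⌈v i * 256⌉) ≠ 0).card : ℝ) * 2 ^ 17 ≤ n := by
      rw [lt_div_iff₀ (by positivity)] at hS
      linarith
    exact_mod_cast h3
  · have : ∀ i, (((if 0 ≤ v i then ⌊v i * 256⌋ else ⌈v i * 256⌉ : ℤ)) : ℝ) ^ 2 ≤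
        65536 * v i ^ 2 := by
      intro i
      rw [show 65536 * v i ^ 2 = (v i * 256) ^ 2 by ring, sq_le_sq]
      split_ifs with h
      · have h1 : (0 : ℝ) ≤ (⌊v i * 256⌋ : ℤ) := by
          exact_mod_cast Int.floor_nonneg.2 (by positivity)
        rw [abs_of_nonneg h1, abs_of_nonneg (by positivity)]
        exact Int.floor_le _
      · push Not at h
        have h1 : ((⌈v i * 256⌉ : ℤ) : ℝ) ≤ 0 := by
          have : ⌈v i * 256⌉ ≤ 0 := Int.ceil_le.2 (by push_cast; linarith)
          exact_mod_cast this
        rw [abs_of_nonpos h1, abs_of_nonpos (by linarith)]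
        linarith [Int.le_ceil (v i * 256)]
    refine (Finset.sum_le_sum fun i _ => this i).trans ?_
    rw [← Finset.mul_sum, hv]
  · dsimp only
    rw [abs_le]
    split_ifs with h
    · have h1 := Int.floor_le (v i * 256)
      have h2 := Int.lt_floor_add_one (v i * 256)
      constructor <;> linarith
    · have h1 := Int.le_ceil (v i * 256)
      have h2 := Int.ceil_lt_add_one (v i * 256)
      constructor <;> linarith

/-- Compressible vectors are unlikely to be mapped into a fixed line. -/
theorem pr_compressible_le (hV : 2 ≤ Fintype.card V) (x : V → ℝ) :
    pr (fun A : Sym2 V → Bool => OpGood A ∧ ∃ v : V → ℝ, ∑ i, v i ^ 2 = Fintype.card V ∧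
      (∃ s, ∀ i, av A v i = s * x i) ∧
      ((Finset.univ.filter fun i => 1 / 256 ≤ |v i| ∧ |v i| ≤ 512).card : ℝ) <
        Fintype.card V / 2 ^ 18) ≤
      (1000 * Fintype.card V) * exp (-(Fintype.card V / 1000)) := by
  set n := Fintype.card V with hn
  have hn' : (2 : ℝ) ≤ n := by exact_mod_cast hV
  obtain ⟨e, he⟩ := exists_line_net x
  set b := 65536 * n with hb
  set Net := Finset.univ.filter fun y : V → ↥(Finset.Icc (-b : ℤ) b) =>
      (Finset.univ.filter fun i => (y i : ℤ) ≠ 0).card * 2 ^ 17 ≤ n ∧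
        ∑ i, ((y i : ℤ) : ℝ) ^ 2 ≤ 65536 * n ∧ (n : ℝ) / 4 ≤ ∑ i, (1 / 256 * ((y i : ℤ) : ℝ)) ^ 2
    with hNet
  have hcard : (Net.card : ℝ) ≤ exp (5 * n / 8192) := by
    refine le_trans ?_ (card_sparse_le (V := V) b)
    refine Nat.cast_le.2 (Finset.card_le_card fun y hy => ?_)
    simp only [hNet, Finset.mem_filter, Finset.mem_univ, true_and] at hy ⊢
    exact ⟨hy.1, hy.2.1⟩
  set m := 300 * n with hm
  have hstep : pr (fun A : Sym2 V → Bool => OpGood A ∧ ∃ v : V → ℝ, ∑ i, v i ^ 2 = n ∧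
      (∃ s, ∀ i, av A v i = s * x i) ∧
      ((Finset.univ.filter fun i => 1 / 256 ≤ |v i| ∧ |v i| ≤ 512).card : ℝ) < n / 2 ^ 18) ≤
      pr (fun A : Sym2 V → Bool => ∃ p ∈ Net ×ˢ Finset.Icc (-m : ℤ) m,
        ∑ i, (av A (fun j => 1 / 256 * ((p.1 j : ℤ) : ℝ)) i - p.2 * (n / 50) * e i) ^ 2 ≤
          (n : ℝ) ^ 2 / 480) := by
    refine pr_mono fun A => ?_
    rintro ⟨hop, v, hv, ⟨s, hs⟩, hS⟩
    obtain ⟨y, hy1, hy2, hy3⟩ := exists_sparse v hv hS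
    have hyb : ∀ i, y i ∈ Finset.Icc (-b : ℤ) b := by
      intro i
      have h1 : (y i : ℝ) ^ 2 ≤ 65536 * n :=
        (Finset.single_le_sum (f := fun i => (y i : ℝ) ^ 2) (fun _ _ => sq_nonneg _)
          (Finset.mem_univ i)).trans hy2
      have h2 : y i ^ 2 ≤ (b : ℤ) := by rw [hb]; exact_mod_cast h1
      rw [Finset.mem_Icc]
      constructor
      · nlinarith [sq_nonneg (y i + 1), sq_nonneg (y i)]
      · nlinarith [sq_nonneg (y i - 1), sq_nonneg (y i)]
    have hvn : ∀ i, |v i| ≤ √n := by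
      intro i
      apply abs_le_sqrt
      rw [← hv]
      exact Finset.single_le_sum (f := fun i => v i ^ 2) (fun _ _ => sq_nonneg _)
        (Finset.mem_univ i)
    have hop1 := hop v (√n) hvn
    rw [sq_sqrt (by positivity)] at hop1
    simp_rw [hs] at hop1
    obtain ⟨k, hk, hk2⟩ := he s (n / 50) m (by positivity) (by
      refine hop1.trans ?_
      rw [hm]
      push_cast
      rw [← hn]
      have : (32 : ℝ) * n ^ 2 * n ≤ 32 * n ^ 2 * n * n := le_mul_of_one_le_right (by positivity) (by linarith)
      nlinarith [pow_pos (show (0 : ℝ) < n by linarith) 4])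
    refine ⟨(fun i => ⟨y i, hyb i⟩, k), ?_, ?_⟩
    · rw [Finset.mem_product]
      refine ⟨?_, hk⟩
      simp only [hNet, Finset.mem_filter, Finset.mem_univ, true_and]
      refine ⟨hy1, hy2, ?_⟩
      have h1 : ∀ i, v i ^ 2 ≤ 2 * (1 / 256 * (y i : ℝ)) ^ 2 + 2 * (1 / 256) ^ 2 := by
        intro i
        have h2 : (v i - 1 / 256 * y i) ^ 2 ≤ (1 / 256) ^ 2 := sq_le_sq.2 (by
          rw [abs_of_nonneg (show (0 : ℝ) ≤ 1 / 256 by norm_num)]; exact hy3 i)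
        nlinarith [sq_nonneg (v i - 1 / 256 * y i - 1 / 256 * y i)]
      have h3 := Finset.sum_le_sum fun i (_ : i ∈ Finset.univ) => h1 i
      rw [hv, Finset.sum_add_distrib, ← Finset.mul_sum, Finset.sum_const, Finset.card_univ,
        ← hn, nsmul_eq_mul] at h3
      linarith
    · have h1 := hop (fun i => v i - 1 / 256 * y i) (1 / 256) hy3
      simp_rw [av_sub, hs] at h1
      have h2 : ∀ i, (av A (fun j => 1 / 256 * (y j : ℝ)) i - k * (n / 50) * e i) ^ 2 ≤
          2 * (s * x i - av A (fun j => 1 / 256 * (y j : ℝ)) i) ^ 2 +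
          2 * (s * x i - k * (n / 50) * e i) ^ 2 := by
        intro i
        nlinarith [sq_nonneg ((s * x i - av A (fun j => 1 / 256 * (y j : ℝ)) i) +
          (s * x i - k * (n / 50) * e i))]
      refine (Finset.sum_le_sum fun i _ => h2 i).trans ?_
      rw [Finset.sum_add_distrib, ← Finset.mul_sum, ← Finset.mul_sum]
      nlinarith [sq_nonneg (n : ℝ)]
  refine hstep.trans ?_
  refine (pr_exists_le_card _ _ (p := exp (-(n / 600))) ?_).trans ?_
  · rintro ⟨y, k⟩ hp
    rw [Finset.mem_product] at hp
    have hy := hp.1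
    simp only [hNet, Finset.mem_filter, Finset.mem_univ, true_and] at hy
    exact pr_small_le hV _ _ hy.2.2
  · rw [Finset.card_product, Int.card_Icc]
    have h1 : ((m : ℤ) + 1 - -m).toNat = 600 * n + 1 := by omega
    rw [h1]
    push_cast
    have h2 : (Net.card : ℝ) * (600 * n + 1) ≤ exp (5 * n / 8192) * (1000 * n) :=
      mul_le_mul hcard (by linarith) (by positivity) (exp_pos _).le
    refine (mul_le_mul_of_nonneg_right h2 (exp_pos _).le).trans ?_
    rw [mul_right_comm, ← exp_add, mul_comm]
    refine mul_le_mul_of_nonneg_left (exp_le_exp.2 ?_) (by positivity)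
    linarith

end SymSing

namespace SymSing

open scoped BigOperators

open Real MeasureTheory ProbabilityTheory

section Lower

variable {R D : Type} [Fintype R] [Fintype D] [DecidableEq R] [DecidableEq D]

/-- The Laplace transform of a single lazy row. -/
noncomputable def rowf (n : ℕ) (y : D → ℝ) : ℝ :=
  𝔼 h : D → Fin 8, exp (-(∑ j, lz (h j) * y j) ^ 2 / (2 * n))

theorem integral_gam_prod {μ : Type*} [Fintype μ] (G : μ → ℝ → ℝ) :
    ∫ ξ, ∏ l, G l (ξ l) ∂gam μ = ∏ l, ∫ x, G l x ∂gaussianReal 0 1 := by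
  unfold gam
  rw [integral_fintype_prod_eq_prod]

theorem rowf_eq {n : ℕ} (hn : 0 < n) (y : D → ℝ) :
    rowf n y = ∫ x, ∏ j, phi (x * ((√n)⁻¹ * y j)) ∂gaussianReal 0 1 := by
  have hn' : (0 : ℝ) < n := by exact_mod_cast hn
  have hs2 : ((√n)⁻¹ : ℝ) ^ 2 = 1 / n := by rw [inv_pow, sq_sqrt hn'.le, one_div]
  have h1 := expect_exp_eq (ι := D) (μ := Unit) (fun _ j => (√n)⁻¹ * y j)
  have h2 := integral_gam_prod (μ := Unit) fun _ x => ∏ j, phi (x * ((√n)⁻¹ * y j))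
  simp only [Finset.univ_unique, Finset.sum_singleton, Finset.prod_singleton] at h1 h2
  rw [← h2, ← h1]
  refine Finset.expect_congr rfl fun h _ => ?_
  congr 1
  have : ∑ j, lz (h j) * ((√n)⁻¹ * y j) = (√n)⁻¹ * ∑ j, lz (h j) * y j := by
    rw [Finset.mul_sum]
    exact Finset.sum_congr rfl fun j _ => by ring
  rw [this, mul_pow, hs2]
  field_simp

theorem rowf_nonneg (n : ℕ) (y : D → ℝ) : 0 ≤ rowf n y := expect_nonneg' fun _ => (exp_pos _).le

theorem integrable_prod_phi (y : D → ℝ) (m : ℕ) :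
    Integrable (fun x : ℝ => (∏ j, phi (x * y j)) ^ m) (gaussianReal 0 1) := by
  refine Integrable.of_bound (C := 1) (Continuous.aestronglyMeasurable ?_)
    (Filter.Eventually.of_forall fun x => ?_)
  · exact (continuous_finsetProd _ fun i _ => continuous_phi.comp (by fun_prop)).pow m
  · rw [norm_eq_abs, abs_pow]
    exact pow_le_one₀ (abs_nonneg _) (abs_prod_phi_le_one _ _)

theorem rowf_cube_le {n : ℕ} (hn : 0 < n) (y : D → ℝ) :
    rowf n y ^ 3 ≤ ∫ x, (∏ j, phi (x * ((√n)⁻¹ * y j))) ^ 3 ∂gaussianReal 0 1 := by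
  rw [rowf_eq hn]
  have hc : ConvexOn ℝ (Set.Ici 0) fun x : ℝ => x ^ 3 := convexOn_pow 3
  have h1 := integrable_prod_phi (fun j => (√n)⁻¹ * y j) 1
  simp only [pow_one] at h1
  exact hc.map_integral_le (continuous_pow 3).continuousOn isClosed_Ici
    (Filter.Eventually.of_forall fun x => Finset.prod_nonneg fun _ _ => (phi_pos _).le)
    h1 (integrable_prod_phi _ 3)

theorem inv_le_integral_prod_phi {n : ℕ} (hn : 0 < n) (x : R → ℝ) {N : ℝ} (hN : 1 ≤ N)
    (hx : ∑ i, x i ^ 2 ≤ N ^ 2 * n) :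
    1 / (3 * N) ≤ ∫ t, (∏ i, phi (t * ((√n)⁻¹ * x i))) ^ 3 ∂gaussianReal 0 1 := by
  have hn' : (0 : ℝ) < n := by exact_mod_cast hn
  have hs2 : ((√n)⁻¹ : ℝ) ^ 2 = 1 / n := by rw [inv_pow, sq_sqrt hn'.le, one_div]
  have hc : -(3 * N ^ 2) < 1 / 2 := by nlinarith
  have h1 : ∫ t, exp (-(3 * N ^ 2) * t ^ 2) ∂gaussianReal 0 1 ≤
      ∫ t, (∏ i, phi (t * ((√n)⁻¹ * x i))) ^ 3 ∂gaussianReal 0 1 := by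
    refine integral_mono ?_ (integrable_prod_phi _ 3) fun t => ?_
    · refine Integrable.of_bound (C := 1) (Continuous.aestronglyMeasurable (by fun_prop))
        (Filter.Eventually.of_forall fun t => ?_)
      rw [norm_eq_abs, abs_of_pos (exp_pos _), exp_le_one_iff]
      nlinarith [mul_nonneg (sq_nonneg N) (sq_nonneg t)]
    · have h2 : exp (-(N ^ 2) * t ^ 2) ≤ ∏ i, phi (t * ((√n)⁻¹ * x i)) := by
        refine le_trans ?_ (Finset.prod_le_prod (fun _ _ => (exp_pos _).le)
          fun i _ => exp_neg_sq_le_phi (t * ((√n)⁻¹ * x i)))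
        rw [← exp_sum, Finset.sum_neg_distrib]
        apply exp_le_exp.2
        simp_rw [mul_pow, ← Finset.mul_sum, hs2]
        have : t ^ 2 * (1 / n * ∑ i, x i ^ 2) ≤ t ^ 2 * (1 / n * (N ^ 2 * n)) := by gcongr
        have h3 : t ^ 2 * (1 / n * (N ^ 2 * n)) = t ^ 2 * N ^ 2 := by field_simp
        linarith
      have h3 := pow_le_pow_left₀ (exp_pos _).le h2 3
      rw [← exp_nat_mul] at h3
      convert h3 using 2
      push_cast; ring
  rw [integral_exp_sq_one hc] at h1
  refine le_trans ?_ h1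
  rw [one_div]
  apply inv_anti₀ (sqrt_pos.2 (by nlinarith))
  rw [sqrt_le_left (by linarith)]
  nlinarith

theorem le_blockf {n : ℕ} (hn : 0 < n) (x : R → ℝ) (y : D → ℝ) {N : ℝ} (hN : 1 ≤ N)
    (hx : ∑ i, x i ^ 2 ≤ N ^ 2 * n) :
    (rowf n y ^ 3) ^ Fintype.card R * (1 / (3 * N)) ^ Fintype.card D ≤ blockf n x y := by
  have hn' : (0 : ℝ) < n := by exact_mod_cast hn
  set s : ℝ := (√n)⁻¹ with hs
  have hs2 : s ^ 2 = 1 / n := by rw [hs, inv_pow, sq_sqrt hn'.le, one_div]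
  let M : R ⊕ D → R × D → ℝ := fun l p =>
    Sum.elim (fun i => if i = p.1 then s * y p.2 else 0)
      (fun j => if j = p.2 then s * x p.1 else 0) l
  let G : R ⊕ D → ℝ → ℝ := fun l t =>
    Sum.elim (fun _ => (∏ j, phi (t * (s * y j))) ^ 3) (fun _ => (∏ i, phi (t * (s * x i))) ^ 3) l
  have h1 : blockf n x y = 𝔼 h : R × D → Fin 8, exp (-(∑ l, (∑ p, lz (h p) * M l p) ^ 2) / 2) := by
    unfold blockf
    rw [← expect_equiv (Equiv.curry _ _ _)]
    refine Finset.expect_congr rfl fun h _ => ?_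
    congr 1
    unfold blockq
    rw [Fintype.sum_sum_type]
    have hR : ∀ i, ∑ p, lz (h p) * M (.inl i) p = s * ∑ j, lz (Equiv.curry _ _ _ h i j) * y j := by
      intro i
      rw [Fintype.sum_prod_type, Finset.sum_eq_single i, Finset.mul_sum]
      · refine Finset.sum_congr rfl fun j _ => ?_
        simp [M]; ring
      · intro k _ hk
        simp [M, hk.symm]
      · simp
    have hD : ∀ j, ∑ p, lz (h p) * M (.inr j) p = s * ∑ i, x i * lz (Equiv.curry _ _ _ h i j) := by
      intro j
      rw [Fintype.sum_prod_type_right, Finset.sum_eq_single j, Finset.mul_sum]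
      · refine Finset.sum_congr rfl fun i _ => ?_
        simp [M]; ring
      · intro k _ hk
        simp [M, hk.symm]
      · simp
    simp_rw [hR, hD, mul_pow, ← Finset.mul_sum, hs2]
    field_simp
    try ring
  rw [h1, expect_exp_eq]
  have h2 : ∫ ξ, ∏ l, G l (ξ l) ∂gam (R ⊕ D) ≤
      ∫ ξ, ∏ p, phi (∑ l, ξ l * M l p) ∂gam (R ⊕ D) := by
    have hprod : ∀ ξ : R ⊕ D → ℝ, ∏ l, G l (ξ l) =
        ∏ p : R × D, phi (ξ (.inl p.1) * (s * y p.2)) ^ 3 * phi (ξ (.inr p.2) * (s * x p.1)) ^ 3 := by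
      intro ξ
      rw [Fintype.prod_sum_type, Finset.prod_mul_distrib, Fintype.prod_prod_type,
        Fintype.prod_prod_type_right]
      simp only [G, Sum.elim_inl, Sum.elim_inr, Finset.prod_pow]
    simp_rw [hprod]
    refine integral_mono ?_ ?_ fun ξ => ?_
    · refine integrable_gam_of_bound ?_ 1 fun ξ => ?_
      · exact continuous_finsetProd _ fun p _ => ((continuous_phi.comp (by fun_prop)).pow 3).mul
          ((continuous_phi.comp (by fun_prop)).pow 3)
      · have h0 : ∀ p : R × D, 0 ≤ phi (ξ (.inl p.1) * (s * y p.2)) ^ 3 *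
            phi (ξ (.inr p.2) * (s * x p.1)) ^ 3 := fun p =>
          mul_nonneg (pow_nonneg (phi_pos _).le _) (pow_nonneg (phi_pos _).le _)
        rw [abs_of_nonneg (Finset.prod_nonneg fun p _ => h0 p)]
        exact Finset.prod_le_one (fun p _ => h0 p) fun p _ =>
          mul_le_one₀ (pow_le_one₀ (phi_pos _).le (phi_le_one _))
            (pow_nonneg (phi_pos _).le _) (pow_le_one₀ (phi_pos _).le (phi_le_one _))
    · exact integrable_gam_of_bound
        (continuous_finsetProd _ fun i _ => continuous_phi.comp (by fun_prop)) 1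
        fun x => abs_prod_phi_le_one _ _
    · refine Finset.prod_le_prod (fun p _ =>
        mul_nonneg (pow_nonneg (phi_pos _).le _) (pow_nonneg (phi_pos _).le _)) fun p _ => ?_
      refine (phi_cube_mul_le _ _).trans (le_of_eq ?_)
      congr 1
      rw [Fintype.sum_sum_type]
      simp [M]
  refine le_trans ?_ h2
  rw [integral_gam_prod, Fintype.prod_sum_type]
  simp only [G, Sum.elim_inl, Sum.elim_inr, Finset.prod_const, Finset.card_univ]
  have hr := rowf_cube_le hn y
  have hx' := inv_le_integral_prod_phi hn x hN hx
  exact mul_le_mul (pow_le_pow_left₀ (pow_nonneg (rowf_nonneg _ _) _) hr _)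
    (pow_le_pow_left₀ (by positivity) hx' _) (by positivity)
    (pow_nonneg ((pow_nonneg (rowf_nonneg _ _) _).trans hr) _)

end Lower

section Concentration

variable {V : Type} [Fintype V] [DecidableEq V]

theorem pr_sum_eq_le_rowf {I D : Finset V} (hDI : D ⊆ I) {n : ℕ} (v : V → ℝ) (a N : ℝ) :
    pr (fun ε : V → Bool => ∑ i ∈ I, sg (ε i) * v i = a) ≤
      rowf n fun j : {j // j ∈ D} => N * v j := by
  have h1 := expect_exp_sg_le_lz (ι := {j // j ∈ D}) (E := V) (μ := Unit)
    (fun _ e => if e ∈ I then (√n)⁻¹ * (N * v e) else 0) (fun _ => -((√n)⁻¹ * (N * a)))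
    (fun j => (j : V)) Subtype.val_injective
  have hs2 : ((√n)⁻¹ : ℝ) ^ 2 = 1 / n := by
    rw [inv_pow, sq_sqrt (Nat.cast_nonneg n), one_div]
  simp only [Finset.univ_unique, Finset.sum_singleton] at h1
  refine le_trans (pr_le_expect (fun ε => (exp_pos _).le) fun ε hε => ?_)
    (h1.trans (le_of_eq ?_))
  · have : ∑ e, sg (ε e) * (if e ∈ I then (√n)⁻¹ * (N * v e) else 0) = (√n)⁻¹ * (N * a) := by
      rw [← hε, Finset.mul_sum, Finset.mul_sum, ← Finset.sum_subset (Finset.subset_univ I)]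
      · refine Finset.sum_congr rfl fun i hi => ?_
        rw [if_pos hi]; ring
      · intro i _ hi
        simp [hi]
    rw [this]
    simp
  · unfold rowf
    refine Finset.expect_congr rfl fun h _ => ?_
    congr 1
    have : ∑ j : {j // j ∈ D}, lz (h j) * (if (j : V) ∈ I then (√n)⁻¹ * (N * v j) else 0) =
        (√n)⁻¹ * ∑ j : {j // j ∈ D}, lz (h j) * (N * v j) := by
      rw [Finset.mul_sum]
      refine Finset.sum_congr rfl fun j _ => ?_
      rw [if_pos (hDI j.2)]; ring
    rw [this, mul_pow, hs2, neg_div, neg_div, one_div, div_eq_mul_inv, div_eq_mul_inv, mul_inv]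
    ring

end Concentration

section Rounding

variable {K W : Type*} [Fintype K] [Fintype W] [DecidableEq W]

theorem convex_sq_defect {θ p q t : ℝ} (hpq : |p - q| ≤ 2)
    (ht : t = θ * p + (1 - θ) * q) : θ * p ^ 2 + (1 - θ) * q ^ 2 ≤ t ^ 2 + 1 := by
  rw [ht]
  have h1 : (p - q) ^ 2 ≤ 4 := by
    rw [← sq_abs]; nlinarith [abs_nonneg (p - q)]
  have h2 : θ * (1 - θ) ≤ 1 / 4 := by nlinarith [sq_nonneg (θ - 1 / 2)]
  have h3 : θ * (1 - θ) * (p - q) ^ 2 ≤ 1 / 4 * 4 :=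
    mul_le_mul h2 h1 (sq_nonneg _) (by norm_num)
  nlinarith

theorem exists_round_one (c : K → W → W → ℝ) (hc : ∀ h l k, |c h l k| ≤ 2) (w : W → ℝ) (i : W) :
    ∃ z : ℤ, |z - w i| ≤ 1 ∧
      exp (-1) * 𝔼 h, exp (-(∑ l, (∑ k, c h l k * w k) ^ 2) / (2 * Fintype.card W)) ≤
      𝔼 h, exp (-(∑ l, (∑ k, c h l k * Function.update w i z k) ^ 2) / (2 * Fintype.card W)) := by
  have : Nonempty W := ⟨i⟩
  set n := Fintype.card W with hn
  have hn' : (0 : ℝ) < n := by exact_mod_cast Fintype.card_pos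
  set F : ℝ → ℝ := fun t =>
    𝔼 h, exp (-(∑ l, (∑ k, c h l k * Function.update w i t k) ^ 2) / (2 * n)) with hF
  set θ : ℝ := 1 - Int.fract (w i) with hθ
  have hθ0 : 0 ≤ θ := by rw [hθ]; linarith [Int.fract_lt_one (w i)]
  have hθ1 : θ ≤ 1 := by rw [hθ]; linarith [Int.fract_nonneg (w i)]
  have hw : w i = θ * (⌊w i⌋ : ℤ) + (1 - θ) * ((⌊w i⌋ + 1 : ℤ) : ℝ) := by
    rw [hθ]; push_cast; linarith [Int.floor_add_fract (w i)]
  have hlin : ∀ h l t, ∑ k, c h l k * Function.update w i t k =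
      ∑ k, c h l k * w k + c h l i * (t - w i) := by
    intro h l t
    have : ∀ k, c h l k * Function.update w i t k =
        c h l k * w k + if k = i then c h l i * (t - w i) else 0 := by
      intro k
      by_cases hk : k = i
      · subst hk; simp; ring
      · simp [hk]
    simp_rw [this, Finset.sum_add_distrib]
    simp
  have key : exp (-1) * 𝔼 h, exp (-(∑ l, (∑ k, c h l k * w k) ^ 2) / (2 * n)) ≤
      θ * F (⌊w i⌋ : ℤ) + (1 - θ) * F ((⌊w i⌋ + 1 : ℤ) : ℝ) := by
    rw [hF]
    simp only
    rw [Finset.mul_expect, Finset.mul_expect, Finset.mul_expect, ← Finset.expect_add_distrib]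
    refine expect_mono fun h => ?_
    rw [← exp_add]
    have hcv := convexOn_exp.2 (Set.mem_univ
      (-(∑ l, (∑ k, c h l k * Function.update w i ((⌊w i⌋ : ℤ) : ℝ) k) ^ 2) / (2 * n)))
      (Set.mem_univ (-(∑ l, (∑ k, c h l k *
        Function.update w i ((⌊w i⌋ + 1 : ℤ) : ℝ) k) ^ 2) / (2 * n)))
      hθ0 (sub_nonneg.2 hθ1) (by ring)
    simp only [smul_eq_mul] at hcv
    refine le_trans (exp_le_exp.2 ?_) hcv
    have h1 : ∀ l, θ * (∑ k, c h l k * Function.update w i ((⌊w i⌋ : ℤ) : ℝ) k) ^ 2 +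
        (1 - θ) * (∑ k, c h l k * Function.update w i ((⌊w i⌋ + 1 : ℤ) : ℝ) k) ^ 2 ≤
        (∑ k, c h l k * w k) ^ 2 + 1 := by
      intro l
      refine convex_sq_defect ?_ ?_
      · rw [hlin, hlin]
        push_cast
        ring_nf
        rw [abs_neg]
        exact hc h l i
      · rw [hlin, hlin]
        linear_combination c h l i * hw
    have h2 := Finset.sum_le_sum fun l (_ : l ∈ Finset.univ) => h1 l
    rw [Finset.sum_add_distrib, Finset.sum_add_distrib, ← Finset.mul_sum, ← Finset.mul_sum,
      Finset.sum_const, Finset.card_univ, ← hn, nsmul_eq_mul, mul_one] at h2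
    rw [← mul_div_assoc, ← mul_div_assoc, ← add_div, show (-1 : ℝ) = -(2 * n) / (2 * n) by
      field_simp, ← add_div]
    refine div_le_div_of_nonneg_right ?_ (by positivity)
    linarith
  by_cases h : exp (-1) * 𝔼 h, exp (-(∑ l, (∑ k, c h l k * w k) ^ 2) / (2 * n)) ≤
      F (⌊w i⌋ : ℤ)
  · refine ⟨⌊w i⌋, ?_, h⟩
    rw [abs_le]
    constructor <;> linarith [Int.floor_le (w i), Int.lt_floor_add_one (w i)]
  · refine ⟨⌊w i⌋ + 1, ?_, ?_⟩
    · rw [abs_le]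
      push_cast
      constructor <;> linarith [Int.floor_le (w i), Int.lt_floor_add_one (w i)]
    · by_contra h'
      push Not at h h'
      have h'' : F ((⌊w i⌋ + 1 : ℤ) : ℝ) <
          exp (-1) * 𝔼 h, exp (-(∑ l, (∑ k, c h l k * w k) ^ 2) / (2 * n)) := h'
      set E := exp (-1) * 𝔼 h, exp (-(∑ l, (∑ k, c h l k * w k) ^ 2) / (2 * n))
      rcases hθ0.eq_or_lt with h0 | h0
      · rw [← h0] at key
        linarith
      · nlinarith [mul_lt_mul_of_pos_left h h0, mul_le_mul_of_nonneg_left h''.le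
          (sub_nonneg.2 hθ1)]

theorem exists_round (c : K → W → W → ℝ) (hc : ∀ h l k, |c h l k| ≤ 2) (w : W → ℝ) :
    ∃ X : W → ℤ, (∀ i, |X i - w i| ≤ 1) ∧ exp (-Fintype.card W) *
        𝔼 h, exp (-(∑ l, (∑ k, c h l k * w k) ^ 2) / (2 * Fintype.card W)) ≤
      𝔼 h, exp (-(∑ l, (∑ k, c h l k * X k) ^ 2) / (2 * Fintype.card W)) := by
  have key : ∀ s : Finset W, ∃ X : W → ℝ, (∀ i ∈ s, ∃ z : ℤ, X i = z ∧ |z - w i| ≤ 1) ∧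
      (∀ i ∉ s, X i = w i) ∧ exp (-s.card) *
        𝔼 h, exp (-(∑ l, (∑ k, c h l k * w k) ^ 2) / (2 * Fintype.card W)) ≤
      𝔼 h, exp (-(∑ l, (∑ k, c h l k * X k) ^ 2) / (2 * Fintype.card W)) := by
    intro s
    induction s using Finset.induction_on with
    | empty => exact ⟨w, by simp, by simp, by simp⟩
    | insert i s hi ih =>
      obtain ⟨X, h1, h2, h3⟩ := ih
      obtain ⟨z, hz, hz2⟩ := exists_round_one c hc X i
      refine ⟨Function.update X i z, ?_, ?_, ?_⟩
      · intro k hk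
        by_cases hki : k = i
        · subst hki
          refine ⟨z, by simp, ?_⟩
          rwa [← h2 k hi]
        · rw [Function.update_of_ne hki]
          exact h1 k ((Finset.mem_insert.1 hk).resolve_left hki)
      · intro k hk
        rw [Finset.mem_insert, not_or] at hk
        rw [Function.update_of_ne hk.1]
        exact h2 k hk.2
      · refine le_trans ?_ hz2
        refine le_trans (le_of_eq ?_) (mul_le_mul_of_nonneg_left h3 (exp_pos (-1)).le)
        rw [← mul_assoc, ← exp_add, Finset.card_insert_of_notMem hi]
        congr 2
        push_cast; ring
  obtain ⟨X, h1, -, h3⟩ := key Finset.univ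
  choose z hz1 hz2 using fun i => h1 i (Finset.mem_univ i)
  refine ⟨z, hz2, ?_⟩
  rw [Finset.card_univ] at h3
  simp_rw [hz1] at h3
  exact h3

end Rounding

section BlockRounding

variable {R D : Type} [Fintype R] [Fintype D] [DecidableEq R] [DecidableEq D]

theorem exists_blockf_round {n : ℕ} (hn : Fintype.card R + Fintype.card D = n)
    (x : R → ℝ) (y : D → ℝ) : ∃ (X : R → ℤ) (Y : D → ℤ), (∀ i, |X i - x i| ≤ 1) ∧
      (∀ j, |Y j - y j| ≤ 1) ∧
      exp (-n) * blockf n x y ≤ blockf n (fun i => (X i : ℝ)) (fun j => (Y j : ℝ)) := by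
  let c : (R → D → Fin 8) → R ⊕ D → R ⊕ D → ℝ := fun h l k =>
    Sum.elim (fun i => Sum.elim (fun _ => 0) (fun j => lz (h i j)) k)
      (fun j => Sum.elim (fun i => lz (h i j)) (fun _ => 0) k) l
  have hc : ∀ h l k, |c h l k| ≤ 2 := by
    rintro h (i | j) (i' | j') <;> simp [c, abs_lz_le]
  have hq : ∀ (x : R → ℝ) (y : D → ℝ), blockf n x y =
      𝔼 h, exp (-(∑ l, (∑ k, c h l k * Sum.elim x y k) ^ 2) / (2 * Fintype.card (R ⊕ D))) := by
    intro x y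
    unfold blockf blockq
    rw [Fintype.card_sum, hn]
    refine Finset.expect_congr rfl fun h _ => ?_
    simp only [Fintype.sum_sum_type, c, Sum.elim_inl, Sum.elim_inr, zero_mul,
      Finset.sum_const_zero, zero_add, add_zero, mul_comm (x _)]
  obtain ⟨X, hX1, hX2⟩ := exists_round c hc (Sum.elim x y)
  refine ⟨fun i => X (.inl i), fun j => X (.inr j), fun i => hX1 (.inl i),
    fun j => hX1 (.inr j), ?_⟩
  rw [hq, hq]
  rw [Fintype.card_sum, hn] at hX2 ⊢
  have hs : (Sum.elim (fun i => ((X (.inl i) : ℤ) : ℝ)) fun j => ((X (.inr j) : ℤ) : ℝ)) =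
      fun k => (X k : ℝ) := by
    funext k
    rcases k <;> rfl
  rw [hs]
  exact hX2

end BlockRounding

end SymSing

namespace SymSing

open scoped BigOperators

open Real

open Classical in
/-- The integer points at scale `N` at which the block function is large. -/
noncomputable def blockNet (R D : Type) [Fintype R] [Fintype D] [DecidableEq R] [DecidableEq D]
    (n N b : ℕ) (L : ℝ) :
    Finset ((R → ↥(Finset.Icc (-b : ℤ) b)) ×
      (D → ↥(Finset.Icc (-(2 * 512 * N : ℕ) : ℤ) (2 * 512 * N : ℕ)))) :=
  Finset.univ.filter fun p =>
    (∀ j, 1 / 256 * N / 2 ≤ |((p.2 j : ℤ) : ℝ)|) ∧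
      ∑ i, ((p.1 i : ℤ) : ℝ) ^ 2 ≤ 4 * (N : ℝ) ^ 2 * n ∧
      exp (-n) * (L / N) ^ n ≤
        blockf n (fun i => ((p.1 i : ℤ) : ℝ)) (fun j => ((p.2 j : ℤ) : ℝ))

theorem card_blockNet_le : ∃ K > 0, ∀ L : ℝ, 1 ≤ L → ∃ c > 0, ∃ n₀ : ℕ, ∀ n ≥ n₀,
    ∀ (R D : Type) [Fintype R] [Fintype D] [DecidableEq R] [DecidableEq D],
    Fintype.card R + Fintype.card D = n → 4 * Fintype.card D ≤ n →
    1 / 2 ^ 21 * (n : ℝ) ≤ Fintype.card D → ∀ N : ℕ, 1 ≤ N → (N : ℝ) ≤ exp (c * n) → ∀ b : ℕ,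
    ((blockNet R D n N b L).card : ℝ) ≤ (K * N / L ^ 2) ^ n := by
  obtain ⟨K, hK, h⟩ := card_net_le (κ₀ := 1 / 256) (δ := 1 / 2 ^ 21) (by norm_num) (by norm_num)
    (κ₁ := 512) (by norm_num)
  refine ⟨K, hK, fun L hL => ?_⟩
  obtain ⟨c, hc, n₀, h⟩ := h L hL
  refine ⟨c, hc, n₀, fun n hn R D _ _ _ _ h1 h2 h3 N hN hN' b => ?_⟩
  have := h n hn R D h1 h2 h3 N hN hN' b
  unfold blockNet
  convert this using 3

section

variable {V : Type} [Fintype V] [DecidableEq V]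

/-- The event that some unit-scale vector mapped to the line of `x` has threshold about `L / N`. -/
def BlockEvent (D : Finset V) (N : ℕ) (L : ℝ) (x : V → ℝ) (A : Sym2 V → Bool) : Prop :=
  OpGood A ∧ ∃ v : V → ℝ, ∑ i, v i ^ 2 = Fintype.card V ∧ (∃ s, ∀ i, av A v i = s * x i) ∧
    (∀ j ∈ D, 1 / 256 ≤ |v j| ∧ |v j| ≤ 512) ∧
    (L / N) ^ Fintype.card V ≤ blockf (Fintype.card V) (fun i : {i // i ∉ D} => N * v i)
      (fun j : {j // j ∈ D} => N * v j) ∧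
    blockf (Fintype.card V) (fun i : {i // i ∉ D} => 1 / 2 * (N * v i))
      (fun j : {j // j ∈ D} => 1 / 2 * (N * v j)) ≤ (2 * L / N) ^ Fintype.card V

theorem pr_blockEvent_step (hV : 2 ≤ Fintype.card V) (D : Finset V) (N : ℕ) {p : ℝ} (X v e : V → ℝ)
    (hX : ∀ i, |X i - N * v i| ≤ 1)
    (hv : blockf (Fintype.card V) (fun i : {i // i ∉ D} => 1 / 2 * (N * v i))
      (fun j : {j // j ∈ D} => 1 / 2 * (N * v j)) ≤ p) :
    pr (fun A : Sym2 V → Bool => OpGood A ∧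
      ∑ i, (av A X i - e i) ^ 2 ≤ 66 * (Fintype.card V : ℝ) ^ 2) ≤
      exp (25 * Fintype.card V) * p := by
  set n := Fintype.card V with hn
  have hn' : (2 : ℝ) ≤ n := by exact_mod_cast hV
  have hp : 0 ≤ p := (blockf_nonneg _ _ _).trans hv
  refine (pr_mono (Q := fun A : Sym2 V → Bool =>
    ∑ i, (av A (fun i => N * v i) i - e i) ^ 2 ≤ 196 * (n : ℝ) ^ 2) ?_).trans
    ((pr_ball_le_blockf D (n := n) (by omega) (fun i => N * v i) e (1 / 2)).trans ?_)
  · rintro A ⟨hop, hA⟩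
    have h1 := hop (fun i => X i - N * v i) 1 hX
    simp_rw [av_sub] at h1
    have h2 : ∀ i, (av A (fun i => N * v i) i - e i) ^ 2 ≤
        2 * (av A X i - av A (fun i => N * v i) i) ^ 2 + 2 * (av A X i - e i) ^ 2 := by
      intro i
      nlinarith [sq_nonneg ((av A X i - av A (fun i => N * v i) i) + (av A X i - e i))]
    refine (Finset.sum_le_sum fun i _ => h2 i).trans ?_
    rw [Finset.sum_add_distrib, ← Finset.mul_sum, ← Finset.mul_sum]
    linarith
  · refine mul_le_mul (exp_le_exp.2 ?_) hv (blockf_nonneg _ _ _) (exp_pos _).le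
    have : (1 / 2 : ℝ) ^ 2 * (196 * (n : ℝ) ^ 2) / (2 * n) = 49 / 2 * n := by
      field_simp; norm_num
    rw [this]
    linarith

theorem exists_glue_round (D : Finset V) {n : ℕ} (hn : Fintype.card V = n) (v : V → ℝ) :
    ∃ X : V → ℤ, (∀ i, |X i - v i| ≤ 1) ∧
      exp (-n) * blockf n (fun i : {i // i ∉ D} => v i) (fun j : {j // j ∈ D} => v j) ≤
        blockf n (fun i : {i // i ∉ D} => (X i : ℝ)) (fun j : {j // j ∈ D} => (X j : ℝ)) := by
  have hcard : Fintype.card {i // i ∉ D} + Fintype.card {j // j ∈ D} = n := by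
    rw [Fintype.card_subtype_compl, Fintype.card_coe]
    have := D.card_le_univ
    omega
  obtain ⟨X, Y, hX, hY, hXY⟩ := exists_blockf_round hcard (fun i : {i // i ∉ D} => v i)
    (fun j : {j // j ∈ D} => v j)
  refine ⟨fun i => if h : i ∈ D then Y ⟨i, h⟩ else X ⟨i, h⟩, fun i => ?_, ?_⟩
  · beta_reduce
    split_ifs with h
    · exact hY ⟨i, h⟩
    · exact hX ⟨i, h⟩
  · refine hXY.trans_eq ?_
    congr 1
    · funext i
      simp [i.2]
    · funext j
      simp

theorem abs_le_sqrt_of_sum_sq_eq {n : ℕ} {v : V → ℝ} (hv : ∑ i, v i ^ 2 = n) (i : V) :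
    |v i| ≤ √n := by
  apply abs_le_sqrt
  rw [← hv]
  exact Finset.single_le_sum (f := fun i => v i ^ 2) (fun _ _ => sq_nonneg _) (Finset.mem_univ i)

theorem OpGood.exists_line_point {A : Sym2 V → Bool} (hop : OpGood A) {n : ℕ}
    (hn : Fintype.card V = n) (hn2 : 2 ≤ n) {N : ℕ} (hN : 1 ≤ N) {x e v : V → ℝ} {s : ℝ}
    (he : ∀ (s r : ℝ) (m : ℕ), 0 < r → ∑ i, (s * x i) ^ 2 ≤ (r * m) ^ 2 →
      ∃ k ∈ Finset.Icc (-m : ℤ) m, ∑ i, (s * x i - k * r * e i) ^ 2 ≤ r ^ 2)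
    (hv : ∑ i, v i ^ 2 = n) (hs : ∀ i, av A v i = s * x i) :
    ∃ k ∈ Finset.Icc (-(6 * N * n : ℕ) : ℤ) (6 * N * n : ℕ),
      ∑ i, (N * s * x i - k * n * e i) ^ 2 ≤ (n : ℝ) ^ 2 := by
  have hn' : (2 : ℝ) ≤ n := by exact_mod_cast hn2
  have hop1 := hop v (√n) (abs_le_sqrt_of_sum_sq_eq hv)
  rw [sq_sqrt (by positivity), hn] at hop1
  simp_rw [hs, mul_pow, ← Finset.mul_sum] at hop1
  refine he (N * s) n (6 * N * n) (by positivity) ?_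
  simp_rw [mul_assoc, mul_pow, ← Finset.mul_sum]
  push_cast
  have h1 : (N : ℝ) ^ 2 * (s ^ 2 * ∑ i, x i ^ 2) ≤ N ^ 2 * (32 * n ^ 2 * n) :=
    mul_le_mul_of_nonneg_left hop1 (by positivity)
  have h2 : (N : ℝ) ^ 2 * (32 * n ^ 2 * n) ≤ (N ^ 2 * (n ^ 2 * n)) * (36 * n) := by
    have : (0 : ℝ) ≤ N ^ 2 * (n ^ 2 * n) := by positivity
    nlinarith
  nlinarith

theorem sum_sq_round_le {n : ℕ} (hn : Fintype.card V = n) (D : Finset V) {N : ℕ} (hN : 1 ≤ N)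
    {v : V → ℝ} {X : V → ℤ} (hv : ∑ i, v i ^ 2 = n) (hX : ∀ i, |X i - N * v i| ≤ 1) :
    ∑ i : {i // i ∉ D}, (X i : ℝ) ^ 2 ≤ 4 * (N : ℝ) ^ 2 * n := by
  have hN' : (1 : ℝ) ≤ N := by exact_mod_cast hN
  have h1 : ∀ i, (X i : ℝ) ^ 2 ≤ 2 * N ^ 2 * v i ^ 2 + 2 := by
    intro i
    have h2 : ((X i : ℝ) - N * v i) ^ 2 ≤ 1 := by
      rw [← sq_abs]
      exact pow_le_one₀ (abs_nonneg _) (hX i)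
    nlinarith [sq_nonneg ((X i : ℝ) - N * v i - N * v i)]
  have h3 : ∑ i : {i // i ∉ D}, (X i : ℝ) ^ 2 ≤ ∑ i, (X i : ℝ) ^ 2 := by
    rw [← sum_mem_add_sum_notMem D (fun i => (X i : ℝ) ^ 2)]
    exact le_add_of_nonneg_left (Finset.sum_nonneg fun _ _ => sq_nonneg _)
  refine h3.trans ((Finset.sum_le_sum fun i _ => h1 i).trans ?_)
  rw [Finset.sum_add_distrib, ← Finset.mul_sum, Finset.sum_const, Finset.card_univ,
    nsmul_eq_mul, hn, hv]
  have h5 : (1 : ℝ) ≤ N ^ 2 := one_le_pow₀ hN'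
  have h6 : (n : ℝ) ≤ N ^ 2 * n := le_mul_of_one_le_left (by positivity) h5
  linarith

theorem OpGood.sum_sq_round_sub_le {A : Sym2 V → Bool} (hop : OpGood A) {n : ℕ}
    (hn : Fintype.card V = n) {N k s : ℝ} {x e v X : V → ℝ} (hX : ∀ i, |X i - N * v i| ≤ 1)
    (hs : ∀ i, av A v i = s * x i) (h : ∑ i, (N * s * x i - k * n * e i) ^ 2 ≤ (n : ℝ) ^ 2) :
    ∑ i, (av A X i - k * n * e i) ^ 2 ≤ 66 * (n : ℝ) ^ 2 := by
  have h1 := hop (fun i => X i - N * v i) 1 hX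
  rw [hn] at h1
  simp_rw [av_sub, av_smul, hs] at h1
  have h2 : ∀ i, (av A X i - k * n * e i) ^ 2 ≤
      2 * (av A X i - N * (s * x i)) ^ 2 + 2 * (N * s * x i - k * n * e i) ^ 2 := by
    intro i
    nlinarith [sq_nonneg ((av A X i - N * (s * x i)) - (N * s * x i - k * n * e i))]
  refine (Finset.sum_le_sum fun i _ => h2 i).trans ?_
  rw [Finset.sum_add_distrib, ← Finset.mul_sum, ← Finset.mul_sum]
  linarith

theorem mem_Icc_of_abs_sub_le {z : ℤ} {y c : ℝ} {b : ℕ} (h : |z - y| ≤ 1) (hy : |y| ≤ c)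
    (hb : c + 1 ≤ b) : z ∈ Finset.Icc (-b : ℤ) b := by
  rw [abs_le] at h hy
  rw [Finset.mem_Icc]
  constructor
  · have : ((-b : ℤ) : ℝ) ≤ z := by push_cast; linarith [h.1, hy.1]
    exact_mod_cast this
  · have : (z : ℝ) ≤ ((b : ℤ) : ℝ) := by push_cast; linarith [h.2, hy.2]
    exact_mod_cast this

/-- The real vector of a pair of bounded integer vectors. -/
def netVec (D : Finset V) {b c : ℕ} (p : ({i // i ∉ D} → ↥(Finset.Icc (-b : ℤ) b)) ×
    ({j // j ∈ D} → ↥(Finset.Icc (-c : ℤ) c))) (i : V) : ℝ :=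
  if h : i ∈ D then ((p.2 ⟨i, h⟩ : ℤ) : ℝ) else ((p.1 ⟨i, h⟩ : ℤ) : ℝ)

theorem BlockEvent.exists_mem_blockNet {n : ℕ} (hn : Fintype.card V = n) (hn2 : 2 ≤ n)
    {D : Finset V} {N : ℕ} (hN : 512 ≤ N) {L : ℝ} {x e : V → ℝ}
    (he : ∀ (s r : ℝ) (m : ℕ), 0 < r → ∑ i, (s * x i) ^ 2 ≤ (r * m) ^ 2 →
      ∃ k ∈ Finset.Icc (-m : ℤ) m, ∑ i, (s * x i - k * r * e i) ^ 2 ≤ r ^ 2)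
    {A : Sym2 V → Bool} (h : BlockEvent D N L x A) :
    ∃ p ∈ blockNet {i // i ∉ D} {j // j ∈ D} n N (2 * N * n) L,
      ∃ k ∈ Finset.Icc (-(6 * N * n : ℕ) : ℤ) (6 * N * n : ℕ),
      (∃ v : V → ℝ, (∀ i, |netVec D p i - N * v i| ≤ 1) ∧
        blockf n (fun i : {i // i ∉ D} => 1 / 2 * (N * v i))
          (fun j : {j // j ∈ D} => 1 / 2 * (N * v j)) ≤ (2 * L / N) ^ n) ∧
      OpGood A ∧ ∑ i, (av A (netVec D p) i - k * n * e i) ^ 2 ≤ 66 * (n : ℝ) ^ 2 := by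
  obtain ⟨hop, v, hv, ⟨s, hs⟩, hD, hlow, hup⟩ := h
  rw [hn] at hv hlow hup
  have hn' : (2 : ℝ) ≤ n := by exact_mod_cast hn2
  have hN' : (512 : ℝ) ≤ N := by exact_mod_cast hN
  obtain ⟨X, hX, hXf⟩ := exists_glue_round D hn (fun i => N * v i)
  obtain ⟨k, hk, hk2⟩ := hop.exists_line_point hn hn2 (N := N) (by omega) he hv hs
  have hvn := abs_le_sqrt_of_sum_sq_eq hv
  have hsqn : √(n : ℝ) ≤ n := by
    rw [sqrt_le_left (by linarith)]
    nlinarith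
  have hXb : ∀ i, X i ∈ Finset.Icc (-(2 * N * n : ℕ) : ℤ) (2 * N * n : ℕ) := fun i =>
    mem_Icc_of_abs_sub_le (c := N * n) (hX i) (by
      rw [abs_mul, Nat.abs_cast]
      exact mul_le_mul_of_nonneg_left ((hvn i).trans hsqn) (by positivity))
      (by push_cast; nlinarith)
  have hYb : ∀ j : {j // j ∈ D}, X j ∈ Finset.Icc (-(2 * 512 * N : ℕ) : ℤ) (2 * 512 * N : ℕ) :=
    fun j => mem_Icc_of_abs_sub_le (c := N * 512) (hX j) (by
      rw [abs_mul, Nat.abs_cast]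
      exact mul_le_mul_of_nonneg_left (hD j j.2).2 (by positivity))
      (by push_cast; linarith)
  have hZ : netVec D (b := 2 * N * n) (c := 2 * 512 * N)
      (fun i => ⟨X i, hXb i⟩, fun j => ⟨X j, hYb j⟩) = fun i => (X i : ℝ) := by
    funext i
    simp [netVec]
  refine ⟨(fun i => ⟨X i, hXb i⟩, fun j => ⟨X j, hYb j⟩), ?_, k, hk, ⟨v, ?_, hup⟩, hop, ?_⟩
  · refine Finset.mem_filter.2 ⟨Finset.mem_univ _, fun j => ?_,
      sum_sq_round_le hn D (by omega) hv hX, ?_⟩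
    · have h2 : (N : ℝ) * (1 / 256) ≤ |N * v j| := by
        rw [abs_mul, Nat.abs_cast]
        exact mul_le_mul_of_nonneg_left (hD j j.2).1 (by positivity)
      have h1 := hX j
      have h3 := abs_sub_abs_le_abs_sub ((N : ℝ) * v j) (X j)
      rw [abs_sub_comm] at h3
      show 1 / 256 * (N : ℝ) / 2 ≤ |(X j : ℝ)|
      linarith
    · exact (mul_le_mul_of_nonneg_left hlow (exp_pos _).le).trans hXf
  · rw [hZ]
    exact hX
  · rw [hZ]
    exact hop.sum_sq_round_sub_le hn hX hs hk2

theorem pr_blockEvent_le {n : ℕ} (hn : Fintype.card V = n) (hn2 : 2 ≤ n) (D : Finset V) {N : ℕ}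
    (hN : 512 ≤ N) {L : ℝ} (hL : 0 ≤ L) (x : V → ℝ) {M : ℝ}
    (hM : ((blockNet {i // i ∉ D} {j // j ∈ D} n N (2 * N * n) L).card : ℝ) ≤ M) :
    pr (BlockEvent D N L x) ≤ M * (12 * N * n + 1) * (exp (25 * n) * (2 * L / N) ^ n) := by
  classical
  obtain ⟨e, he⟩ := exists_line_net x
  have hp0 : 0 ≤ exp (25 * (n : ℝ)) * (2 * L / N) ^ n := by positivity
  refine (pr_mono (Q := fun A : Sym2 V → Bool =>
    ∃ q ∈ blockNet {i // i ∉ D} {j // j ∈ D} n N (2 * N * n) L ×ˢ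
      Finset.Icc (-(6 * N * n : ℕ) : ℤ) (6 * N * n : ℕ),
      (∃ v : V → ℝ, (∀ i, |netVec D q.1 i - N * v i| ≤ 1) ∧
        blockf n (fun i : {i // i ∉ D} => 1 / 2 * (N * v i))
          (fun j : {j // j ∈ D} => 1 / 2 * (N * v j)) ≤ (2 * L / N) ^ n) ∧
      OpGood A ∧ ∑ i, (av A (netVec D q.1) i - q.2 * n * e i) ^ 2 ≤ 66 * (n : ℝ) ^ 2) ?_).trans
    ((pr_exists_le_card _ _ (p := exp (25 * n) * (2 * L / N) ^ n) ?_).trans ?_)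
  · intro A hA
    obtain ⟨p, hp, k, hk, h⟩ := hA.exists_mem_blockNet hn hn2 hN he
    exact ⟨(p, k), Finset.mem_product.2 ⟨hp, hk⟩, h⟩
  · rintro ⟨p, k⟩ -
    by_cases hw : ∃ v : V → ℝ, (∀ i, |netVec D p i - N * v i| ≤ 1) ∧
        blockf n (fun i : {i // i ∉ D} => 1 / 2 * (N * v i))
          (fun j : {j // j ∈ D} => 1 / 2 * (N * v j)) ≤ (2 * L / N) ^ n
    · obtain ⟨v, hv1, hv2⟩ := hw
      subst hn
      exact (pr_mono fun A hA => hA.2).trans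
        (pr_blockEvent_step hn2 D N (netVec D p) v (fun i => k * _ * e i) hv1 hv2)
    · refine le_trans (le_of_eq ?_) hp0
      simp only [hw, false_and]
      simp [pr]
  · rw [Finset.card_product, Int.card_Icc]
    have h1 : (((6 * N * n : ℕ) : ℤ) + 1 - -((6 * N * n : ℕ) : ℤ)).toNat = 2 * (6 * N * n) + 1 := by
      omega
    rw [h1]
    push_cast
    refine mul_le_mul_of_nonneg_right ?_ hp0
    refine mul_le_mul hM (by linarith) (by positivity) ((Nat.cast_nonneg _).trans hM)

end

end SymSing

namespace SymSing

open scoped BigOperators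

open Real

theorem blockf_le_one {R D : Type} [Fintype R] [Fintype D] [DecidableEq R] [DecidableEq D]
    (n : ℕ) (x : R → ℝ) (y : D → ℝ) : blockf n x y ≤ 1 := by
  refine expect_le_of_forall_le fun h => exp_le_one_iff.2 ?_
  exact div_nonpos_of_nonpos_of_nonneg (neg_nonpos.2 (blockq_nonneg _ _ _)) (by positivity)

theorem scale_pow_le {L N c : ℝ} {n r d : ℕ} (hrd : r + d = n) (hd : 4 * d ≤ n) (hL : 1 ≤ L)
    (hN : 1 ≤ N) (hNc : c * n - 1 ≤ 2 * log N) (hc : 0 ≤ c) (hn : log (3 * L) + 1 ≤ c * n / 8) :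
    (L / N) ^ n ≤ (exp (-(c / 24 * n)) ^ 3) ^ r * (1 / (3 * N)) ^ d := by
  have hL0 : 0 < L := by linarith
  have hN0 : 0 < N := by linarith
  rw [log_mul (by norm_num) hL0.ne'] at hn
  have hlL : 0 ≤ log L := log_nonneg hL
  have hlN : 0 ≤ log N := log_nonneg hN
  have hl3 : 0 ≤ log (3 : ℝ) := log_nonneg (by norm_num)
  have h1 : L / N = exp (log L - log N) := by rw [exp_sub, exp_log hL0, exp_log hN0]
  have h2 : 1 / (3 * N) = exp (-(log 3 + log N)) := by
    rw [exp_neg, exp_add, exp_log hN0, exp_log (by norm_num), one_div]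
  rw [h1, h2, ← exp_nat_mul, ← exp_nat_mul, ← exp_nat_mul, ← exp_nat_mul, ← exp_add, exp_le_exp]
  have hr : (r : ℝ) ≤ n := by exact_mod_cast (by omega : r ≤ n)
  have hd' : (d : ℝ) ≤ n / 4 := by
    rw [le_div_iff₀ (by norm_num)]
    exact_mod_cast (by omega : d * 4 ≤ n)
  have h3 : (d : ℝ) * (log 3 + log N) ≤ n / 4 * (log 3 + log N) :=
    mul_le_mul_of_nonneg_right hd' (by linarith)
  have h4 : (r : ℝ) * (c / 8 * n) ≤ n * (c / 8 * n) :=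
    mul_le_mul_of_nonneg_right hr (by positivity)
  have h5 : (n : ℝ) * (log L + c / 8 * n + (log 3 + log N) / 4) ≤ n * log N :=
    mul_le_mul_of_nonneg_left (by linarith) (by positivity)
  push_cast
  linarith

section

variable {V : Type} [Fintype V] [DecidableEq V]

/-- The first dyadic scale at which the block function exceeds the threshold. -/
theorem exists_dyadic_scale {n : ℕ} (hn0 : 0 < n) (hn : Fintype.card V = n) {D : Finset V}
    (hd : 4 * D.card ≤ n) {L c : ℝ} (hL : 512 ≤ L) (hc : 0 < c) (hc1 : c ≤ 1)
    (hnc : log (3 * L) + 1 ≤ c * n / 8) {v : V → ℝ} (hv : ∑ i, v i ^ 2 = n)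
    (hrow : ∀ N : ℝ, exp (-(c / 24 * n)) ≤ rowf n fun j : {j // j ∈ D} => N * v j) :
    ∃ j ∈ Finset.range (n + 1), 512 ≤ 2 ^ j ∧ ((2 ^ j : ℕ) : ℝ) ≤ exp (c * n) ∧
      (L / (2 ^ j : ℕ)) ^ n ≤ blockf n (fun i : {i // i ∉ D} => ((2 ^ j : ℕ) : ℝ) * v i)
        (fun i : {j // j ∈ D} => ((2 ^ j : ℕ) : ℝ) * v i) ∧
      blockf n (fun i : {i // i ∉ D} => 1 / 2 * (((2 ^ j : ℕ) : ℝ) * v i))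
        (fun i : {j // j ∈ D} => 1 / 2 * (((2 ^ j : ℕ) : ℝ) * v i)) ≤
          (2 * L / (2 ^ j : ℕ)) ^ n := by
  classical
  have hcard : Fintype.card {i // i ∉ D} + Fintype.card {j // j ∈ D} = n := by
    rw [Fintype.card_subtype_compl, Fintype.card_coe]
    have := D.card_le_univ
    omega
  have hlow : ∃ j : ℕ, (L / (2 ^ j : ℕ)) ^ n ≤
      blockf n (fun i : {i // i ∉ D} => ((2 ^ j : ℕ) : ℝ) * v i)
        (fun i : {j // j ∈ D} => ((2 ^ j : ℕ) : ℝ) * v i) ∧ (j : ℝ) ≤ c * n := by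
    refine ⟨⌊c * n⌋₊, ?_, Nat.floor_le (by positivity)⟩
    have hN1 : (1 : ℝ) ≤ ((2 ^ ⌊c * (n : ℝ)⌋₊ : ℕ) : ℝ) := by
      push_cast
      exact one_le_pow₀ (by norm_num)
    have hsum : ∑ i : {i // i ∉ D}, (((2 ^ ⌊c * (n : ℝ)⌋₊ : ℕ) : ℝ) * v i) ^ 2 ≤
        ((2 ^ ⌊c * (n : ℝ)⌋₊ : ℕ) : ℝ) ^ 2 * n := by
      simp_rw [mul_pow, ← Finset.mul_sum]
      refine mul_le_mul_of_nonneg_left ?_ (by positivity)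
      rw [← hv, ← sum_mem_add_sum_notMem D]
      exact le_add_of_nonneg_left (Finset.sum_nonneg fun _ _ => sq_nonneg _)
    refine le_trans ?_ (le_blockf hn0 _ _ hN1 hsum)
    have h3 : (exp (-(c / 24 * n)) ^ 3) ^ Fintype.card {i // i ∉ D} ≤
        (rowf n (fun i : {j // j ∈ D} => ((2 ^ ⌊c * (n : ℝ)⌋₊ : ℕ) : ℝ) * v i) ^ 3) ^
          Fintype.card {i // i ∉ D} :=
      pow_le_pow_left₀ (by positivity) (pow_le_pow_left₀ (exp_pos _).le (hrow _) _) _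
    refine le_trans ?_ (mul_le_mul_of_nonneg_right h3 (by positivity))
    refine scale_pow_le hcard (by rwa [Fintype.card_coe]) (by linarith) hN1 ?_ hc.le hnc
    push_cast
    rw [log_pow]
    have h4 := Nat.lt_floor_add_one (c * (n : ℝ))
    have h5 : (1 / 2 : ℝ) ≤ log 2 := by linarith [log_two_gt_d9]
    have h6 : (⌊c * (n : ℝ)⌋₊ : ℝ) * (1 / 2) ≤ ⌊c * (n : ℝ)⌋₊ * log 2 :=
      mul_le_mul_of_nonneg_left h5 (Nat.cast_nonneg _)
    linarith
  have hspec := Nat.find_spec hlow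
  have hmin := fun m => Nat.find_min hlow (m := m)
  set j := Nat.find hlow with hj
  have hjn : j ≤ n := by
    have h1 : (j : ℝ) ≤ n := hspec.2.trans (by nlinarith [Nat.cast_nonneg (α := ℝ) n])
    exact_mod_cast h1
  have h512 : (512 : ℝ) ≤ ((2 ^ j : ℕ) : ℝ) := by
    have h1 := hspec.1.trans (blockf_le_one _ _ _)
    have hp : (0 : ℝ) < ((2 ^ j : ℕ) : ℝ) := by positivity
    by_contra hcon
    push Not at hcon
    have h2 : 1 < L / ((2 ^ j : ℕ) : ℝ) := by
      rw [one_lt_div hp]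
      linarith
    exact absurd h1 (not_le.2 (one_lt_pow₀ h2 hn0.ne'))
  have hj1 : j ≠ 0 := by
    intro h0
    rw [h0] at h512
    norm_num at h512
  obtain ⟨m, hm⟩ := Nat.exists_eq_succ_of_ne_zero hj1
  refine ⟨j, Finset.mem_range.2 (by omega), by exact_mod_cast h512, ?_, hspec.1, ?_⟩
  · push_cast
    have h1 : (2 : ℝ) ^ j ≤ exp 1 ^ j :=
      pow_le_pow_left₀ (by norm_num) (by linarith [exp_one_gt_d9]) _
    refine h1.trans ?_
    rw [← exp_nat_mul, mul_one]
    exact exp_le_exp.2 hspec.2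
  · have h1 := hmin m (by omega)
    rw [not_and_or] at h1
    have hmj : (m : ℝ) ≤ j := by exact_mod_cast (by omega : m ≤ j)
    have h2 := h1.resolve_right (not_not.2 (hmj.trans hspec.2))
    have e1 : ((2 ^ m : ℕ) : ℝ) = 1 / 2 * ((2 ^ j : ℕ) : ℝ) := by
      rw [hm]
      push_cast
      rw [pow_succ]
      ring
    rw [not_le, e1] at h2
    simp_rw [mul_assoc] at h2
    refine h2.le.trans_eq ?_
    congr 1
    field_simp

/-- Some unit-scale vector with large concentration along `I` is mapped to the line of `x`. -/
def StructEvent (I : Finset V) (t : ℝ) (x : V → ℝ) (A : Sym2 V → Bool) : Prop :=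
  OpGood A ∧ ∃ v : V → ℝ, ∑ i, v i ^ 2 = Fintype.card V ∧ (∃ s, ∀ i, av A v i = s * x i) ∧
    ∃ a, t ≤ pr fun ε : V → Bool => ∑ i ∈ I, sg (ε i) * v i = a

theorem StructEvent.blockEvent_or {n : ℕ} (hn : Fintype.card V = n) (hn2 : 2 ^ 21 ≤ n) {L c : ℝ}
    (hL : 512 ≤ L) (hc : 0 < c) (hc1 : c ≤ 1) (hnc : log (3 * L) + 1 ≤ c * n / 8) {I : Finset V}
    (hI : Iᶜ.card * 2 ^ 19 ≤ n) {x : V → ℝ} {A : Sym2 V → Bool}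
    (h : StructEvent I (exp (-(c / 24 * n))) x A) :
    (OpGood A ∧ ∃ v : V → ℝ, ∑ i, v i ^ 2 = Fintype.card V ∧ (∃ s, ∀ i, av A v i = s * x i) ∧
      ((Finset.univ.filter fun i => 1 / 256 ≤ |v i| ∧ |v i| ≤ 512).card : ℝ) <
        Fintype.card V / 2 ^ 18) ∨
    ∃ q ∈ (Finset.univ ×ˢ Finset.range (n + 1) : Finset (Finset V × ℕ)).filter
        (fun q => q.1.card = n / 2 ^ 20 ∧ 512 ≤ 2 ^ q.2 ∧ ((2 ^ q.2 : ℕ) : ℝ) ≤ exp (c * n)),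
      BlockEvent q.1 (2 ^ q.2) L x A := by
  obtain ⟨hop, v, hv, hs, a, ha⟩ := h
  by_cases hS : ((Finset.univ.filter fun i => 1 / 256 ≤ |v i| ∧ |v i| ≤ 512).card : ℝ) <
      Fintype.card V / 2 ^ 18
  · exact Or.inl ⟨hop, v, hv, hs, hS⟩
  right
  set S := Finset.univ.filter fun i => 1 / 256 ≤ |v i| ∧ |v i| ≤ 512 with hSdef
  have hS2 : n ≤ S.card * 2 ^ 18 := by
    rw [not_lt, div_le_iff₀ (by norm_num), hn] at hS
    exact_mod_cast hS
  have hSI : n / 2 ^ 20 ≤ (S ∩ I).card := by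
    have h1 : S.card ≤ (S ∩ I).card + Iᶜ.card := by
      refine (Finset.card_le_card (t := (S ∩ I) ∪ Iᶜ) fun i hi => ?_).trans
        (Finset.card_union_le _ _)
      by_cases hiI : i ∈ I <;> simp [hi, hiI]
    omega
  obtain ⟨D, hDs, hDc⟩ := Finset.exists_subset_card_eq hSI
  rw [hn] at hv
  obtain ⟨j, hj, hj1, hj2, hj3, hj4⟩ := exists_dyadic_scale (D := D) (by omega : 0 < n) hn
    (by omega) hL hc hc1 hnc hv (fun N => ha.trans
      (pr_sum_eq_le_rowf (hDs.trans Finset.inter_subset_right) v a N))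
  refine ⟨(D, j), Finset.mem_filter.2
    ⟨Finset.mem_product.2 ⟨Finset.mem_univ _, hj⟩, hDc, hj1, hj2⟩, hop, v, by rw [hn, hv], hs, ?_,
    by rwa [hn], by rwa [hn]⟩
  intro i hi
  exact (Finset.mem_filter.1 (Finset.mem_inter.1 (hDs hi)).1).2

end

theorem block_count_le {K L N : ℝ} {n : ℕ} (hK : 0 < K) (hL : 0 < L) (hKL : 2 * K * exp 30 ≤ L)
    (hN : 1 ≤ N) (hNn : N ≤ exp n) (hn : 1 ≤ n) :
    (K * N / L ^ 2) ^ n * (12 * N * n + 1) * (exp (25 * n) * (2 * L / N) ^ n) ≤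
      13 * n * exp (-(4 * n)) := by
  have hn' : (1 : ℝ) ≤ n := by exact_mod_cast hn
  have hN0 : 0 < N := by linarith
  have h1 : (K * N / L ^ 2) ^ n * (12 * N * n + 1) * (exp (25 * n) * (2 * L / N) ^ n) =
      (2 * K * exp 25 / L) ^ n * (12 * N * n + 1) := by
    have : exp (25 * (n : ℝ)) = exp 25 ^ n := by rw [← exp_nat_mul, mul_comm]
    rw [this, ← mul_pow, mul_right_comm, ← mul_pow]
    congr 2
    field_simp
  have h2 : (2 * K * exp 25 / L) ^ n ≤ exp (-5) ^ n := by
    refine pow_le_pow_left₀ (by positivity) ?_ _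
    rw [div_le_iff₀ hL]
    calc 2 * K * exp 25 = exp (-5) * (2 * K * exp 30) := by
          rw [mul_left_comm, ← exp_add]; norm_num
      _ ≤ _ := mul_le_mul_of_nonneg_left hKL (exp_pos _).le
  have h3 : 12 * N * n + 1 ≤ 13 * n * exp n := by
    have : 1 ≤ (n : ℝ) * exp n := one_le_mul_of_one_le_of_one_le hn' (hN.trans hNn)
    have : N * n ≤ n * exp n := by rw [mul_comm]; exact mul_le_mul_of_nonneg_left hNn (by linarith)
    linarith
  rw [h1]
  refine (mul_le_mul h2 h3 (by positivity) (by positivity)).trans_eq ?_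
  have : exp (-(4 * (n : ℝ))) = exp (-5) ^ n * exp n := by
    rw [← exp_nat_mul, ← exp_add]
    congr 1
    ring
  rw [this]
  ring

theorem pr_structEvent_le : ∃ c > 0, ∃ n₀ : ℕ, ∀ (V : Type) [Fintype V] [DecidableEq V],
    n₀ ≤ Fintype.card V → ∀ I : Finset V, Iᶜ.card * 2 ^ 19 ≤ Fintype.card V → ∀ x : V → ℝ,
      pr (StructEvent I (exp (-(c * Fintype.card V))) x) ≤
        (2000 * Fintype.card V) * exp (-(Fintype.card V / 1000)) := by
  obtain ⟨K, hK, hnet⟩ := card_blockNet_le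
  set L : ℝ := max 512 (2 * K * exp 30) with hL
  have hL1 : 512 ≤ L := le_max_left _ _
  have hL2 : 2 * K * exp 30 ≤ L := le_max_right _ _
  obtain ⟨c, hc, n₀, hnet⟩ := hnet L (by linarith)
  have hc0 : 0 < min c 1 := lt_min hc one_pos
  refine ⟨min c 1 / 24, by positivity,
    max (max n₀ (2 ^ 21)) ⌈8 * (log (3 * L) + 1) / min c 1⌉₊, ?_⟩
  intro V _ _ hV I hI x
  obtain ⟨n, hn⟩ : ∃ n, Fintype.card V = n := ⟨_, rfl⟩
  rw [hn] at hV hI ⊢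
  have hn0 : n₀ ≤ n := (le_max_left _ _).trans ((le_max_left _ _).trans hV)
  have hn1 : 2 ^ 21 ≤ n := (le_max_right _ _).trans ((le_max_left _ _).trans hV)
  have hn2 : log (3 * L) + 1 ≤ min c 1 * n / 8 := by
    have h1 := Nat.ceil_le.1 ((le_max_right _ _).trans hV)
    rw [div_le_iff₀ hc0] at h1
    linarith
  have hn' : (1 : ℝ) ≤ n := by exact_mod_cast (by omega : 1 ≤ n)
  refine (pr_mono fun A hA => StructEvent.blockEvent_or hn hn1 hL1 hc0 (min_le_right _ _) hn2 hI
    hA).trans ((pr_or_le _ _).trans ?_)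
  have hA1 := pr_compressible_le (by omega : 2 ≤ Fintype.card V) x
  have hA2 := pr_exists_le_card
    ((Finset.univ ×ˢ Finset.range (n + 1) : Finset (Finset V × ℕ)).filter
        (fun q => q.1.card = n / 2 ^ 20 ∧ 512 ≤ 2 ^ q.2 ∧
          ((2 ^ q.2 : ℕ) : ℝ) ≤ exp (min c 1 * n)))
    (fun q => BlockEvent q.1 (2 ^ q.2) L x) (p := 13 * n * exp (-(4 * n))) (by
      rintro ⟨D, j⟩ hq
      obtain ⟨hD, h512, hj⟩ := (Finset.mem_filter.1 hq).2
      simp only at hD h512 hj ⊢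
      have hcard : Fintype.card {i // i ∉ D} + Fintype.card {j // j ∈ D} = n := by
        rw [Fintype.card_subtype_compl, Fintype.card_coe]
        have := D.card_le_univ
        omega
      have hd : 1 / 2 ^ 21 * (n : ℝ) ≤ Fintype.card {j // j ∈ D} := by
        rw [Fintype.card_coe, hD, one_div, inv_mul_le_iff₀ (by norm_num)]
        exact_mod_cast (by omega : n ≤ 2 ^ 21 * (n / 2 ^ 20))
      have hN1 : (1 : ℝ) ≤ ((2 ^ j : ℕ) : ℝ) := by
        push_cast
        exact one_le_pow₀ (by norm_num)
      have hM := hnet n hn0 {i // i ∉ D} {j // j ∈ D} hcard (by rw [Fintype.card_coe]; omega) hd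
        (2 ^ j) Nat.one_le_two_pow (hj.trans (exp_le_exp.2 (mul_le_mul_of_nonneg_right
          (min_le_left _ _) (by positivity)))) (2 * 2 ^ j * n)
      refine (pr_blockEvent_le hn (by omega) D h512 (by linarith) x hM).trans
        (block_count_le hK (by linarith) hL2 hN1 (hj.trans (exp_le_exp.2 ?_)) (by omega))
      exact (mul_le_mul_of_nonneg_right (min_le_right _ _) (by positivity)).trans_eq (one_mul _))
  rw [hn] at hA1
  refine (add_le_add (b := 1000 * n * exp (-(n / 1000))) (d := 1000 * n * exp (-(n / 1000)))
    ?_ (hA2.trans ?_)).trans_eq (by ring)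
  · simpa only [hn] using hA1
  · have hcard : ((((Finset.univ ×ˢ Finset.range (n + 1) : Finset (Finset V × ℕ)).filter
        (fun q => q.1.card = n / 2 ^ 20 ∧ 512 ≤ 2 ^ q.2 ∧
          ((2 ^ q.2 : ℕ) : ℝ) ≤ exp (min c 1 * n))).card : ℕ) : ℝ) ≤ exp n * exp n := by
      have h1 := Finset.card_filter_le
        (Finset.univ ×ˢ Finset.range (n + 1) : Finset (Finset V × ℕ))
        (fun q => q.1.card = n / 2 ^ 20 ∧ 512 ≤ 2 ^ q.2 ∧
          ((2 ^ q.2 : ℕ) : ℝ) ≤ exp (min c 1 * n))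
      rw [Finset.card_product, Finset.card_univ, Fintype.card_finset, Finset.card_range, hn] at h1
      refine (Nat.cast_le.2 h1).trans ?_
      push_cast
      refine mul_le_mul ?_ (add_one_le_exp _) (by positivity) (exp_pos _).le
      have h2 : (2 : ℝ) ^ n ≤ exp 1 ^ n :=
        pow_le_pow_left₀ (by norm_num) (by linarith [exp_one_gt_d9]) _
      rwa [← exp_nat_mul, mul_one] at h2
    refine (mul_le_mul_of_nonneg_right hcard (by positivity)).trans ?_
    have h3 : exp (n : ℝ) * exp n * (13 * n * exp (-(4 * n))) = 13 * n * exp (-(2 * n)) := by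
      have : exp (-(2 * (n : ℝ))) = exp (n : ℝ) * exp n * exp (-(4 * n)) := by
        rw [← exp_add, ← exp_add]
        congr 1
        ring
      rw [this]
      ring
    rw [h3]
    exact mul_le_mul (by linarith) (exp_le_exp.2 (by linarith)) (exp_pos _).le (by positivity)

end SymSing

namespace SymSing

open scoped BigOperators

open Real

theorem sq_expect_le {α : Type*} [Fintype α] [Nonempty α] (f : α → ℝ) :
    (𝔼 a, f a) ^ 2 ≤ 𝔼 a, f a ^ 2 := by
  have h := expect_nonneg' (f := fun a => (f a - 𝔼 b, f b) ^ 2) fun a => sq_nonneg _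
  have h1 : ∀ a, (f a - 𝔼 b, f b) ^ 2 = f a ^ 2 - f a * (2 * 𝔼 b, f b) + (𝔼 b, f b) ^ 2 := by
    intro a
    ring
  simp_rw [h1] at h
  rw [Finset.expect_add_distrib, Finset.expect_sub_distrib, ← Finset.expect_mul,
    Fintype.expect_const] at h
  linarith

theorem pr_prod {α β : Type*} [Fintype α] [Fintype β] (P : α × β → Prop) :
    pr P = 𝔼 a, pr fun b => P (a, b) := by
  unfold pr
  rw [expect_prod_type]

section

variable {V : Type} [Fintype V] [DecidableEq V]

/-- Join a function on a finset and a function on its complement. -/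
def join (I : Finset V) (X : {i // i ∈ I} → Bool) (W : {i // i ∉ I} → Bool) : V → Bool :=
  (Equiv.piEquivPiSubtypeProd (· ∈ I) fun _ => Bool).symm (X, W)

theorem join_mem {I : Finset V} (X : {i // i ∈ I} → Bool) (W : {i // i ∉ I} → Bool)
    (i : {i // i ∈ I}) : join I X W i = X i := by
  simp [join]

theorem join_notMem {I : Finset V} (X : {i // i ∈ I} → Bool) (W : {i // i ∉ I} → Bool)
    (i : {i // i ∉ I}) : join I X W i = W i := by
  simp [join, i.2]

theorem pr_eq_expect_join (I : Finset V) (P : (V → Bool) → Prop) :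
    pr P = 𝔼 X : {i // i ∈ I} → Bool, pr fun W : {i // i ∉ I} → Bool => P (join I X W) := by
  rw [← pr_equiv (Equiv.piEquivPiSubtypeProd (· ∈ I) fun _ => Bool).symm P, pr_prod]
  rfl

theorem pr_sum_eq (I : Finset V) (v : V → ℝ) (a : ℝ) :
    pr (fun X : {i // i ∈ I} → Bool => ∑ i, sg (X i) * v i = a) =
      pr (fun ε : V → Bool => ∑ i ∈ I, sg (ε i) * v i = a) := by
  rw [pr_eq_expect_join I]
  unfold pr
  refine Finset.expect_congr rfl fun X _ => ?_
  have h : ∀ W : {i // i ∉ I} → Bool,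
      ∑ i ∈ I, sg (join I X W i) * v i = ∑ i, sg (X i) * v i := by
    intro W
    rw [← Finset.sum_coe_sort]
    exact Finset.sum_congr rfl fun i _ => by rw [join_mem]
  simp_rw [h]
  rw [Fintype.expect_const]

theorem sq_pr_le_decouple (I : Finset V) (P : (V → Bool) → Prop) :
    pr P ^ 2 ≤ 𝔼 W : {i // i ∉ I} → Bool, 𝔼 W' : {i // i ∉ I} → Bool,
      pr fun X : {i // i ∈ I} → Bool => P (join I X W) ∧ P (join I X W') := by
  rw [pr_eq_expect_join I P]
  refine (sq_expect_le _).trans (le_of_eq ?_)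
  unfold pr
  simp_rw [sq, Finset.expect_mul_expect]
  rw [Finset.expect_comm]
  refine Finset.expect_congr rfl fun W _ => ?_
  rw [Finset.expect_comm]
  refine Finset.expect_congr rfl fun W' _ => Finset.expect_congr rfl fun X _ => ?_
  by_cases h1 : P (join I X W) <;> by_cases h2 : P (join I X W') <;> simp [h1, h2]

theorem sum_mul_av_comm (A : Sym2 V → Bool) (v w : V → ℝ) :
    ∑ i, av A v i * w i = ∑ i, v i * av A w i := by
  unfold av
  simp_rw [Finset.sum_mul, Finset.mul_sum]
  rw [Finset.sum_comm]
  refine Finset.sum_congr rfl fun i _ => Finset.sum_congr rfl fun j _ => ?_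
  rw [Sym2.eq_swap]
  ring

/-- The bordered system with border `Y` and corner `a` is solvable. -/
def Solve (B : Sym2 V → Bool) (a : ℝ) (Y : V → Bool) : Prop :=
  ∃ v : V → ℝ, (∀ i, av B v i = sg (Y i)) ∧ ∑ i, sg (Y i) * v i = a

theorem sum_join {I : Finset V} (X : {i // i ∈ I} → Bool) (W : {i // i ∉ I} → Bool) (u : V → ℝ) :
    ∑ i, sg (join I X W i) * u i =
      ∑ i, sg (X i) * u i + ∑ i, sg (W i) * u i := by
  rw [← sum_mem_add_sum_notMem I]
  simp_rw [join_mem, join_notMem]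

theorem pr_sum_eq_lt_of_not_structEvent {I : Finset V} {t : ℝ} {x : V → ℝ} {B : Sym2 V → Bool}
    (hop : OpGood B) (hS : ¬StructEvent I t x B) {u : V → ℝ} (hu : u ≠ 0) {s : ℝ}
    (hs : ∀ i, av B u i = s * x i) (a : ℝ) :
    pr (fun X : {i // i ∈ I} → Bool => ∑ i, sg (X i) * u i = a) < t := by
  by_contra hcon
  push Not at hcon
  have hpos : 0 < ∑ i, u i ^ 2 := by
    obtain ⟨i, hi⟩ := Function.ne_iff.1 hu
    exact Finset.sum_pos' (fun _ _ => sq_nonneg _) ⟨i, Finset.mem_univ _, by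
      simp only [Pi.zero_apply] at hi
      positivity⟩
  obtain ⟨i₀, -⟩ := Function.ne_iff.1 hu
  have hc : 0 < (Fintype.card V : ℝ) := by
    have : 0 < Fintype.card V := Fintype.card_pos_iff.2 ⟨i₀⟩
    exact_mod_cast this
  set l : ℝ := √(Fintype.card V / ∑ i, u i ^ 2) with hl
  have hl2 : l ^ 2 = Fintype.card V / ∑ i, u i ^ 2 := sq_sqrt (by positivity)
  have hl0 : 0 < l := sqrt_pos.2 (by positivity)
  refine hS ⟨hop, fun i => l * u i, ?_, ⟨l * s, fun i => ?_⟩, l * a, ?_⟩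
  · simp_rw [mul_pow, ← Finset.mul_sum, hl2]
    exact div_mul_cancel₀ _ hpos.ne'
  · rw [av_smul, hs, mul_assoc]
  · rw [pr_sum_eq] at hcon
    refine hcon.trans (pr_mono fun ε h => ?_)
    rw [← h, Finset.mul_sum]
    exact Finset.sum_congr rfl fun i _ => by ring

theorem pr_solve_le_of_singular {I : Finset V} {t : ℝ} {B : Sym2 V → Bool} {a : ℝ}
    {W : {i // i ∉ I} → Bool} {x : V → ℝ} (hop : OpGood B) (hS : ¬StructEvent I t x B)
    {w : V → ℝ} (hw : w ≠ 0) (hBw : ∀ i, av B w i = 0) :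
    pr (fun X : {i // i ∈ I} → Bool => Solve B a (join I X W)) ≤ t := by
  have hs : ∀ i, av B w i = 0 * x i := fun i => by rw [hBw, zero_mul]
  refine (pr_mono (Q := fun X : {i // i ∈ I} → Bool =>
    ∑ i, sg (X i) * w i = -∑ i, sg (W i) * w i) ?_).trans
    (pr_sum_eq_lt_of_not_structEvent hop hS hw hs _).le
  rintro X ⟨v, hv, -⟩
  have h := sum_mul_av_comm B v w
  have h1 : ∑ i, av B v i * w i = ∑ i, sg (join I X W i) * w i :=
    Finset.sum_congr rfl fun i _ => by rw [hv]
  have h2 : ∑ i, v i * av B w i = 0 := Finset.sum_eq_zero fun i _ => by rw [hBw, mul_zero]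
  rw [h1, h2, sum_join] at h
  linarith

theorem Solve.sum_join_eq {I : Finset V} {B : Sym2 V → Bool} {a : ℝ} {X : {i // i ∈ I} → Bool}
    {W W' : {i // i ∉ I} → Bool} {u : V → ℝ}
    (hu : ∀ i, av B u i = sg (join I X W i) - sg (join I X W' i))
    (hinj : ∀ u u' : V → ℝ, (∀ i, av B u i = av B u' i) → u = u')
    (h : Solve B a (join I X W)) (h' : Solve B a (join I X W')) :
    ∑ i, sg (X i) * u i = -(∑ i, sg (W i) * u i + ∑ i, sg (W' i) * u i) / 2 := by
  obtain ⟨v, hv, hva⟩ := h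
  obtain ⟨v', hv', hva'⟩ := h'
  obtain rfl : (fun i => v i - v' i) = u := hinj _ _ fun i => by rw [hu, av_sub, hv, hv']
  have h1 := sum_mul_av_comm B v v'
  have h3 : ∑ i, av B v i * v' i = ∑ i, sg (join I X W i) * v' i :=
    Finset.sum_congr rfl fun i _ => by rw [hv]
  have h4 : ∑ i, v i * av B v' i = ∑ i, sg (join I X W' i) * v i :=
    Finset.sum_congr rfl fun i _ => by rw [hv', mul_comm]
  rw [h3, h4] at h1
  have h5 := sum_join X W fun i => v i - v' i
  have h6 := sum_join X W' fun i => v i - v' i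
  have h7 : ∑ i, sg (join I X W i) * (v i - v' i) =
      ∑ i, sg (join I X W i) * v i - ∑ i, sg (join I X W i) * v' i := by
    simp_rw [mul_sub, Finset.sum_sub_distrib]
  have h8 : ∑ i, sg (join I X W' i) * (v i - v' i) =
      ∑ i, sg (join I X W' i) * v i - ∑ i, sg (join I X W' i) * v' i := by
    simp_rw [mul_sub, Finset.sum_sub_distrib]
  rw [h7] at h5
  rw [h8] at h6
  linarith

theorem pr_solve_pair_le {I : Finset V} {t : ℝ} (ht : 0 ≤ t) {B : Sym2 V → Bool} {a : ℝ}
    {W W' : {i // i ∉ I} → Bool} (hW : W ≠ W') {x : V → ℝ}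
    (hx : ∀ X i, x i = sg (join I X W i) - sg (join I X W' i))
    (hop : OpGood B) (hS : ¬StructEvent I t x B) :
    pr (fun X : {i // i ∈ I} → Bool => Solve B a (join I X W) ∧ Solve B a (join I X W')) ≤ t := by
  by_cases hsing : ∃ w : V → ℝ, w ≠ 0 ∧ ∀ i, av B w i = 0
  · obtain ⟨w, hw, hBw⟩ := hsing
    exact (pr_mono fun X h => h.1).trans (pr_solve_le_of_singular hop hS hw hBw)
  push Not at hsing
  have hinj : ∀ u u' : V → ℝ, (∀ i, av B u i = av B u' i) → u = u' := by
    intro u u' h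
    by_contra hne
    obtain ⟨i, hi⟩ := hsing (fun i => u i - u' i) (fun h0 => hne (by
      funext i
      have := congrFun h0 i
      simp only [Pi.zero_apply] at this
      linarith))
    rw [av_sub, h, sub_self] at hi
    exact hi rfl
  by_cases hex : ∃ X : {i // i ∈ I} → Bool, Solve B a (join I X W) ∧ Solve B a (join I X W')
  swap
  · push Not at hex
    refine le_trans (le_of_eq ?_) ht
    unfold pr
    refine (Finset.expect_congr rfl fun X _ => if_neg ?_).trans (by simp)
    exact fun h => hex X h.1 h.2
  obtain ⟨X₀, ⟨v₀, hv₀, -⟩, v₁, hv₁, -⟩ := hex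
  obtain ⟨u, hu⟩ : ∃ u : V → ℝ, ∀ i, av B u i = x i :=
    ⟨fun i => v₀ i - v₁ i, fun i => by rw [av_sub, hv₀, hv₁, hx X₀]⟩
  have hu0 : u ≠ 0 := by
    rintro rfl
    apply hW
    funext i
    have h1 := hu i
    rw [hx X₀, join_notMem, join_notMem] at h1
    have h2 : sg (W i) = sg (W' i) := by
      have h0 : av B 0 (i : V) = 0 := by simp [av]
      linarith
    revert h2
    cases W i <;> cases W' i <;> norm_num [sg]
  have hs : ∀ i, av B u i = 1 * x i := fun i => by rw [hu, one_mul]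
  refine (pr_mono fun X h => ?_).trans (pr_sum_eq_lt_of_not_structEvent hop hS hu0 hs
    (-(∑ i, sg (W i) * u i + ∑ i, sg (W' i) * u i) / 2)).le
  exact h.1.sum_join_eq (fun i => by rw [hu, hx X]) hinj h.2

theorem pr_eq_const (I : Finset V) (W : {i // i ∉ I} → Bool) :
    pr (fun W' => W = W') = (1 / 2) ^ Iᶜ.card := by
  classical
  unfold pr
  rw [Fintype.expect_eq_sum_div_card]
  have h : ∑ W' : {i // i ∉ I} → Bool, (if W = W' then (1 : ℝ) else 0) = 1 := by simp
  have h2 : Fintype.card ({i // i ∉ I} → Bool) = 2 ^ Iᶜ.card := by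
    rw [Fintype.card_fun, Fintype.card_bool, Fintype.card_subtype_compl, Fintype.card_coe,
      Finset.card_compl]
  rw [h2, one_div_pow, Nat.cast_pow, Nat.cast_ofNat]
  congr 1
  convert h

open Classical in
/-- A decoupled bound for the probability that a random bordered system is solvable. -/
theorem sq_expect_pr_solve_le {I : Finset V} {t η : ℝ} (ht : 0 ≤ t) (hη : 0 ≤ η)
    (hV : 0 < Fintype.card V)
    (h : ∀ x : V → ℝ, pr (StructEvent I t x) ≤ η) (a : ℝ) :
    (𝔼 B : Sym2 V → Bool, pr (Solve B a)) ^ 2 ≤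
      (1 / 2) ^ Iᶜ.card + (t + exp (-Fintype.card V) + η) := by
  refine (sq_expect_le _).trans ((expect_mono fun B => sq_pr_le_decouple I (Solve B a)).trans ?_)
  rw [Finset.expect_comm]
  refine expect_le_of_forall_le fun W => ?_
  rw [Finset.expect_comm]
  refine (expect_mono (g := fun W' => (if W = W' then (1 : ℝ) else 0) +
    (t + exp (-Fintype.card V) + η)) fun W' => ?_).trans ?_
  · by_cases hW : W = W'
    · rw [if_pos hW]
      refine le_trans (b := 1) (expect_le_of_forall_le fun B => pr_le_one _) ?_
      have := exp_pos (-(Fintype.card V : ℝ))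
      linarith
    · rw [if_neg hW, zero_add]
      obtain ⟨x, hx⟩ : ∃ x : V → ℝ, ∀ X i, x i = sg (join I X W i) - sg (join I X W' i) := by
        refine ⟨fun i => if hi : i ∈ I then 0 else sg (W ⟨i, hi⟩) - sg (W' ⟨i, hi⟩), fun X i => ?_⟩
        by_cases hi : i ∈ I
        · simp [join, hi]
        · simp [join, hi]
      have hB : ∀ B : Sym2 V → Bool,
          pr (fun X : {i // i ∈ I} → Bool => Solve B a (join I X W) ∧ Solve B a (join I X W')) ≤
          t + ((if ¬OpGood B then 1 else 0) + if StructEvent I t x B then 1 else 0) := by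
        intro B
        by_cases hop : OpGood B
        · by_cases hS : StructEvent I t x B
          · simp only [hop, hS, not_true, if_false, if_true]
            have := pr_le_one (fun X : {i // i ∈ I} → Bool =>
              Solve B a (join I X W) ∧ Solve B a (join I X W'))
            linarith
          · simp only [hop, hS, not_true, if_false]
            linarith [pr_solve_pair_le (a := a) ht hW hx hop hS]
        · simp only [hop, not_false_eq_true, if_true]
          have := pr_le_one (fun X : {i // i ∈ I} → Bool =>
              Solve B a (join I X W) ∧ Solve B a (join I X W'))
          have h0 : (0 : ℝ) ≤ if StructEvent I t x B then 1 else 0 := by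
            split_ifs <;> norm_num
          linarith
      refine (expect_mono hB).trans ?_
      rw [Finset.expect_add_distrib, Finset.expect_add_distrib, Fintype.expect_const]
      have h1 := pr_not_opGood_le hV
      have h2 := h x
      have e1 : (𝔼 B : Sym2 V → Bool, if ¬OpGood B then (1 : ℝ) else 0) =
          pr fun B : Sym2 V → Bool => ¬OpGood B := by
        unfold pr
        congr! 2
      have e2 : (𝔼 B : Sym2 V → Bool, if StructEvent I t x B then (1 : ℝ) else 0) =
          pr (StructEvent I t x) := by
        unfold pr
        congr! 2
      rw [e1, e2]
      linarith
  · rw [Finset.expect_add_distrib, Fintype.expect_const]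
    have e1 : (𝔼 W' : {i // i ∉ I} → Bool, if W = W' then (1 : ℝ) else 0) =
        pr fun W' => W = W' := by
      unfold pr
      congr! 2
    rw [e1, pr_eq_const]

end

end SymSing

namespace SymSing

open scoped BigOperators

open Real

theorem bijective_sym2_option (V : Type) :
    Function.Bijective (Sum.elim (Sym2.map some) fun o => s(none, o) :
      Sym2 V ⊕ Option V → Sym2 (Option V)) := by
  constructor
  · rintro (a | a) (b | b) h
    · exact congrArg _ (Sym2.map.injective (Option.some_injective V) h)
    · induction a with | _ x y => simp at h
    · induction b with | _ x y => simp at h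
    · simp only [Sum.elim_inr, Sym2.congr_right] at h
      rw [h]
  · intro z
    induction z with | _ x y =>
    rcases x with _ | x
    · exact ⟨Sum.inr y, rfl⟩
    · rcases y with _ | y
      · exact ⟨Sum.inr (some x), Sym2.eq_swap⟩
      · exact ⟨Sum.inl s(x, y), rfl⟩

/-- A random symmetric sign pattern consists of a minor, a corner and a border. -/
theorem exists_border_equiv (V : Type) :
    ∃ E : (Sym2 V → Bool) × (Bool × (V → Bool)) ≃ (Sym2 (Option V) → Bool),
      ∀ p, E p s(none, none) = p.2.1 ∧ (∀ i, E p s(none, some i) = p.2.2 i) ∧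
        ∀ i j, E p s(some i, some j) = p.1 s(i, j) := by
  set e := Equiv.ofBijective _ (bijective_sym2_option V) with he
  refine ⟨((Equiv.prodCongr (Equiv.refl _) Equiv.piOptionEquivProd.symm).trans
    (Equiv.sumArrowEquivProdArrow _ _ _).symm).trans (Equiv.arrowCongr e (Equiv.refl _)), ?_⟩
  rintro ⟨B, z, Y⟩
  have h1 : e.symm s(none, none) = Sum.inr none := by rw [Equiv.symm_apply_eq]; rfl
  have h2 : ∀ i, e.symm s(none, some i) = Sum.inr (some i) := fun i => by
    rw [Equiv.symm_apply_eq]; rfl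
  have h3 : ∀ i j, e.symm s(some i, some j) = Sum.inl s(i, j) := fun i j => by
    rw [Equiv.symm_apply_eq]; rfl
  refine ⟨?_, fun i => ?_, fun i j => ?_⟩
  · simp [Equiv.arrowCongr, h1, Equiv.sumArrowEquivProdArrow]
  · simp [Equiv.arrowCongr, h2, Equiv.sumArrowEquivProdArrow]
  · simp [Equiv.arrowCongr, h3, Equiv.sumArrowEquivProdArrow]

theorem pr_kernel_option_le {V : Type} [Fintype V] [DecidableEq V] {p : ℝ}
    (h : ∀ a, 𝔼 B : Sym2 V → Bool, pr (Solve B a) ≤ p) :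
    pr (fun A : Sym2 (Option V) → Bool => ∃ v : Option V → ℝ, v none ≠ 0 ∧ ∀ i, av A v i = 0) ≤
      p := by
  obtain ⟨E, hE⟩ := exists_border_equiv V
  rw [← pr_equiv E]
  refine (pr_mono (Q := fun q => Solve q.1 (sg q.2.1) q.2.2) ?_).trans ?_
  · rintro q ⟨v, hv0, hv⟩
    obtain ⟨h1, h2, h3⟩ := hE q
    have h4 : ∀ i, E q s(some i, none) = q.2.2 i := fun i => by rw [Sym2.eq_swap, h2]
    refine ⟨fun i => -(v none)⁻¹ * v (some i), fun i => ?_, ?_⟩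
    · have := hv (some i)
      simp only [av, Fintype.sum_option, h4, h3] at this
      have e1 : av q.1 (fun i => v (some i)) i = -(sg (q.2.2 i) * v none) := by
        simp only [av]
        linarith
      rw [av_smul, e1]
      field_simp
    · have := hv none
      simp only [av, Fintype.sum_option, h1, h2] at this
      have e1 : ∑ i, sg (q.2.2 i) * (-(v none)⁻¹ * v (some i)) =
          -(v none)⁻¹ * ∑ i, sg (q.2.2 i) * v (some i) := by
        rw [Finset.mul_sum]
        exact Finset.sum_congr rfl fun i _ => by ring
      have e2 : ∑ i, sg (q.2.2 i) * v (some i) = -(sg q.2.1 * v none) := by linarith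
      rw [e1, e2]
      field_simp
  · rw [pr_prod]
    simp_rw [pr_prod]
    rw [Finset.expect_comm]
    exact expect_le_of_forall_le fun z => h (sg z)

theorem pr_kernel_ne_zero_eq {U W : Type} [Fintype U] [Fintype W] [DecidableEq U]
    [DecidableEq W] (e : U ≃ W) (i : U) :
    pr (fun A : Sym2 U → Bool => ∃ v : U → ℝ, v i ≠ 0 ∧ ∀ k, av A v k = 0) =
      pr (fun A : Sym2 W → Bool => ∃ v : W → ℝ, v (e i) ≠ 0 ∧ ∀ k, av A v k = 0) := by
  have hb : Function.Bijective (Sym2.map e) := by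
    refine ⟨Sym2.map.injective e.injective, fun z => ⟨Sym2.map e.symm z, ?_⟩⟩
    rw [Sym2.map_map]
    simp
  rw [← pr_equiv (Equiv.arrowCongr (Equiv.ofBijective _ hb) (Equiv.refl Bool)).symm]
  congr 1
  funext A
  have hA : ∀ a b, (Equiv.arrowCongr (Equiv.ofBijective _ hb) (Equiv.refl Bool)).symm A s(a, b) =
      A s(e a, e b) := fun a b => rfl
  refine propext ⟨?_, ?_⟩
  · rintro ⟨v, hv, h⟩
    refine ⟨fun k => v (e.symm k), by simpa using hv, fun k => ?_⟩
    have h1 := h (e.symm k)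
    simp only [av, hA] at h1 ⊢
    rw [← Equiv.sum_comp e]
    simpa using h1
  · rintro ⟨v, hv, h⟩
    refine ⟨fun k => v (e k), hv, fun k => ?_⟩
    have h1 := h (e k)
    simp only [av, hA] at h1 ⊢
    rwa [← Equiv.sum_comp e] at h1

/-- The sign pattern gives a matrix with a nontrivial kernel. -/
def Sing {V : Type} [Fintype V] (A : Sym2 V → Bool) : Prop :=
  ∃ v : V → ℝ, v ≠ 0 ∧ ∀ i, av A v i = 0

theorem pr_sing_succ_le {n : ℕ} {p : ℝ}
    (h : ∀ a, 𝔼 B : Sym2 (Fin n) → Bool, pr (Solve B a) ≤ p) :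
    pr (Sing : (Sym2 (Fin (n + 1)) → Bool) → Prop) ≤ (n + 1) * p := by
  refine (pr_mono (Q := fun A => ∃ i ∈ (Finset.univ : Finset (Fin (n + 1))),
    ∃ v : Fin (n + 1) → ℝ, v i ≠ 0 ∧ ∀ k, av A v k = 0) ?_).trans
    ((pr_exists_le_card _ _ (p := p) fun i _ => ?_).trans_eq ?_)
  · rintro A ⟨v, hv, hA⟩
    obtain ⟨i, hi⟩ := Function.ne_iff.1 hv
    exact ⟨i, Finset.mem_univ _, v, hi, hA⟩
  · rw [pr_kernel_ne_zero_eq (finSuccEquiv' i) i, finSuccEquiv'_at]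
    exact pr_kernel_option_le h
  · simp

theorem tail_sum_le {c κ : ℝ} {n k : ℕ} (hκc : κ ≤ c) (hκ1 : κ ≤ 1 / 2 ^ 20)
    (hk : n < (k + 1) * 2 ^ 19) (hn : 1 ≤ n) :
    (1 / 2) ^ k + (exp (-(c * n)) + exp (-n) + 2000 * n * exp (-(n / 1000))) ≤
      2004 * n * exp (-(κ * n)) := by
  have hn' : (1 : ℝ) ≤ n := by exact_mod_cast hn
  have hk' : (n : ℝ) < (k + 1) * 2 ^ 19 := by exact_mod_cast hk
  have hκn : κ * n ≤ 1 / 2 ^ 20 * n := mul_le_mul_of_nonneg_right hκ1 (by positivity)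
  have h0 : (1 / 2 : ℝ) ≤ exp (-(1 / 2)) := by
    have := add_one_le_exp (-(1 / 2) : ℝ)
    linarith
  have h1 : (1 / 2 : ℝ) ^ k ≤ 2 * exp (-(κ * n)) := by
    refine (pow_le_pow_left₀ (by norm_num) h0 k).trans ?_
    have h2 : exp (1 / 2 : ℝ) ≤ 2 := by
      have := exp_pos (1 / 2 : ℝ)
      rw [exp_neg] at h0
      rw [one_div, inv_le_inv₀ (by norm_num) (exp_pos _)] at h0
      simpa using h0
    refine le_trans ?_ (mul_le_mul_of_nonneg_right h2 (exp_pos _).le)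
    rw [← exp_nat_mul, ← exp_add, exp_le_exp]
    linarith
  have h2 : exp (-(c * n)) ≤ exp (-(κ * n)) := exp_le_exp.2 (by
    have := mul_le_mul_of_nonneg_right hκc (show (0 : ℝ) ≤ n by positivity)
    linarith)
  have h3 : exp (-(n : ℝ)) ≤ exp (-(κ * n)) := exp_le_exp.2 (by linarith)
  have h4 : exp (-((n : ℝ) / 1000)) ≤ exp (-(κ * n)) := exp_le_exp.2 (by linarith)
  have h5 : 2000 * n * exp (-((n : ℝ) / 1000)) ≤ 2000 * n * exp (-(κ * n)) :=
    mul_le_mul_of_nonneg_left h4 (by positivity)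
  have h6 : exp (-(κ * n)) ≤ n * exp (-(κ * n)) := le_mul_of_one_le_left (exp_pos _).le hn'
  linarith

theorem poly_mul_exp_le {κ : ℝ} (hκ : 0 < κ) (hκ1 : κ ≤ 1) {n : ℕ}
    (hn : 2004 * 24 * 16 * 3 / κ ^ 4 ≤ n) :
    ((n : ℝ) + 1) ^ 2 * (2004 * n * exp (-(κ * n))) ≤ exp (-(κ / 8 * (n + 1))) ^ 2 := by
  set m : ℝ := n + 1 with hm
  have hm1 : 1 ≤ m := by rw [hm]; linarith [Nat.cast_nonneg (α := ℝ) n]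
  have h1 := pow_div_factorial_le_exp (κ * m / 2) (by positivity) 4
  rw [div_le_iff₀ (by positivity)] at hn
  have h2 : 2004 * 3 * m ^ 3 ≤ exp (κ * m / 2) := by
    refine le_trans ?_ h1
    have h3 : 2004 * 24 * 16 * 3 ≤ m * κ ^ 4 :=
      hn.trans (mul_le_mul_of_nonneg_right (by linarith) (by positivity))
    have h4 := mul_le_mul_of_nonneg_right h3 (show (0 : ℝ) ≤ m ^ 3 by positivity)
    norm_num [Nat.factorial]
    nlinarith
  have h5 : exp (-(κ * n)) ≤ 3 * exp (-(κ * m)) := by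
    have h6 : exp κ ≤ 3 := (exp_le_exp.2 hκ1).trans (by linarith [exp_one_lt_d9])
    refine le_trans (le_of_eq ?_) (mul_le_mul_of_nonneg_right h6 (exp_pos _).le)
    rw [← exp_add, hm]
    congr 1
    ring
  calc m ^ 2 * (2004 * n * exp (-(κ * n))) ≤ m ^ 2 * (2004 * m * (3 * exp (-(κ * m)))) := by
        gcongr
        linarith
    _ = 2004 * 3 * m ^ 3 * exp (-(κ * m)) := by ring
    _ ≤ exp (κ * m / 2) * exp (-(κ * m)) := mul_le_mul_of_nonneg_right h2 (exp_pos _).le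
    _ ≤ _ := by
        rw [← exp_add, ← exp_nat_mul, exp_le_exp]
        push_cast
        nlinarith [mul_pos hκ (by linarith : 0 < m)]

theorem pr_sing_le_of_large : ∃ c > 0, ∃ n₀ : ℕ, ∀ n ≥ n₀,
    pr (Sing : (Sym2 (Fin n) → Bool) → Prop) ≤ exp (-c * n) := by
  obtain ⟨c, hc, n₀, h⟩ := pr_structEvent_le
  have hκ : 0 < min c (1 / 2 ^ 20) := lt_min hc (by norm_num)
  set κ := min c (1 / 2 ^ 20) with hκd
  have hκ1 : κ ≤ 1 / 2 ^ 20 := min_le_right _ _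
  refine ⟨κ / 8, by positivity, max (max n₀ 1) ⌈2004 * 24 * 16 * 3 / κ ^ 4⌉₊ + 1, fun m hm => ?_⟩
  obtain ⟨n, rfl⟩ : ∃ n, m = n + 1 := ⟨m - 1, by omega⟩
  have hm' := Nat.le_of_succ_le_succ hm
  have hn0 : n₀ ≤ n := (le_max_left _ _).trans ((le_max_left _ _).trans hm')
  have hn1 : 1 ≤ n := (le_max_right _ _).trans ((le_max_left _ _).trans hm')
  have hn2 := Nat.ceil_le.1 ((le_max_right _ _).trans hm')
  obtain ⟨J, -, hJ⟩ := Finset.exists_subset_card_eq (s := (Finset.univ : Finset (Fin n)))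
    (n := n / 2 ^ 19) (by rw [Finset.card_univ, Fintype.card_fin]; omega)
  set ζ : ℝ := 2004 * n * exp (-(κ * n)) with hζ
  have hsolve : ∀ a, 𝔼 B : Sym2 (Fin n) → Bool, pr (Solve B a) ≤ √ζ := by
    intro a
    refine (le_abs_self _).trans (abs_le_sqrt ?_)
    have h1 := sq_expect_pr_solve_le (V := Fin n) (I := Jᶜ) (t := exp (-(c * n)))
      (η := 2000 * n * exp (-(n / 1000))) (exp_pos _).le (by positivity)
      (by rw [Fintype.card_fin]; omega) (fun x => by
        have := h (Fin n) (by rwa [Fintype.card_fin]) Jᶜ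
          (by rw [compl_compl, hJ, Fintype.card_fin]; omega) x
        rwa [Fintype.card_fin] at this) a
    rw [compl_compl, hJ, Fintype.card_fin] at h1
    exact h1.trans (tail_sum_le (min_le_left _ _) hκ1 (by omega) hn1)
  refine (pr_sing_succ_le hsolve).trans ?_
  have h2 := poly_mul_exp_le hκ (hκ1.trans (by norm_num)) hn2
  have h3 : (((n : ℝ) + 1) * √ζ) ^ 2 ≤ exp (-(κ / 8 * (n + 1))) ^ 2 := by
    rw [mul_pow, sq_sqrt (by positivity)]
    exact h2
  refine (le_abs_self _).trans ((abs_le_of_sq_le_sq h3 (exp_pos _).le).trans_eq ?_)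
  push_cast
  congr 1
  ring

theorem exists_not_sing (n : ℕ) : ∃ A : Sym2 (Fin n) → Bool, ¬Sing A := by
  rcases n with _ | n
  · exact ⟨fun _ => true, fun ⟨v, hv, _⟩ => hv (Subsingleton.elim _ _)⟩
  classical
  refine ⟨fun z => decide ¬(z.IsDiag ∧ z ≠ s(0, 0)), ?_⟩
  rintro ⟨v, hv, h⟩
  have hA : ∀ i j : Fin (n + 1), sg (decide ¬(s(i, j).IsDiag ∧ s(i, j) ≠ s(0, 0))) =
      if i = j ∧ i ≠ 0 then -1 else 1 := by
    intro i j
    by_cases hij : i = j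
    · subst hij
      by_cases hi : i = 0 <;> simp [sg, hi]
    · simp [sg, hij]
  simp only [av, hA] at h
  have h0 : ∑ j, v j = 0 := by simpa using h 0
  have hs : ∀ i, i ≠ 0 → v i = 0 := by
    intro i hi
    have h1 := h i
    have h2 : ∀ j, (if i = j ∧ i ≠ 0 then (-1 : ℝ) else 1) * v j =
        v j - if i = j then 2 * v j else 0 := by
      intro j
      by_cases hij : i = j
      · rw [if_pos ⟨hij, hi⟩, if_pos hij]
        ring
      · simp [hij]
    simp_rw [h2, Finset.sum_sub_distrib, h0] at h1
    simp at h1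
    exact h1
  apply hv
  funext i
  by_cases hi : i = 0
  · rw [Finset.sum_eq_single 0 (fun j _ hj => hs j hj) (by simp)] at h0
    rw [hi, h0]
    rfl
  · exact hs i hi

theorem pr_lt_one {α : Type*} [Fintype α] {P : α → Prop} (h : ∃ a, ¬P a) : pr P < 1 := by
  classical
  obtain ⟨a, ha⟩ := h
  have : Nonempty α := ⟨a⟩
  unfold pr
  rw [Fintype.expect_eq_sum_div_card, div_lt_one (by exact_mod_cast Fintype.card_pos)]
  have h1 : ∑ b, (if P b then (1 : ℝ) else 0) < ∑ _b : α, (1 : ℝ) :=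
    Finset.sum_lt_sum (fun b _ => by split_ifs <;> norm_num) ⟨a, Finset.mem_univ _, by simp [ha]⟩
  refine lt_of_eq_of_lt ?_ (h1.trans_eq (by simp))
  exact Finset.sum_congr rfl fun b _ => by congr

theorem exists_rate (f : ℕ → ℝ) (hf : ∀ n, f n < 1) (m : ℕ) :
    ∃ c > 0, ∀ n < m, f n ≤ exp (-c * n) := by
  induction m with
  | zero => exact ⟨1, one_pos, fun n hn => absurd hn (Nat.not_lt_zero n)⟩
  | succ m ih =>
    obtain ⟨c, hc, h⟩ := ih
    have hm : 0 < 1 - f m := by linarith [hf m]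
    refine ⟨min c ((1 - f m) / (m + 1)), lt_min hc (by positivity), fun n hn => ?_⟩
    rcases Nat.lt_succ_iff_lt_or_eq.1 hn with hn | rfl
    · refine (h n hn).trans (exp_le_exp.2 ?_)
      exact mul_le_mul_of_nonneg_right (neg_le_neg (min_le_left _ _)) (Nat.cast_nonneg _)
    · have h1 : -((1 - f n) / (n + 1)) * n ≤ -min c ((1 - f n) / (n + 1)) * n :=
        mul_le_mul_of_nonneg_right (neg_le_neg (min_le_right _ _)) (Nat.cast_nonneg _)
      refine le_trans ?_ (exp_le_exp.2 h1)
      refine le_trans ?_ (add_one_le_exp _)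
      have h2 : (1 - f n) / (n + 1) * n ≤ 1 - f n := by
        rw [div_mul_eq_mul_div, div_le_iff₀ (by positivity)]
        nlinarith
      linarith

theorem pr_sing_le : ∃ c > 0, ∀ n : ℕ,
    pr (Sing : (Sym2 (Fin n) → Bool) → Prop) ≤ exp (-c * n) := by
  obtain ⟨c, hc, n₀, h⟩ := pr_sing_le_of_large
  obtain ⟨c', hc', h'⟩ := exists_rate (fun n => pr (Sing : (Sym2 (Fin n) → Bool) → Prop))
    (fun n => pr_lt_one (exists_not_sing n)) n₀
  refine ⟨min c c', lt_min hc hc', fun n => ?_⟩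
  rcases lt_or_ge n n₀ with hn | hn
  · exact (h' n hn).trans (exp_le_exp.2
      (mul_le_mul_of_nonneg_right (neg_le_neg (min_le_right _ _)) (Nat.cast_nonneg _)))
  · exact (h n hn).trans (exp_le_exp.2
      (mul_le_mul_of_nonneg_right (neg_le_neg (min_le_left _ _)) (Nat.cast_nonneg _)))

/-- The symmetric sign matrix of a sign pattern. -/
def signMatrix {n : ℕ} (A : Sym2 (Fin n) → Bool) : Matrix (Fin n) (Fin n) ℝ :=
  Matrix.of fun i j => sg (A s(i, j))

theorem signMatrix_injective (n : ℕ) :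
    Function.Injective (signMatrix : (Sym2 (Fin n) → Bool) → Matrix (Fin n) (Fin n) ℝ) := by
  intro A B h
  funext z
  induction z with | _ i j =>
  have h1 := congrFun (congrFun h i) j
  simp only [signMatrix, Matrix.of_apply] at h1
  revert h1
  cases A s(i, j) <;> cases B s(i, j) <;> norm_num [sg]

theorem range_signMatrix (n : ℕ) :
    Set.range (signMatrix : (Sym2 (Fin n) → Bool) → Matrix (Fin n) (Fin n) ℝ) =
      {A | A.IsSymm ∧ ∀ i j, A i j = 1 ∨ A i j = -1} := by
  ext M
  constructor
  · rintro ⟨A, rfl⟩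
    refine ⟨Matrix.IsSymm.ext fun i j => ?_, fun i j => ?_⟩
    · simp [signMatrix, Sym2.eq_swap]
    · simp only [signMatrix, Matrix.of_apply]
      cases A s(i, j) <;> simp [sg]
  · rintro ⟨hs, hM⟩
    classical
    refine ⟨Sym2.lift ⟨fun i j => decide (M i j = 1), fun i j => by beta_reduce; rw [hs.apply]⟩, ?_⟩
    ext i j
    simp only [signMatrix, Matrix.of_apply, Sym2.lift_mk]
    rcases hM i j with h | h <;> norm_num [sg, h]

theorem det_signMatrix_eq_zero_iff {n : ℕ} (A : Sym2 (Fin n) → Bool) :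
    (signMatrix A).det = 0 ↔ Sing A := by
  rw [← Matrix.exists_mulVec_eq_zero_iff]
  refine exists_congr fun v => and_congr_right fun _ => ?_
  rw [funext_iff]
  rfl

theorem pr_eq_ncard_div {α : Type*} [Fintype α] (P : α → Prop) :
    pr P = ({a | P a}.ncard : ℝ) / Fintype.card α := by
  classical
  unfold pr
  rw [Fintype.expect_eq_sum_div_card, Set.ncard_eq_toFinset_card']
  congr 1
  simp only [Finset.sum_boole]
  congr 2
  ext a
  simp

end SymSing

/-- **Singularity of random symmetric matrices (Campos–Jenssen–Michelen–Sahasrabudhe).**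
There is an absolute constant `c > 0` such that for every `n`, a uniformly random
`n × n` symmetric matrix with `{-1,1}` entries is singular with probability at most
`e^{-cn}`.  The probability is formulated by counting: the number of singular symmetric
sign matrices is at most `e^{-cn}` times the total number of symmetric sign matrices. -/
theorem symmetric_singularity :
    ∃ c : ℝ, 0 < c ∧ ∀ n : ℕ,
      ({A : Matrix (Fin n) (Fin n) ℝ |
          (A.IsSymm ∧ ∀ i j, A i j = 1 ∨ A i j = -1) ∧ A.det = 0}.ncard : ℝ) ≤
        Real.exp (-c * n) *
          {A : Matrix (Fin n) (Fin n) ℝ |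
            A.IsSymm ∧ ∀ i j, A i j = 1 ∨ A i j = -1}.ncard := by
  obtain ⟨c, hc, h⟩ := SymSing.pr_sing_le
  refine ⟨c, hc, fun n => ?_⟩
  have h1 : {A : Matrix (Fin n) (Fin n) ℝ |
      (A.IsSymm ∧ ∀ i j, A i j = 1 ∨ A i j = -1) ∧ A.det = 0} =
      SymSing.signMatrix '' {A : Sym2 (Fin n) → Bool | SymSing.Sing A} := by
    ext M
    have hM := Set.ext_iff.1 (SymSing.range_signMatrix n) M
    constructor
    · rintro ⟨h1, h2⟩
      obtain ⟨A, rfl⟩ := hM.2 h1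
      exact ⟨A, (SymSing.det_signMatrix_eq_zero_iff A).1 h2, rfl⟩
    · rintro ⟨A, hA, rfl⟩
      exact ⟨hM.1 ⟨A, rfl⟩, (SymSing.det_signMatrix_eq_zero_iff A).2 hA⟩
  have h2 := h n
  rw [SymSing.pr_eq_ncard_div, div_le_iff₀ (by exact_mod_cast Fintype.card_pos)] at h2
  rw [h1, ← SymSing.range_signMatrix, Set.ncard_image_of_injective _ (SymSing.signMatrix_injective n),
    ← Set.image_univ, Set.ncard_image_of_injective _ (SymSing.signMatrix_injective n),
    Set.ncard_univ, Nat.card_eq_fintype_card]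
  exact h2
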